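/- Let N ≥ 3, 0 < a < 1, let p : ℝ^N → (0,∞) be Hölder continuous of exponent γ ∈ (0,1), let g satisfy (g1) and let f satisfy (f1)–(f2). If φ(r) := max_{|x|=r} p(x) satisfies ∫_1^∞ t φ(t) dt < ∞, then there exists a classical solution u ∈ C²(ℝ^N) of the problem −Δu = p(x)(g(u) + f(u) + |∇u|^a) in ℝ^N, with u > 0 in ℝ^N and u(x) → 0 as |x| → ∞. -/

import Mathlib

open Filter Set MeasureTheory Bornology

/-- The Laplace operator on `ℝ^N`, as the sum of the second partial derivatives. -/
noncomputable def laplacianFn {N : ℕ} (u : EuclideanSpace ℝ (Fin N) → ℝ)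
    (x : EuclideanSpace ℝ (Fin N)) : ℝ :=
  ∑ i, fderiv ℝ (fun y => fderiv ℝ u y (EuclideanSpace.single i 1)) x (EuclideanSpace.single i 1)

section Brouwer

open Polynomial in
/-- Values at `1` of the polynomials `t ↦ det (1 + t • A)` are a fixed affine combination of values
at finitely many points in a prescribed interval `(0, δ)`. -/
lemma exists_det_one_add_eq_sum {E : Type*} [NormedAddCommGroup E] [NormedSpace ℝ E]
    [FiniteDimensional ℝ E] {δ : ℝ} (hδ : 0 < δ) :
    ∃ (s : Finset ℝ) (c : ℝ → ℝ), (∀ t ∈ s, 0 < t ∧ t < δ) ∧ ∑ t ∈ s, c t = 1 ∧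
      ∀ A : E →L[ℝ] E, (1 + A).det = ∑ t ∈ s, c t * (1 + t • A).det := by
  classical
  set d := Module.finrank ℝ E with hd
  set v : ℕ → ℝ := fun i => δ * ((i + 1) / (d + 2)) with hv
  have hinj : Function.Injective v := by
    intro i j hij
    have h1 : (0:ℝ) < d + 2 := by positivity
    simp only [hv] at hij
    have := mul_left_cancel₀ hδ.ne' hij
    field_simp at this
    exact_mod_cast (by linarith : (i:ℝ) = j)
  set s : Finset ℝ := (Finset.range (d + 1)).image v with hs
  have hcard : s.card = d + 1 := by
    rw [hs, Finset.card_image_of_injective _ hinj, Finset.card_range]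
  have hne : s.Nonempty := by
    rw [← Finset.card_pos, hcard]; omega
  refine ⟨s, fun t => (Lagrange.basis s id t).eval 1, ?_, ?_, ?_⟩
  · intro t ht
    obtain ⟨i, hi, rfl⟩ := Finset.mem_image.1 ht
    have hi' : (i : ℝ) + 1 ≤ d + 1 := by
      have := Finset.mem_range.1 hi
      exact_mod_cast this
    have h1 : (0:ℝ) < d + 2 := by positivity
    refine ⟨by positivity, ?_⟩
    have : ((i:ℝ) + 1) / (d + 2) < 1 := by
      rw [div_lt_one h1]; linarith
    nlinarith
  · rw [← Polynomial.eval_finsetSum, Lagrange.sum_basis (v := id) (fun _ _ _ _ h => h) hne]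
    simp
  · intro A
    let b := Module.finBasis ℝ E
    let M := LinearMap.toMatrix b b (A : E →ₗ[ℝ] E)
    let q : ℝ[X] := Matrix.det ((X : ℝ[X]) • M.map C + (1 : Matrix _ _ ℝ).map C)
    have hq : ∀ t : ℝ, q.eval t = (1 + t • A).det := by
      intro t
      have h1 : (1 + t • A).det =
          Matrix.det (LinearMap.toMatrix b b ((1 + t • A : E →L[ℝ] E) : E →ₗ[ℝ] E)) := by
        rw [LinearMap.det_toMatrix]
      rw [h1]
      have h2 : LinearMap.toMatrix b b ((1 + t • A : E →L[ℝ] E) : E →ₗ[ℝ] E) = 1 + t • M := by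
        rw [ContinuousLinearMap.toLinearMap_add, ContinuousLinearMap.toLinearMap_smul, map_add,
          map_smul]
        exact congrArg (· + t • M) (LinearMap.toMatrix_id b)
      rw [h2]
      change Polynomial.evalRingHom t q = _
      rw [RingHom.map_det]
      congr 1
      ext i j
      by_cases hij : i = j <;> simp [hij] <;> ring
    have hdeg : q.degree < s.card := by
      rw [hcard]
      have := Polynomial.natDegree_det_X_add_C_le M (1 : Matrix _ _ ℝ)
      rw [Fintype.card_fin] at this
      refine lt_of_le_of_lt (Polynomial.degree_le_natDegree) ?_
      exact_mod_cast Nat.lt_succ_of_le this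
    have hint := Lagrange.eq_interpolate (s := s) (v := id) (fun _ _ _ _ h => h) hdeg
    have h1 := hq 1
    rw [one_smul] at h1
    rw [← h1]
    conv_lhs => rw [hint]
    rw [Lagrange.interpolate_apply, Polynomial.eval_finsetSum]
    refine Finset.sum_congr rfl fun t _ => ?_
    simp [hq t, mul_comm]

variable {E : Type*} [NormedAddCommGroup E] [InnerProductSpace ℝ E] [FiniteDimensional ℝ E]

lemma image_ball_eq_of_open_of_boundary {h : E → E}
    (hc : ContinuousOn h (Metric.closedBall 0 1))
    (hin : ∀ x ∈ Metric.ball (0:E) 1, h x ∈ Metric.ball (0:E) 1)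
    (hbd : ∀ x : E, ‖x‖ = 1 → h x = x)
    (hop : ∀ x ∈ Metric.ball (0:E) 1, map h (nhds x) = nhds (h x)) :
    h '' Metric.ball 0 1 = Metric.ball 0 1 := by
  have hsub : h '' Metric.ball 0 1 ⊆ Metric.ball 0 1 := by
    rintro _ ⟨x, hx, rfl⟩; exact hin x hx
  have hopen : IsOpen (h '' Metric.ball 0 1) := by
    rw [isOpen_iff_mem_nhds]
    rintro _ ⟨x, hx, rfl⟩
    rw [← hop x hx]
    exact image_mem_map (Metric.isOpen_ball.mem_nhds hx)
  have hcl : h '' Metric.ball 0 1 = h '' Metric.closedBall 0 1 ∩ Metric.ball 0 1 := by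
    apply Subset.antisymm
    · exact subset_inter (image_mono Metric.ball_subset_closedBall) hsub
    · rintro _ ⟨⟨x, hx, rfl⟩, hy⟩
      rcases (mem_closedBall_zero_iff.1 hx).lt_or_eq with h1 | h1
      · exact ⟨x, mem_ball_zero_iff.2 h1, rfl⟩
      · rw [hbd x h1, mem_ball_zero_iff] at hy
        exact absurd h1 hy.ne
  have hclosed : IsClosed (h '' Metric.closedBall 0 1) :=
    ((isCompact_closedBall (0:E) 1).image_of_continuousOn hc).isClosed
  have hpre : IsPreconnected (Metric.ball (0:E) 1) := (convex_ball (0:E) 1).isPreconnected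
  refine Subset.antisymm hsub ?_
  refine hpre.subset_of_closure_inter_subset hopen ?_ ?_
  · exact ⟨h 0, hin 0 (by simp), 0, by simp, rfl⟩
  · rintro y ⟨hy1, hy2⟩
    rw [hcl]
    refine ⟨?_, hy2⟩
    exact closure_minimal (image_mono Metric.ball_subset_closedBall) hclosed hy1

/-- There is no `C¹` retraction of the closed ball onto its boundary sphere. -/
lemma not_C1_retraction [MeasurableSpace E] [BorelSpace E]
    {U : Set E} (hU : IsOpen U) (hBU : Metric.closedBall 0 1 ⊆ U)
    {r : E → E} (hr : ContDiffOn ℝ 1 r U) (hn : ∀ x ∈ Metric.closedBall (0:E) 1, ‖r x‖ = 1)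
    (hid : ∀ x, ‖x‖ = 1 → r x = x) : False := by
  set v : E → E := fun x => r x - x with hv
  have hvU : ContDiffOn ℝ 1 v U := hr.sub contDiffOn_id
  have hdv : ∀ x ∈ U, HasStrictFDerivAt v (fderiv ℝ v x) x := fun x hx =>
    (hvU.contDiffAt (hU.mem_nhds hx)).hasStrictFDerivAt (by norm_num)
  have hcv : ContinuousOn (fun x => fderiv ℝ v x) U := hvU.continuousOn_fderiv_of_isOpen hU le_rfl
  -- Lipschitz bound
  obtain ⟨L, hL⟩ : ∃ L : ℝ, ∀ x ∈ Metric.closedBall (0:E) 1, ‖fderiv ℝ v x‖ ≤ L :=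
    (isCompact_closedBall (0:E) 1).exists_bound_of_continuousOn (hcv.mono hBU)
  have hL0 : 0 ≤ L := (norm_nonneg _).trans (hL 0 (by simp))
  have hlip : ∀ x ∈ Metric.closedBall (0:E) 1, ∀ y ∈ Metric.closedBall (0:E) 1,
      ‖v y - v x‖ ≤ L * ‖y - x‖ := fun x hx y hy =>
    (convex_closedBall (0:E) 1).norm_image_sub_le_of_norm_hasFDerivWithin_le
      (fun z hz => (hdv z (hBU hz)).hasFDerivAt.hasFDerivWithinAt) hL hx hy
  -- determinant is positive near identity
  obtain ⟨δ₀, hδ₀, hdet⟩ : ∃ δ > 0, ∀ A : E →L[ℝ] E, ‖A‖ < δ → 0 < (1 + A).det := by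
    have hcont : Continuous fun A : E →L[ℝ] E => (1 + A).det :=
      ContinuousLinearMap.continuous_det.comp (continuous_const.add continuous_id)
    have h0 : ∀ᶠ A in nhds (0 : E →L[ℝ] E), 0 < (1 + A).det := by
      refine hcont.continuousAt.eventually (lt_mem_nhds ?_)
      simp [ContinuousLinearMap.det]
    obtain ⟨δ, hδ, h⟩ := Metric.eventually_nhds_iff.1 h0
    exact ⟨δ, hδ, fun A hA => h (by simpa using hA)⟩
  set δ := min 1 (min (δ₀ / (L + 1)) (1 / (L + 1))) with hδdef
  have hδ : 0 < δ := by positivity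
  obtain ⟨s, c, hs, hc1, hc⟩ := exists_det_one_add_eq_sum (E := E) hδ
  have hvol : ∀ t, 0 < t → t < δ →
      ∫ x in Metric.ball (0:E) 1, (1 + t • fderiv ℝ v x).det =
        volume.real (Metric.ball (0:E) 1) := by
    intro t ht0 ht
    have ht1 : t < 1 := ht.trans_le (min_le_left _ _)
    have ht2 : t * (L + 1) < δ₀ := by
      rw [← lt_div_iff₀ (by positivity)]
      exact ht.trans_le ((min_le_right _ _).trans (min_le_left _ _))
    have ht3 : t * (L + 1) < 1 := by
      rw [← lt_div_iff₀ (by positivity)]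
      exact ht.trans_le ((min_le_right _ _).trans (min_le_right _ _))
    have hpos : ∀ x ∈ Metric.ball (0:E) 1, 0 < (1 + t • fderiv ℝ v x).det := by
      intro x hx
      apply hdet
      rw [norm_smul, Real.norm_of_nonneg ht0.le]
      have := hL x (Metric.ball_subset_closedBall hx)
      nlinarith
    set h : E → E := fun x => x + t • v x with hh
    have hstrict : ∀ x ∈ U, HasStrictFDerivAt h (1 + t • fderiv ℝ v x) x := fun x hx =>
      (hasStrictFDerivAt_id x).add ((hdv x hx).const_smul t)
    have himg : h '' Metric.ball 0 1 = Metric.ball 0 1 := by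
      apply image_ball_eq_of_open_of_boundary
      · intro x hx
        exact (hstrict x (hBU hx)).hasFDerivAt.continuousAt.continuousWithinAt
      · intro x hx
        have h1 : h x = (1 - t) • x + t • r x := by
          simp only [hh, hv, smul_sub, sub_smul, one_smul]; abel
        rw [mem_ball_zero_iff] at hx ⊢
        rw [h1]
        calc _ ≤ ‖(1 - t) • x‖ + ‖t • r x‖ := norm_add_le _ _
          _ = (1 - t) * ‖x‖ + t * 1 := by
            rw [norm_smul, norm_smul, hn x (by simpa using hx.le), Real.norm_of_nonneg ht0.le,
              Real.norm_of_nonneg (by linarith)]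
          _ < 1 := by nlinarith
      · intro x hx
        simp [hh, hv, hid x hx]
      · intro x hx
        have hxU := hBU (Metric.ball_subset_closedBall hx)
        apply (hstrict x hxU).map_nhds_eq_of_surj
        have hne : (1 + t • fderiv ℝ v x).det ≠ 0 := (hpos x hx).ne'
        exact (LinearMap.equivOfDetNeZero _ hne).range
    have hinj : InjOn h (Metric.ball 0 1) := by
      intro x hx y hy hxy
      have h1 := hlip x (Metric.ball_subset_closedBall hx) y (Metric.ball_subset_closedBall hy)
      have h2 : y - x = -(t • (v y - v x)) := by
        simp only [hh] at hxy
        rw [smul_sub, neg_sub, sub_eq_sub_iff_add_eq_add]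
        rw [add_comm (t • v x), hxy, add_comm]
      have h3 : ‖y - x‖ ≤ t * (L * ‖y - x‖) := by
        conv_lhs => rw [h2]
        rw [norm_neg, norm_smul, Real.norm_of_nonneg ht0.le]
        gcongr
      have h4 : ‖y - x‖ = 0 := by
        by_contra hne
        have : 0 < ‖y - x‖ := lt_of_le_of_ne (norm_nonneg _) (Ne.symm hne)
        nlinarith
      exact (sub_eq_zero.1 (norm_eq_zero.1 h4)).symm
    have key := integral_image_eq_integral_abs_det_fderiv_smul (volume : Measure E)
      Metric.isOpen_ball.measurableSet
      (fun x hx => (hstrict x (hBU (Metric.ball_subset_closedBall hx))).hasFDerivAt.hasFDerivWithinAt)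
      hinj (fun _ => (1:ℝ))
    rw [himg] at key
    rw [setIntegral_const, smul_eq_mul, mul_one] at key
    simp only [smul_eq_mul, mul_one] at key
    rw [key]
    refine setIntegral_congr_fun Metric.isOpen_ball.measurableSet fun x hx => ?_
    rw [abs_of_pos (hpos x hx)]
  have hzero : ∀ x ∈ Metric.ball (0:E) 1, (1 + fderiv ℝ v x).det = 0 := by
    intro x hx
    have hxU := hBU (Metric.ball_subset_closedBall hx)
    have hr' : HasFDerivAt r (1 + fderiv ℝ v x) x := by
      have := (hasFDerivAt_id (𝕜 := ℝ) x).add (hdv x hxU).hasFDerivAt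
      refine this.congr_of_eventuallyEq (Eventually.of_forall fun y => ?_)
      simp [hv]
    have horth : ∀ w, inner ℝ (r x) ((1 + fderiv ℝ v x) w) = 0 := by
      intro w
      have h1 := (hr'.norm_sq)
      have h2 : HasFDerivAt (fun y => ‖r y‖ ^ 2) (0 : E →L[ℝ] ℝ) x := by
        refine (hasFDerivAt_const (1:ℝ) x).congr_of_eventuallyEq ?_
        filter_upwards [Metric.isOpen_ball.mem_nhds hx] with y hy
        rw [hn y (Metric.ball_subset_closedBall hy)]; norm_num
      have := congrArg (fun T : E →L[ℝ] ℝ => T w) (h1.unique h2)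
      simpa [inner_add_right, ← mul_add] using this
    by_contra hne
    obtain ⟨w, hw⟩ := (LinearMap.equivOfDetNeZero
      ((1 + fderiv ℝ v x : E →L[ℝ] E) : E →ₗ[ℝ] E) hne).surjective (r x)
    have hw' : (1 + fderiv ℝ v x) w = r x := hw
    have := horth w
    rw [hw', real_inner_self_eq_norm_sq, hn x (Metric.ball_subset_closedBall hx)] at this
    norm_num at this
  have hint : ∀ t : ℝ, IntegrableOn (fun x => (1 + t • fderiv ℝ v x).det) (Metric.ball (0:E) 1) := by
    intro t
    have : ContinuousOn (fun x => (1 + t • fderiv ℝ v x).det) (Metric.closedBall (0:E) 1) :=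
      ContinuousLinearMap.continuous_det.comp_continuousOn
        (continuousOn_const.add ((hcv.mono hBU).const_smul t))
    exact (this.integrableOn_compact (isCompact_closedBall _ _)).mono_set
      Metric.ball_subset_closedBall
  have h1 : ∫ x in Metric.ball (0:E) 1, (1 + fderiv ℝ v x).det =
      volume.real (Metric.ball (0:E) 1) := by
    rw [integral_congr_ae (Eventually.of_forall fun x => hc (fderiv ℝ v x))]
    rw [integral_finsetSum _ (fun t _ => (hint t).const_mul _)]
    simp_rw [integral_const_mul]
    rw [Finset.sum_congr rfl (fun t ht => by rw [hvol t (hs t ht).1 (hs t ht).2]), ← Finset.sum_mul,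
      hc1, one_mul]
  rw [setIntegral_congr_fun (g := fun _ => (0:ℝ)) Metric.isOpen_ball.measurableSet hzero] at h1
  simp only [integral_zero] at h1
  have : 0 < volume.real (Metric.ball (0:E) 1) :=
    ENNReal.toReal_pos (Metric.measure_ball_pos _ _ one_pos).ne' measure_ball_lt_top.ne
  linarith

end Brouwer

section FixedPoint

variable {E : Type*} [NormedAddCommGroup E] [InnerProductSpace ℝ E] [FiniteDimensional ℝ E]

lemma exists_fixedPoint_of_contDiff {P : E → E} (hP : ContDiff ℝ 1 P) (hP1 : ∀ x, ‖P x‖ ≤ 1) :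
    ∃ x, P x = x := by
  by_contra! hne
  borelize E
  set d : E → E := fun x => x - P x with hd
  have hdc : ContDiff ℝ 1 d := contDiff_id.sub hP
  have hd0 : ∀ x, d x ≠ 0 := fun x h => hne x (sub_eq_zero.1 h).symm
  set disc : E → ℝ := fun x => inner ℝ x (d x) ^ 2 + ‖d x‖ ^ 2 * (1 - ‖x‖ ^ 2) with hdisc
  have hdiscc : ContDiff ℝ 1 disc :=
    ((contDiff_id.inner ℝ hdc).pow 2).add
      ((hdc.norm_sq ℝ).mul (contDiff_const.sub (contDiff_id.norm_sq ℝ)))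
  set r : E → E := fun x => x + ((-inner ℝ x (d x) + √(disc x)) / ‖d x‖ ^ 2) • d x with hr
  have hdpos : ∀ x, 0 < ‖d x‖ ^ 2 := fun x => by
    have := norm_pos_iff.2 (hd0 x); positivity
  have hinner : ∀ x, ‖x‖ = 1 → 0 < inner ℝ x (d x) := by
    intro x hx
    have h1 : ‖d x‖ ^ 2 = 1 - 2 * inner ℝ x (P x) + ‖P x‖ ^ 2 := by
      rw [hd, norm_sub_sq_real, hx]; norm_num
    have h2 : inner ℝ x (d x) = 1 - inner ℝ x (P x) := by
      rw [hd, inner_sub_right, real_inner_self_eq_norm_sq, hx]; norm_num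
    have h3 : ‖P x‖ ^ 2 ≤ 1 := by
      have := hP1 x; have := norm_nonneg (P x); nlinarith
    have := hdpos x
    rw [h2]; linarith
  refine not_C1_retraction (U := {x | 0 < disc x}) (r := r)
    (isOpen_lt continuous_const hdiscc.continuous) ?_ ?_ ?_ ?_
  · intro x hx
    rcases (mem_closedBall_zero_iff.1 hx).lt_or_eq with h | h
    · have : 0 < 1 - ‖x‖ ^ 2 := by have := norm_nonneg x; nlinarith
      have := hdpos x
      simp only [mem_ofPred_eq, hdisc]; positivity
    · have := hinner x h
      simp only [mem_ofPred_eq, hdisc, h]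
      have h2 : 0 < inner ℝ x (d x) ^ 2 := by positivity
      linarith
  · intro x hx
    have h1 : ContDiffAt ℝ 1 (fun x => √(disc x)) x := hdiscc.contDiffAt.sqrt (ne_of_gt hx)
    have h2 : ContDiffAt ℝ 1 (fun x => inner ℝ x (d x)) x := (contDiff_id.inner ℝ hdc).contDiffAt
    exact (contDiffAt_id.add (((h2.neg.add h1).div (hdc.norm_sq ℝ).contDiffAt (hdpos x).ne').smul
      hdc.contDiffAt)).contDiffWithinAt
  · intro x hx
    have hx1 : ‖x‖ ≤ 1 := mem_closedBall_zero_iff.1 hx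
    have hnn : 0 ≤ disc x := by
      have : 0 ≤ 1 - ‖x‖ ^ 2 := by have := norm_nonneg x; nlinarith
      simp only [hdisc]; positivity
    have hs := Real.sq_sqrt hnn
    have h1 : ‖r x‖ ^ 2 = 1 := by
      rw [hr]
      simp only
      rw [norm_add_sq_real, inner_smul_right, norm_smul, mul_pow, Real.norm_eq_abs, sq_abs]
      have := (hdpos x).ne'
      have hdd : disc x = inner ℝ x (d x) ^ 2 + ‖d x‖ ^ 2 * (1 - ‖x‖ ^ 2) := rfl
      generalize √(disc x) = q at *
      rw [hdd] at hs
      generalize inner ℝ x (d x) = b at *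
      generalize ‖d x‖ ^ 2 = c at *
      generalize ‖x‖ ^ 2 = e at *
      field_simp
      linear_combination hs
    have := norm_nonneg (r x)
    nlinarith
  · intro x hx
    have h1 : disc x = inner ℝ x (d x) ^ 2 := by simp [hdisc, hx]
    simp [hr, h1, Real.sqrt_sq (hinner x hx).le]

/-- Brouwer's fixed point theorem for continuous maps with values in the unit ball. -/
theorem exists_fixedPoint_of_continuous {F : E → E} (hF : Continuous F) (hF1 : ∀ x, ‖F x‖ ≤ 1) :
    ∃ x, F x = x := by
  by_contra! hne
  borelize E
  have hK : IsCompact (Metric.closedBall (0:E) 1) := isCompact_closedBall 0 1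
  obtain ⟨δ, hδ, hδF⟩ : ∃ δ > 0, ∀ x ∈ Metric.closedBall (0:E) 1, δ ≤ ‖F x - x‖ := by
    obtain ⟨x₀, _, hx₀⟩ := hK.exists_isMinOn ⟨0, by simp⟩ ((hF.sub continuous_id).norm.continuousOn)
    exact ⟨‖F x₀ - x₀‖, norm_pos_iff.2 (sub_ne_zero.2 (hne x₀)), fun x hx => hx₀ hx⟩
  have hK2 : IsCompact (Metric.closedBall (0:E) 2) := isCompact_closedBall 0 2
  have huc := hK2.uniformContinuousOn_of_continuous hF.continuousOn
  obtain ⟨ρ, hρ, hρF⟩ := Metric.uniformContinuousOn_iff.1 huc (δ / 2) (by positivity)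
  have hρ1 : 0 < min ρ 1 := by positivity
  let φ : ContDiffBump (0:E) := ⟨min ρ 1 / 2, min ρ 1, by positivity, by linarith⟩
  set P : E → E :=
    MeasureTheory.convolution (φ.normed volume) F (ContinuousLinearMap.lsmul ℝ ℝ) volume with hP
  have hPc : ContDiff ℝ 1 P :=
    φ.hasCompactSupport_normed.contDiff_convolution_left _ φ.contDiff_normed hF.locallyIntegrable
  have hP1 : ∀ x, ‖P x‖ ≤ 1 := by
    intro x
    have := dist_convolution_le (μ := volume) (f := φ.normed volume) (g := F) (x₀ := x) (z₀ := 0)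
      (R := φ.rOut) (ε := 1)
      zero_le_one (φ.support_normed_eq.subset) φ.nonneg_normed φ.integral_normed
      hF.aestronglyMeasurable (fun y _ => by simpa using hF1 y)
    simpa using this
  obtain ⟨x, hx⟩ := exists_fixedPoint_of_contDiff hPc hP1
  have hx1 : x ∈ Metric.closedBall (0:E) 1 := by
    rw [mem_closedBall_zero_iff, ← hx]; exact hP1 x
  have h1 : dist (P x) (F x) ≤ δ / 2 := by
    apply φ.dist_normed_convolution_le hF.aestronglyMeasurable
    intro y hy
    have hy' : dist y x < min ρ 1 := hy
    rw [mem_closedBall_zero_iff] at hx1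
    refine (hρF y ?_ x ?_ (hy'.trans_le (min_le_left _ _))).le
    · rw [mem_closedBall_zero_iff]
      have h2 : ‖y - x‖ < 1 := by rw [← dist_eq_norm]; exact hy'.trans_le (min_le_right _ _)
      have h3 := norm_le_norm_add_norm_sub' y x
      linarith [norm_sub_rev x y]
    · rw [mem_closedBall_zero_iff]; linarith
  have h2 := hδF x hx1
  rw [hx, dist_comm, dist_eq_norm] at h1
  linarith

/-- Schauder's fixed point theorem. -/
theorem exists_fixedPoint_of_compact {X : Type*} [NormedAddCommGroup X] [NormedSpace ℝ X]
    {C K : Set X} (hC : Convex ℝ C) (hcl : IsClosed C) (hne : C.Nonempty) {S : X → X}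
    (hS : ContinuousOn S C) (hm : MapsTo S C C) (hK : IsCompact K) (hSK : MapsTo S C K) :
    ∃ x ∈ C, S x = x := by
  have hKC : IsCompact (K ∩ C) := hK.inter_right hcl
  have approx : ∀ ε > 0, ∃ x ∈ C, ‖S x - x‖ ≤ ε := by
    intro ε hε
    obtain ⟨t, htK, htf, htc⟩ := hKC.finite_cover_balls hε
    obtain ⟨x₀, hx₀⟩ := hne
    have : Fintype t := htf.fintype
    have htne : Nonempty t := by
      have := htc ⟨hSK hx₀, hm hx₀⟩
      simp only [mem_iUnion] at this
      obtain ⟨i, hi, _⟩ := this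
      exact ⟨⟨i, hi⟩⟩
    set m : ℝ := ((Fintype.card t : ℕ) : ℝ) with hmdef
    have hmpos : 0 < m := Nat.cast_pos.2 Fintype.card_pos

    set μ : t → X → ℝ := fun i y => max 0 (ε - ‖y - i‖) with hμ
    have hμ0 : ∀ i y, 0 ≤ μ i y := fun i y => le_max_left _ _
    have hμc : ∀ i, Continuous (μ i) := fun i => by simp only [hμ]; fun_prop
    have hμpos : ∀ y ∈ K ∩ C, 0 < ∑ i, μ i y := by
      intro y hy
      have := htc hy
      simp only [mem_iUnion] at this
      obtain ⟨i, hi, hyi⟩ := this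
      refine Finset.sum_pos' (fun i _ => hμ0 i y) ⟨⟨i, hi⟩, Finset.mem_univ _, ?_⟩
      rw [Metric.mem_ball, dist_eq_norm] at hyi
      exact lt_max_of_lt_right (by simpa using hyi)

    set σ : EuclideanSpace ℝ t → ℝ := fun c => ∑ i, max (c i) 0 with hσ
    set w : EuclideanSpace ℝ t → t → ℝ := fun c i =>
      (max (c i) 0 + max (1 - σ c) 0 / m) / max 1 (σ c) with hw
    have hσc : Continuous σ := by simp only [hσ]; fun_prop
    have hwc : ∀ i, Continuous fun c => w c i := by
      intro i
      simp only [hw]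
      refine Continuous.div (by fun_prop) (by fun_prop) fun c => ?_
      have : 0 < max 1 (σ c) := lt_max_of_lt_left one_pos
      exact this.ne'
    have hw0 : ∀ c i, 0 ≤ w c i := fun c i => by simp only [hw]; positivity
    have hw1 : ∀ c, ∑ i, w c i = 1 := by
      intro c
      simp only [hw]
      rw [← Finset.sum_div, Finset.sum_add_distrib]
      simp only [Finset.sum_const, Finset.card_univ, nsmul_eq_mul]
      rw [← hmdef, mul_div_cancel₀ _ hmpos.ne']
      change (σ c + _) / _ = 1
      rcases le_total (σ c) 1 with h | h
      · rw [max_eq_left h, max_eq_left (by linarith)]; simp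
      · rw [max_eq_right h, max_eq_right (by linarith)]
        have : σ c ≠ 0 := by linarith
        field_simp; simp
    set pt : EuclideanSpace ℝ t → X := fun c => ∑ i, w c i • (i : X) with hpt
    have hptC : ∀ c, pt c ∈ C := fun c =>
      hC.sum_mem (fun i _ => hw0 c i) (hw1 c) (fun i _ => (htK i.2).2)
    have hptc : Continuous pt := by
      simp only [hpt]
      exact continuous_finsetSum _ fun i _ => (hwc i).smul continuous_const
    have hSpt : Continuous fun c => S (pt c) := hS.comp_continuous hptc hptC
    have hmem : ∀ c, S (pt c) ∈ K ∩ C := fun c => ⟨hSK (hptC c), hm (hptC c)⟩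
    set ν : EuclideanSpace ℝ t → t → ℝ := fun c i => μ i (S (pt c)) / ∑ j, μ j (S (pt c)) with hν
    have hν0 : ∀ c i, 0 ≤ ν c i := fun c i =>
      div_nonneg (hμ0 _ _) (hμpos _ (hmem c)).le
    have hν1 : ∀ c, ∑ i, ν c i = 1 := fun c => by
      simp only [hν]
      rw [← Finset.sum_div, div_self (hμpos _ (hmem c)).ne']
    set F : EuclideanSpace ℝ t → EuclideanSpace ℝ t := fun c => WithLp.toLp 2 (ν c) with hFdef
    have hFc : Continuous F := by
      refine (PiLp.continuous_toLp 2 _).comp (continuous_pi fun i => ?_)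
      refine Continuous.div ((hμc i).comp hSpt) (continuous_finsetSum _ fun j _ => (hμc j).comp hSpt)
        fun c => (hμpos _ (hmem c)).ne'
    have hF1 : ∀ c, ‖F c‖ ≤ 1 := by
      intro c
      rw [EuclideanSpace.norm_eq]
      refine Real.sqrt_le_one.2 ?_
      rw [← hν1 c]
      refine Finset.sum_le_sum fun i _ => ?_
      have h1 : ν c i ≤ 1 := by
        rw [← hν1 c]
        exact Finset.single_le_sum (f := ν c) (fun j _ => hν0 c j) (Finset.mem_univ i)
      have h0 := hν0 c i
      change ‖ν c i‖ ^ 2 ≤ ν c i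
      rw [Real.norm_of_nonneg h0]
      nlinarith
    obtain ⟨c, hc⟩ := exists_fixedPoint_of_continuous hFc hF1
    have hci : ∀ i, c i = ν c i := fun i => by
      conv_lhs => rw [← hc]
    have hwi : ∀ i, w c i = ν c i := by
      intro i
      have hσ1 : σ c = 1 := by
        simp only [hσ]
        rw [← hν1 c]
        exact Finset.sum_congr rfl fun j _ => by rw [hci j, max_eq_left (hν0 c j)]
      simp only [hw, hσ1]
      rw [hci i, max_eq_left (hν0 c i)]; simp
    refine ⟨pt c, hptC c, ?_⟩
    have h1 : S (pt c) - pt c = ∑ i, ν c i • (S (pt c) - (i : X)) := by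
      simp only [smul_sub, Finset.sum_sub_distrib]
      rw [← Finset.sum_smul, hν1 c, one_smul]
      congr 1
      exact Finset.sum_congr rfl fun i _ => by rw [hwi i]
    rw [h1]
    calc _ ≤ ∑ i, ‖ν c i • (S (pt c) - (i : X))‖ := norm_sum_le _ _
      _ ≤ ∑ i, ν c i * ε := by
        refine Finset.sum_le_sum fun i _ => ?_
        rw [norm_smul, Real.norm_of_nonneg (hν0 c i)]
        rcases le_or_gt (‖S (pt c) - (i : X)‖) ε with h | h
        · exact mul_le_mul_of_nonneg_left h (hν0 c i)
        · have : ν c i = 0 := by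
            simp only [hν, hμ]
            rw [max_eq_left (by linarith)]; simp
          rw [this]; simp
      _ = ε := by rw [← Finset.sum_mul, hν1 c, one_mul]
  choose x hxC hx using fun n : ℕ => approx (1 / ((n : ℝ) + 1)) (by positivity)
  obtain ⟨z, hz, φ, hφ, hlim⟩ := hKC.tendsto_subseq (x := fun n => S (x n))
    (fun n => ⟨hSK (hxC n), hm (hxC n)⟩)
  have hdiff : Tendsto (fun n => S (x (φ n)) - x (φ n)) atTop (nhds 0) := by
    refine squeeze_zero_norm (fun n => hx (φ n)) ?_
    exact tendsto_one_div_add_atTop_nhds_zero_nat.comp hφ.tendsto_atTop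
  have hxlim : Tendsto (fun n => x (φ n)) atTop (nhds z) := by
    have := hlim.sub hdiff
    simpa using this
  refine ⟨z, hz.2, ?_⟩
  have h1 : Tendsto (fun n => S (x (φ n))) atTop (nhds (S z)) :=
    (hS z hz.2).tendsto.comp (tendsto_nhdsWithin_iff.2 ⟨hxlim, Eventually.of_forall fun n => hxC _⟩)
  exact tendsto_nhds_unique h1 hlim

end FixedPoint

/-- The Euclidean space of dimension `N`. -/
abbrev Eu (N : ℕ) := EuclideanSpace ℝ (Fin N)

/-- Convolution of the scalar function `h` with the kernel `K`. -/
noncomputable def cv {N : ℕ} {F : Type*} [NormedAddCommGroup F] [NormedSpace ℝ F]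
    (K : Eu N → F) (h : Eu N → ℝ) (x : Eu N) : F :=
  ∫ z, h (x - z) • K z

section Convolution

variable {N : ℕ} {F : Type*} [NormedAddCommGroup F]

/-- Hölder continuity of exponent `α` on every ball. -/
def LocHolder (α : ℝ) (h : Eu N → F) : Prop :=
  ∀ R, ∃ C, 0 ≤ C ∧ ∀ x y, ‖x‖ ≤ R → ‖y‖ ≤ R → ‖h x - h y‖ ≤ C * ‖x - y‖ ^ α

lemma exists_bound_of_continuous {h : Eu N → F} (hh : Continuous h) (R : ℝ) :
    ∃ H, 0 ≤ H ∧ ∀ x, ‖x‖ ≤ R → ‖h x‖ ≤ H := by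
  obtain ⟨H, hH⟩ := (isCompact_closedBall (0 : Eu N) R).exists_bound_of_continuousOn hh.continuousOn
  exact ⟨max H 0, le_max_right _ _, fun x hx =>
    (hH x (mem_closedBall_zero_iff.2 hx)).trans (le_max_left _ _)⟩

lemma LocHolder.continuous {α : ℝ} (hα : 0 < α) {h : Eu N → F} (hh : LocHolder α h) :
    Continuous h := by
  rw [continuous_iff_continuousAt]
  intro x
  obtain ⟨C, hC0, hC⟩ := hh (‖x‖ + 1)
  rw [ContinuousAt, tendsto_iff_norm_sub_tendsto_zero]
  have h1 : Tendsto (fun y => C * ‖y - x‖ ^ α) (nhds x) (nhds 0) := by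
    have : Continuous fun y => C * ‖y - x‖ ^ α :=
      continuous_const.mul ((continuous_id.sub continuous_const).norm.rpow_const
        fun _ => Or.inr hα.le)
    have h2 := this.tendsto x
    simpa [Real.zero_rpow hα.ne'] using h2
  refine tendsto_of_tendsto_of_tendsto_of_le_of_le' tendsto_const_nhds h1
    (Eventually.of_forall fun _ => norm_nonneg _) ?_
  filter_upwards [Metric.ball_mem_nhds x one_pos] with y hy
  rw [Metric.mem_ball, dist_eq_norm] at hy
  refine hC y x ?_ (by linarith)
  linarith [norm_le_norm_add_norm_sub' y x, norm_sub_rev x y]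

lemma hasCompactSupport_of_norm {K : Eu N → F} {ρ : ℝ} (hs : ∀ z, ρ < ‖z‖ → K z = 0) :
    HasCompactSupport K :=
  HasCompactSupport.intro (isCompact_closedBall 0 ρ) fun z hz => hs z (by simpa using hz)

/-- Kernels `K j` supported in a fixed ball, converging to `k` and dominated by `W`. -/
structure KernelApprox (K : ℕ → Eu N → F) (k : Eu N → F) (W : Eu N → ℝ) (ρ : ℝ) : Prop where
  meas : ∀ j, AEStronglyMeasurable (K j)
  supp : ∀ j z, ρ < ‖z‖ → K j z = 0
  bound : ∀ j, ∀ᵐ z, ‖K j z‖ ≤ W z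
  lim : ∀ᵐ z, Tendsto (fun j => K j z) atTop (nhds (k z))
  supp_lim : ∀ z, ρ < ‖z‖ → k z = 0

namespace KernelApprox

variable {K : ℕ → Eu N → F} {k : Eu N → F} {W : Eu N → ℝ} {ρ : ℝ}

lemma meas_lim (H : KernelApprox K k W ρ) : AEStronglyMeasurable k :=
  aestronglyMeasurable_of_tendsto_ae atTop H.meas H.lim

lemma bound_lim (H : KernelApprox K k W ρ) : ∀ᵐ z, ‖k z‖ ≤ W z := by
  filter_upwards [ae_all_iff.2 H.bound, H.lim] with z h1 h2
  exact le_of_tendsto h2.norm (Eventually.of_forall h1)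

lemma integrable_lim (H : KernelApprox K k W ρ) (hW : Integrable W) : Integrable k :=
  hW.mono' H.meas_lim H.bound_lim

end KernelApprox

variable [NormedSpace ℝ F]

lemma cv_eq_convolution (K : Eu N → F) (h : Eu N → ℝ) :
    cv K h = MeasureTheory.convolution h K (ContinuousLinearMap.lsmul ℝ ℝ) volume := by
  ext x
  rw [cv, MeasureTheory.convolution, ← integral_sub_left_eq_self _ volume x]
  simp

lemma cv_eq_integral_sub (K : Eu N → F) (h : Eu N → ℝ) (x : Eu N) :
    cv K h x = ∫ y, h y • K (x - y) := by
  rw [cv, ← integral_sub_left_eq_self _ volume x]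
  simp

lemma integrable_cv {K : Eu N → F} {ρ : ℝ} (hK : Integrable K) (hs : ∀ z, ρ < ‖z‖ → K z = 0)
    {h : Eu N → ℝ} (hh : Continuous h) (x : Eu N) : Integrable fun z => h (x - z) • K z := by
  obtain ⟨H, hH0, hH⟩ := exists_bound_of_continuous hh (‖x‖ + ρ)
  refine (hK.norm.const_mul H).mono'
    ((hh.comp (continuous_const.sub continuous_id)).aestronglyMeasurable.smul
      hK.aestronglyMeasurable) (Eventually.of_forall fun z => ?_)
  rw [norm_smul]
  rcases le_or_gt ‖z‖ ρ with hz | hz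
  · exact mul_le_mul_of_nonneg_right (hH _ ((norm_sub_le _ _).trans (by linarith))) (norm_nonneg _)
  · simp [hs z hz]

lemma norm_integral_mul_kernel_le {K : Eu N → F} {ρ : ℝ} (hs : ∀ z, ρ < ‖z‖ → K z = 0)
    {b : Eu N → ℝ} {H : ℝ} (hH0 : 0 ≤ H)
    (hH : ∀ z, ‖z‖ ≤ ρ → ‖b z‖ ≤ H) {W : Eu N → ℝ} (hW : Integrable W)
    (hKW : ∀ᵐ z, ‖K z‖ ≤ W z) : ‖∫ z, b z • K z‖ ≤ H * ∫ z, W z := by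
  rw [← integral_const_mul]
  refine norm_integral_le_of_norm_le (hW.const_mul H) ?_
  filter_upwards [hKW] with z hKz
  rw [norm_smul]
  rcases le_or_gt ‖z‖ ρ with hz | hz
  · exact mul_le_mul (hH z hz) hKz (norm_nonneg _) hH0
  · simp only [hs z hz, norm_zero, mul_zero]
    exact mul_nonneg hH0 ((norm_nonneg _).trans hKz)

namespace KernelApprox

variable {K : ℕ → Eu N → F} {k : Eu N → F} {W : Eu N → ℝ} {ρ : ℝ}

lemma tendsto_integral_norm_sub (H : KernelApprox K k W ρ) {b : Eu N → ℝ} (hb : Continuous b)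
    (hW : Integrable fun z => b z * W z) (hb0 : ∀ z, 0 ≤ b z) :
    Tendsto (fun j => ∫ z, b z * ‖K j z - k z‖) atTop (nhds 0) := by
  have : Tendsto (fun j => ∫ z, b z * ‖K j z - k z‖) atTop (nhds (∫ _ : Eu N, (0:ℝ))) := by
    refine tendsto_integral_of_dominated_convergence (fun z => 2 * (b z * W z))
      (fun j => hb.aestronglyMeasurable.mul ((H.meas j).sub H.meas_lim).norm) (hW.const_mul 2)
      (fun j => ?_) ?_
    · filter_upwards [H.bound j, H.bound_lim] with z h1 h2
      rw [Real.norm_of_nonneg (mul_nonneg (hb0 z) (norm_nonneg _))]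
      nlinarith [norm_sub_le (K j z) (k z), hb0 z]
    · filter_upwards [H.lim] with z hz
      have := (tendsto_iff_norm_sub_tendsto_zero.1 hz).const_mul (b z)
      simpa using this
  simpa using this

/-- Convergence of kernel integrals, uniformly over families of densities dominated by a
weight. -/
lemma exists_forall_norm_integral_sub_le (H : KernelApprox K k W ρ) {b : Eu N → ℝ}
    (hb : Continuous b) (hW : Integrable fun z => b z * W z) (hb0 : ∀ z, 0 ≤ b z) {ε : ℝ}
    (hε : 0 < ε) :
    ∀ᶠ j in atTop, ∀ c : Eu N → ℝ, Continuous c → (∀ z, ‖z‖ ≤ ρ → ‖c z‖ ≤ b z) →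
      ‖(∫ z, c z • K j z) - ∫ z, c z • k z‖ < ε := by
  filter_upwards [(H.tendsto_integral_norm_sub hb hW hb0).eventually (gt_mem_nhds hε)] with j hj
  intro c hc hcb
  have key : ∀ {L : Eu N → F}, AEStronglyMeasurable L → (∀ z, ρ < ‖z‖ → L z = 0) →
      (∀ᵐ z, ‖L z‖ ≤ W z) → Integrable fun z => c z • L z := by
    intro L hm hs hB
    refine hW.mono' (hc.aestronglyMeasurable.smul hm) ?_
    filter_upwards [hB] with z hz
    rw [norm_smul]
    rcases le_or_gt ‖z‖ ρ with h | h
    · exact mul_le_mul (hcb z h) hz (norm_nonneg _) (hb0 z)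
    · simp only [hs z h, norm_zero, mul_zero]
      exact mul_nonneg (hb0 z) ((norm_nonneg _).trans hz)
  have i1 := key (H.meas j) (H.supp j) (H.bound j)
  have i2 := key H.meas_lim H.supp_lim H.bound_lim
  rw [← integral_sub i1 i2]
  refine lt_of_le_of_lt (norm_integral_le_of_norm_le ?_ ?_) hj
  · refine (hW.const_mul 2).mono'
      (hb.aestronglyMeasurable.mul ((H.meas j).sub H.meas_lim).norm) ?_
    filter_upwards [H.bound j, H.bound_lim] with z h1 h2
    rw [Real.norm_of_nonneg (mul_nonneg (hb0 z) (norm_nonneg _))]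
    nlinarith [norm_sub_le (K j z) (k z), hb0 z]
  · refine Eventually.of_forall fun z => ?_
    rw [← smul_sub, norm_smul]
    rcases le_or_gt ‖z‖ ρ with h | h
    · exact mul_le_mul_of_nonneg_right (hcb z h) (norm_nonneg _)
    · simp [H.supp j z h, H.supp_lim z h]

lemma tendsto_cv (H : KernelApprox K k W ρ) (hW : Integrable W) {h : Eu N → ℝ}
    (hh : Continuous h) (x : Eu N) :
    Tendsto (fun j => cv (K j) h x) atTop (nhds (cv k h x)) := by
  obtain ⟨B, hB0, hB⟩ := exists_bound_of_continuous hh (‖x‖ + ρ)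
  rw [tendsto_iff_norm_sub_tendsto_zero, Metric.tendsto_atTop']
  intro ε hε
  have := H.exists_forall_norm_integral_sub_le (b := fun _ => B) continuous_const
    (hW.const_mul B) (fun _ => hB0) hε
  obtain ⟨n, hn⟩ := eventually_atTop.1 this
  refine ⟨n, fun j hj => ?_⟩
  have := hn j hj.le (fun z => h (x - z)) (hh.comp (continuous_const.sub continuous_id))
    (fun z hz => hB _ ((norm_sub_le _ _).trans (by linarith)))
  simpa [cv] using this

lemma tendstoUniformlyOn_cv (H : KernelApprox K k W ρ) (hW : Integrable W) {h : Eu N → ℝ}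
    (hh : Continuous h) (R : ℝ) :
    TendstoUniformlyOn (fun j => cv (K j) h) (cv k h) atTop (Metric.ball 0 R) := by
  obtain ⟨B, hB0, hB⟩ := exists_bound_of_continuous hh (R + ρ)
  rw [Metric.tendstoUniformlyOn_iff]
  intro ε hε
  filter_upwards [H.exists_forall_norm_integral_sub_le (b := fun _ => B) continuous_const
    (hW.const_mul B) (fun _ => hB0) hε] with j hj x hx
  rw [mem_ball_zero_iff] at hx
  rw [dist_comm, dist_eq_norm]
  exact hj (fun z => h (x - z)) (hh.comp (continuous_const.sub continuous_id))
    (fun z hz => hB _ ((norm_sub_le _ _).trans (by linarith)))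

end KernelApprox

lemma hasFDerivAt_cv {K : Eu N → F} (hK : ContDiff ℝ 1 K) (hc : HasCompactSupport K)
    {h : Eu N → ℝ} (hh : Continuous h) (x : Eu N) :
    HasFDerivAt (cv K h) (cv (fderiv ℝ K) h x) x := by
  have := hc.hasFDerivAt_convolution_right (μ := volume) (ContinuousLinearMap.lsmul ℝ ℝ)
    hh.locallyIntegrable hK x
  have h1 : cv (fderiv ℝ K) h x = MeasureTheory.convolution h (fderiv ℝ K)
      ((ContinuousLinearMap.lsmul ℝ ℝ).precompR (Eu N)) volume x := by
    rw [cv_eq_convolution]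
    rfl
  rw [cv_eq_convolution, h1]
  exact this

lemma continuous_cv {K : Eu N → F} {ρ : ℝ} (hK : Integrable K) (hs : ∀ z, ρ < ‖z‖ → K z = 0)
    {h : Eu N → ℝ} (hh : Continuous h) : Continuous (cv K h) := by
  rw [continuous_iff_continuousAt]
  intro x
  obtain ⟨B, hB0, hB⟩ := exists_bound_of_continuous hh (‖x‖ + 1 + ρ)
  refine continuousAt_of_dominated (bound := fun z => B * ‖K z‖)
    (Eventually.of_forall fun y => (integrable_cv hK hs hh y).aestronglyMeasurable) ?_
    (hK.norm.const_mul B) (Eventually.of_forall fun z => ?_)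
  · filter_upwards [Metric.ball_mem_nhds x one_pos] with y hy
    rw [Metric.mem_ball, dist_eq_norm] at hy
    refine Eventually.of_forall fun z => ?_
    rw [norm_smul]
    rcases le_or_gt ‖z‖ ρ with hz | hz
    · refine mul_le_mul_of_nonneg_right (hB _ ((norm_sub_le _ _).trans ?_)) (norm_nonneg _)
      linarith [norm_le_norm_add_norm_sub' y x, norm_sub_rev x y]
    · simp [hs z hz]
  · exact ((hh.comp (continuous_id.sub continuous_const)).smul continuous_const).continuousAt

lemma fderiv_eq_zero_of_norm {K : Eu N → F} {ρ : ℝ} (hs : ∀ z, ρ < ‖z‖ → K z = 0) :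
    ∀ z, ρ < ‖z‖ → fderiv ℝ K z = 0 := by
  intro z hz
  have : K =ᶠ[nhds z] fun _ => 0 := by
    filter_upwards [(isOpen_lt continuous_const continuous_norm).mem_nhds hz] with y hy
    exact hs y hy
  rw [this.fderiv_eq]
  simp

lemma integral_fderiv_eq_zero_of_compact [CompleteSpace F] {K : Eu N → F} (hK : ContDiff ℝ 1 K)
    (hc : HasCompactSupport K) : ∫ z, fderiv ℝ K z = 0 := by
  have h1 := hasFDerivAt_cv hK hc (h := fun _ => 1) continuous_const 0
  have h2 : cv K (fun _ => 1) = fun _ => ∫ z, K z := by ext; simp [cv]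
  rw [h2] at h1
  have := h1.unique (hasFDerivAt_const _ _)
  simpa [cv] using this

/-- Differentiation of the convolution with a weakly singular kernel. -/
lemma KernelApprox.hasFDerivAt {K : ℕ → Eu N → F} {k : Eu N → F} {k' : Eu N → Eu N →L[ℝ] F}
    {W W' : Eu N → ℝ} {ρ : ℝ} (H : KernelApprox K k W ρ)
    (H' : KernelApprox (fun j => fderiv ℝ (K j)) k' W' ρ)
    (hW : Integrable W) (hW' : Integrable W') (hK : ∀ j, ContDiff ℝ 1 (K j))
    {h : Eu N → ℝ} (hh : Continuous h) (x : Eu N) :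
    HasFDerivAt (cv k h) (cv k' h x) x :=
  hasFDerivAt_of_tendstoUniformlyOn Metric.isOpen_ball
    (H'.tendstoUniformlyOn_cv hW' hh (‖x‖ + 1))
    (fun j y _ => hasFDerivAt_cv (hK j) (hasCompactSupport_of_norm (H.supp j)) hh y)
    (fun y _ => H.tendsto_cv hW hh y) (by simp)

/-- Differentiation of the convolution of a locally Hölder continuous function with a kernel whose
derivative is singular. -/
lemma KernelApprox.hasFDerivAt_of_locHolder [CompleteSpace F] {K : ℕ → Eu N → F} {k : Eu N → F}
    {k' : Eu N → Eu N →L[ℝ] F} {W W' : Eu N → ℝ} {ρ α : ℝ} (hα : 0 < α)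
    (H : KernelApprox K k W ρ)
    (H' : KernelApprox (fun j => fderiv ℝ (K j)) k' W' ρ)
    (hW : Integrable W) (hW' : Integrable fun z => ‖z‖ ^ α * W' z) (hK : ∀ j, ContDiff ℝ 1 (K j))
    {h : Eu N → ℝ} (hh : LocHolder α h) :
    (∀ x, HasFDerivAt (cv k h) (∫ z, (h (x - z) - h x) • k' z) x) ∧
      Continuous fun x => ∫ z, (h (x - z) - h x) • k' z := by
  have hcont := hh.continuous hα
  have hcs := fun j => hasCompactSupport_of_norm (H.supp j)
  have hint : ∀ j, Integrable (fderiv ℝ (K j)) := fun j =>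
    ((hK j).continuous_fderiv one_ne_zero).integrable_of_hasCompactSupport ((hcs j).fderiv ℝ)
  have heq : ∀ j x, cv (fderiv ℝ (K j)) h x = ∫ z, (h (x - z) - h x) • fderiv ℝ (K j) z := by
    intro j x
    simp only [sub_smul]
    have i2 : Integrable fun z => h x • fderiv ℝ (K j) z := (hint j).smul (h x)
    rw [integral_sub (integrable_cv (hint j) (H'.supp j) hcont x) i2,
      integral_smul, integral_fderiv_eq_zero_of_compact (hK j) (hcs j)]
    simp [cv]
  have hunif : ∀ R, TendstoUniformlyOn (fun j => cv (fderiv ℝ (K j)) h)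
      (fun x => ∫ z, (h (x - z) - h x) • k' z) atTop (Metric.ball 0 R) := by
    intro R
    obtain ⟨B, hB0, hB⟩ := hh (max R 0 + max ρ 0)
    rw [Metric.tendstoUniformlyOn_iff]
    intro ε hε
    filter_upwards [H'.exists_forall_norm_integral_sub_le (b := fun z => B * ‖z‖ ^ α)
      (continuous_const.mul (continuous_norm.rpow_const fun _ => Or.inr hα.le))
      (by simpa only [mul_assoc] using hW'.const_mul B) (fun _ => by positivity) hε]
      with j hj x hx
    rw [mem_ball_zero_iff] at hx
    rw [dist_comm, dist_eq_norm, heq]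
    refine hj (fun z => h (x - z) - h x)
      ((hcont.comp (continuous_const.sub continuous_id)).sub continuous_const) fun z hz => ?_
    have h1 := hB (x - z) x ((norm_sub_le _ _).trans
      (add_le_add (hx.le.trans (le_max_left _ _)) (hz.trans (le_max_left _ _))))
      (hx.le.trans ((le_max_left _ _).trans (le_add_of_nonneg_right (le_max_right _ _))))
    simpa using h1
  refine ⟨fun x => hasFDerivAt_of_tendstoUniformlyOn (f := fun j => cv (K j) h)
    Metric.isOpen_ball (hunif (‖x‖ + 1))
    (fun j y _ => hasFDerivAt_cv (hK j) (hcs j) hcont y)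
    (fun y _ => H.tendsto_cv hW hcont y) (by simp), ?_⟩
  rw [continuous_iff_continuousAt]
  intro x
  have hx : x ∈ Metric.ball (0 : Eu N) (‖x‖ + 1) := by simp
  refine ((hunif (‖x‖ + 1)).continuousOn (Frequently.of_forall fun j => ?_)).continuousAt
    (Metric.isOpen_ball.mem_nhds hx)
  exact (continuous_cv (hint j) (H'.supp j) hcont).continuousOn

end Convolution

section Profile

/-- A smooth cutoff function: `1` on `(-∞, T]` and `0` on `[2T, ∞)`. -/
noncomputable def cutoff (T s : ℝ) : ℝ := Real.smoothTransition (2 - s / T)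

variable {T : ℝ}

lemma contDiff_cutoff {n : ℕ∞} : ContDiff ℝ n (cutoff T) :=
  Real.smoothTransition.contDiff.comp (contDiff_const.sub (contDiff_id.div_const T))

lemma cutoff_nonneg (s : ℝ) : 0 ≤ cutoff T s := Real.smoothTransition.nonneg _

lemma cutoff_le_one (s : ℝ) : cutoff T s ≤ 1 := Real.smoothTransition.le_one _

lemma cutoff_eq_one (hT : 0 < T) {s : ℝ} (hs : s ≤ T) : cutoff T s = 1 := by
  apply Real.smoothTransition.one_of_one_le
  have : s / T ≤ 1 := (div_le_one hT).2 hs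
  linarith

lemma cutoff_eq_zero (hT : 0 < T) {s : ℝ} (hs : 2 * T ≤ s) : cutoff T s = 0 := by
  apply Real.smoothTransition.zero_of_nonpos
  have : 2 ≤ s / T := (le_div_iff₀ hT).2 hs
  linarith

lemma eventually_cutoff_eq_one (hT : 0 < T) {s : ℝ} (hs : s < T) :
    cutoff T =ᶠ[nhds s] fun _ => 1 := by
  filter_upwards [Iio_mem_nhds hs] with y hy using cutoff_eq_one hT (le_of_lt hy)

lemma eventually_cutoff_eq_zero (hT : 0 < T) {s : ℝ} (hs : 2 * T < s) :
    cutoff T =ᶠ[nhds s] fun _ => 0 := by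
  filter_upwards [Ioi_mem_nhds hs] with y hy using cutoff_eq_zero hT (le_of_lt hy)

lemma deriv_cutoff_of_lt (hT : 0 < T) {s : ℝ} (hs : s < T) : deriv (cutoff T) s = 0 := by
  rw [(eventually_cutoff_eq_one hT hs).deriv_eq]; simp

lemma deriv_cutoff_of_gt (hT : 0 < T) {s : ℝ} (hs : 2 * T < s) : deriv (cutoff T) s = 0 := by
  rw [(eventually_cutoff_eq_zero hT hs).deriv_eq]; simp

lemma deriv_deriv_cutoff_of_lt (hT : 0 < T) {s : ℝ} (hs : s < T) :
    deriv (deriv (cutoff T)) s = 0 := by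
  have : deriv (cutoff T) =ᶠ[nhds s] fun _ => 0 := by
    filter_upwards [Iio_mem_nhds hs] with y hy using deriv_cutoff_of_lt hT hy
  rw [this.deriv_eq]; simp

lemma deriv_deriv_cutoff_of_gt (hT : 0 < T) {s : ℝ} (hs : 2 * T < s) :
    deriv (deriv (cutoff T)) s = 0 := by
  have : deriv (cutoff T) =ᶠ[nhds s] fun _ => 0 := by
    filter_upwards [Ioi_mem_nhds hs] with y hy using deriv_cutoff_of_gt hT hy
  rw [this.deriv_eq]; simp

lemma contDiff_deriv_cutoff {n : ℕ∞} : ContDiff ℝ n (deriv (cutoff T)) := by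
  have h : ContDiff ℝ (n + 1 : ℕ∞) (cutoff T) := contDiff_cutoff
  exact ContDiff.deriv' (by exact_mod_cast h)

lemma contDiff_deriv_deriv_cutoff {n : ℕ∞} : ContDiff ℝ n (deriv (deriv (cutoff T))) := by
  have h : ContDiff ℝ (n + 1 : ℕ∞) (deriv (cutoff T)) := contDiff_deriv_cutoff
  exact ContDiff.deriv' (by exact_mod_cast h)

lemma hasDerivAt_cutoff (s : ℝ) : HasDerivAt (cutoff T) (deriv (cutoff T) s) s :=
  ((contDiff_cutoff (n := 1)).differentiable (by simp) s).hasDerivAt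

lemma hasDerivAt_deriv_cutoff (s : ℝ) :
    HasDerivAt (deriv (cutoff T)) (deriv (deriv (cutoff T)) s) s :=
  ((contDiff_deriv_cutoff (n := 1)).differentiable (by simp) s).hasDerivAt

/-- The radial profile `c s^{-m}`, cut off beyond `2T`, as a function of `s = |z|^2`. -/
noncomputable def prof (c m T s : ℝ) : ℝ := c * (s ^ (-m) * cutoff T s)

/-- The derivative of `prof`. -/
noncomputable def prof1 (c m T s : ℝ) : ℝ :=
  c * (-m * s ^ (-m - 1) * cutoff T s + s ^ (-m) * deriv (cutoff T) s)

/-- The second derivative of `prof`. -/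
noncomputable def prof2 (c m T s : ℝ) : ℝ :=
  c * (m * (m + 1) * s ^ (-m - 2) * cutoff T s - 2 * m * s ^ (-m - 1) * deriv (cutoff T) s
    + s ^ (-m) * deriv (deriv (cutoff T)) s)

/-- The profile of minus the Laplacian of the truncated fundamental solution. -/
noncomputable def profLap (c m T s : ℝ) : ℝ :=
  c * ((4 * m - 4) * s ^ (-m) * deriv (cutoff T) s
    - 4 * s ^ (1 - m) * deriv (deriv (cutoff T)) s)

variable {c m s : ℝ}

lemma hasDerivAt_prof (hs : 0 < s) : HasDerivAt (prof c m T) (prof1 c m T s) s :=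
  (((Real.hasDerivAt_rpow_const (Or.inl hs.ne')).mul (hasDerivAt_cutoff s)).const_mul c)

lemma hasDerivAt_prof1 (hs : 0 < s) : HasDerivAt (prof1 c m T) (prof2 c m T s) s := by
  have h1 : HasDerivAt (fun x : ℝ => x ^ (-m - 1)) ((-m - 1) * s ^ (-m - 1 - 1)) s :=
    Real.hasDerivAt_rpow_const (Or.inl hs.ne')
  have h2 : HasDerivAt (fun x : ℝ => x ^ (-m)) ((-m) * s ^ (-m - 1)) s :=
    Real.hasDerivAt_rpow_const (Or.inl hs.ne')
  refine ((((h1.const_mul (-m)).mul (hasDerivAt_cutoff s)).add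
    (h2.mul (hasDerivAt_deriv_cutoff s))).const_mul c).congr_deriv ?_
  rw [prof2, show -m - 1 - 1 = -m - 2 by ring]
  ring

lemma prof_eq_zero (hT : 0 < T) (hs : 2 * T < s) : prof c m T s = 0 := by
  simp [prof, cutoff_eq_zero hT hs.le]

lemma prof1_eq_zero (hT : 0 < T) (hs : 2 * T < s) : prof1 c m T s = 0 := by
  simp [prof1, cutoff_eq_zero hT hs.le, deriv_cutoff_of_gt hT hs]

lemma prof2_eq_zero (hT : 0 < T) (hs : 2 * T < s) : prof2 c m T s = 0 := by
  simp [prof2, cutoff_eq_zero hT hs.le, deriv_cutoff_of_gt hT hs, deriv_deriv_cutoff_of_gt hT hs]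

lemma profLap_eq_zero_of_gt (hT : 0 < T) (hs : 2 * T < s) : profLap c m T s = 0 := by
  simp [profLap, deriv_cutoff_of_gt hT hs, deriv_deriv_cutoff_of_gt hT hs]

lemma profLap_eq_zero_of_lt (hT : 0 < T) (hs : s < T) : profLap c m T s = 0 := by
  simp [profLap, deriv_cutoff_of_lt hT hs, deriv_deriv_cutoff_of_lt hT hs]

lemma profLap_eq (hs : 0 < s) :
    profLap c m T s = -(2 * (2 * m + 2) * prof1 c m T s + 4 * s * prof2 c m T s) := by
  have h1 : s ^ (-m - 1) = s ^ (-m - 2) * s := by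
    rw [← Real.rpow_add_one hs.ne']; ring_nf
  have h2 : s ^ (-m) = s ^ (-m - 2) * s * s := by
    rw [← h1, ← Real.rpow_add_one hs.ne']; ring_nf
  have h3 : s ^ (1 - m) = s ^ (-m - 2) * s * s * s := by
    rw [← h2, ← Real.rpow_add_one hs.ne']; ring_nf
  rw [profLap, prof1, prof2, h1, h2, h3]
  ring

lemma contDiffAt_prof {n : ℕ∞} (hs : 0 < s) : ContDiffAt ℝ n (prof c m T) s :=
  contDiffAt_const.mul ((contDiffAt_id.rpow_const_of_ne hs.ne').mul contDiff_cutoff.contDiffAt)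

lemma contDiff_profLap {n : ℕ∞} (hT : 0 < T) : ContDiff ℝ n (profLap c m T) := by
  rw [contDiff_iff_contDiffAt]
  intro s
  rcases lt_or_ge s T with h | h
  · refine (contDiffAt_const (c := (0:ℝ))).congr_of_eventuallyEq ?_
    filter_upwards [Iio_mem_nhds h] with y hy using profLap_eq_zero_of_lt hT hy
  · have hs : s ≠ 0 := (hT.trans_le h).ne'
    exact contDiffAt_const.mul (((contDiffAt_const.mul (contDiffAt_id.rpow_const_of_ne hs)).mul
      contDiff_deriv_cutoff.contDiffAt).sub ((contDiffAt_const.mul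
      (contDiffAt_id.rpow_const_of_ne hs)).mul contDiff_deriv_deriv_cutoff.contDiffAt))

lemma exists_bound_deriv_cutoff (hT : 0 < T) : ∃ C, 0 ≤ C ∧ ∀ s, 0 < s →
    |deriv (cutoff T) s| ≤ C * s⁻¹ ∧ |deriv (deriv (cutoff T)) s| ≤ C * s⁻¹ ^ 2 := by
  have key : ∀ {d : ℝ → ℝ}, Continuous d → (∀ s, s < T → d s = 0) → (∀ s, 2 * T < s → d s = 0) →
      ∃ C, 0 ≤ C ∧ ∀ s, |d s| ≤ C := by
    intro d hd h1 h2
    obtain ⟨C, hC⟩ := isCompact_Icc.exists_bound_of_continuousOn (s := Icc T (2 * T)) hd.continuousOn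
    refine ⟨max C 0, le_max_right _ _, fun s => ?_⟩
    by_cases hs : s < T
    · simp [h1 s hs]
    by_cases hs2 : 2 * T < s
    · simp [h2 s hs2]
    exact (hC s ⟨not_lt.1 hs, not_lt.1 hs2⟩).trans (le_max_left _ _)
  obtain ⟨C1, h10, h1⟩ := key (contDiff_deriv_cutoff (n := 0)).continuous
    (fun s => deriv_cutoff_of_lt hT) (fun s => deriv_cutoff_of_gt hT)
  obtain ⟨C2, h20, h2⟩ := key (contDiff_deriv_deriv_cutoff (n := 0)).continuous
    (fun s => deriv_deriv_cutoff_of_lt hT) (fun s => deriv_deriv_cutoff_of_gt hT)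
  have hp : 0 ≤ C1 * (2 * T) := by positivity
  have hp' : 0 ≤ C2 * (2 * T) ^ 2 := by positivity
  refine ⟨C1 * (2 * T) + C2 * (2 * T) ^ 2, by positivity, fun s hs => ⟨?_, ?_⟩⟩
  · rw [← div_eq_mul_inv, le_div_iff₀ hs]
    by_cases hs2 : 2 * T < s
    · rw [deriv_cutoff_of_gt hT hs2]; simp; positivity
    · have := mul_le_mul (h1 s) (not_lt.1 hs2) hs.le h10
      linarith
  · rw [inv_pow, ← div_eq_mul_inv, le_div_iff₀ (by positivity)]
    by_cases hs2 : 2 * T < s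
    · rw [deriv_deriv_cutoff_of_gt hT hs2]; simp; positivity
    · have := mul_le_mul (h2 s) (pow_le_pow_left₀ hs.le (not_lt.1 hs2) 2) (by positivity) h20
      linarith

lemma exists_bound_prof (hT : 0 < T) (c m : ℝ) : ∃ C, 0 ≤ C ∧ ∀ s, 0 < s →
    |prof c m T s| ≤ C * s ^ (-m) ∧ |prof1 c m T s| ≤ C * s ^ (-m - 1) ∧
    |prof2 c m T s| ≤ C * s ^ (-m - 2) := by
  obtain ⟨C, hC0, hC⟩ := exists_bound_deriv_cutoff hT
  refine ⟨|c| * (1 + (|m| + C) + (|m * (m + 1)| + |2 * m| * C + C)), by positivity,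
    fun s hs => ?_⟩
  have h1 : s ^ (-m) * s⁻¹ = s ^ (-m - 1) := by
    rw [Real.rpow_sub_one hs.ne']; rfl
  have h2 : s ^ (-m - 1) * s⁻¹ = s ^ (-m - 2) := by
    rw [show -m - 2 = -m - 1 - 1 by ring, Real.rpow_sub_one hs.ne' (-m - 1)]; rfl
  have h3 : s ^ (-m) * s⁻¹ ^ 2 = s ^ (-m - 2) := by rw [← h2, ← h1]; ring
  have p0 : 0 < s ^ (-m) := Real.rpow_pos_of_pos hs _
  have p1 : 0 < s ^ (-m - 1) := Real.rpow_pos_of_pos hs _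
  have p2 : 0 < s ^ (-m - 2) := Real.rpow_pos_of_pos hs _
  have hc : |cutoff T s| ≤ 1 := by
    rw [abs_of_nonneg (cutoff_nonneg s)]; exact cutoff_le_one s
  obtain ⟨d1, d2⟩ := hC s hs
  refine ⟨?_, ?_, ?_⟩
  · rw [prof, abs_mul, abs_mul, abs_of_pos p0, mul_assoc]
    refine mul_le_mul_of_nonneg_left ?_ (abs_nonneg c)
    rw [mul_comm]
    refine mul_le_mul_of_nonneg_right (hc.trans ?_) p0.le
    have : 0 ≤ (|m| + C) + (|m * (m + 1)| + |2 * m| * C + C) := by positivity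
    linarith
  · rw [prof1, abs_mul, mul_assoc |c|]
    refine mul_le_mul_of_nonneg_left ?_ (abs_nonneg c)
    calc _ ≤ |m| * s ^ (-m - 1) * 1 + s ^ (-m) * (C * s⁻¹) := by
          refine (abs_add_le _ _).trans (add_le_add ?_ ?_)
          · rw [abs_mul, abs_mul, abs_neg, abs_of_pos p1]
            gcongr
          · rw [abs_mul, abs_of_pos p0]
            gcongr
      _ = (|m| + C) * s ^ (-m - 1) := by rw [← h1]; ring
      _ ≤ _ := by
          refine mul_le_mul_of_nonneg_right ?_ p1.le
          have : 0 ≤ (|m * (m + 1)| + |2 * m| * C + C) := by positivity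
          linarith
  · rw [prof2, abs_mul, mul_assoc |c|]
    refine mul_le_mul_of_nonneg_left ?_ (abs_nonneg c)
    calc _ ≤ |m * (m + 1)| * s ^ (-m - 2) * 1 + |2 * m| * s ^ (-m - 1) * (C * s⁻¹)
          + s ^ (-m) * (C * s⁻¹ ^ 2) := by
          refine (abs_add_le _ _).trans (add_le_add ((abs_sub _ _).trans (add_le_add ?_ ?_)) ?_)
          · rw [abs_mul, abs_mul _ (s ^ _), abs_of_pos p2]
            gcongr
          · rw [abs_mul, abs_mul _ (s ^ _), abs_of_pos p1]
            gcongr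
          · rw [abs_mul, abs_of_pos p0]
            gcongr
      _ = (|m * (m + 1)| + |2 * m| * C + C) * s ^ (-m - 2) := by
          have h2' : s ^ (-m - 1) * (C * s⁻¹) = C * s ^ (-m - 2) := by rw [← h2]; ring
          have h3' : s ^ (-m) * (C * s⁻¹ ^ 2) = C * s ^ (-m - 2) := by rw [← h3]; ring
          rw [mul_assoc |2 * m|, h2', h3']; ring
      _ ≤ _ := by
          refine mul_le_mul_of_nonneg_right ?_ p2.le
          have : 0 ≤ |m| + C := by positivity
          linarith

end Profile

section Weights

variable {N : ℕ}

/-- The truncated power weight `‖z‖^{-s}`. -/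
noncomputable def wt (ρ s : ℝ) (z : Eu N) : ℝ := if ‖z‖ ≤ ρ then ‖z‖ ^ (-s) else 0

lemma wt_nonneg (ρ s : ℝ) (z : Eu N) : 0 ≤ wt ρ s z := by
  rw [wt]; split_ifs <;> positivity

lemma nontrivial_eu (hN : 1 ≤ N) : Nontrivial (Eu N) := by
  have : Nonempty (Fin N) := ⟨⟨0, hN⟩⟩
  infer_instance

lemma ae_ne_zero (hN : 1 ≤ N) : ∀ᵐ z : Eu N, z ≠ 0 := by
  have := nontrivial_eu hN
  exact Measure.ae_ne volume 0

lemma integrable_wt (hN : 1 ≤ N) (ρ : ℝ) {s : ℝ} (hs : s < N) :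
    Integrable (wt ρ s : Eu N → ℝ) := by
  have := nontrivial_eu hN
  have h := (integrable_fun_norm_addHaar (E := Eu N) volume
    (f := fun r => if r ≤ ρ then r ^ (-s) else 0)).2 ?_
  · exact h
  have hρ : 0 < max ρ 1 := by positivity
  have h1 : IntegrableOn (fun y : ℝ => y ^ ((N : ℝ) - 1 - s)) (Ioc 0 (max ρ 1)) := by
    rw [integrableOn_Ioc_iff_integrableOn_Ioo,
      intervalIntegral.integrableOn_Ioo_rpow_iff hρ]
    linarith
  have h2 : IntegrableOn ((Iic ρ).indicator fun y : ℝ => y ^ ((N : ℝ) - 1 - s)) (Ioi 0) := by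
    rw [integrableOn_indicator_iff measurableSet_Iic]
    refine h1.mono_set fun y hy => ⟨hy.2, ?_⟩
    exact (mem_Iic.1 hy.1).trans (le_max_left _ _)
  refine h2.congr_fun (fun y hy => ?_) measurableSet_Ioi
  have hy0 : (0:ℝ) < y := hy
  have hcast : ((N - 1 : ℕ) : ℝ) = (N : ℝ) - 1 := by push_cast [Nat.cast_sub hN]; ring
  simp only [finrank_euclideanSpace, Fintype.card_fin, smul_eq_mul, indicator, mem_Iic]
  split_ifs with h
  · rw [← Real.rpow_natCast, ← Real.rpow_add hy0, hcast]; ring_nf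
  · simp

lemma norm_rpow_mul_wt (α ρ s : ℝ) {z : Eu N} (hz : z ≠ 0) :
    ‖z‖ ^ α * wt ρ s z = wt ρ (s - α) z := by
  rw [wt, wt]
  split_ifs
  · rw [← Real.rpow_add (norm_pos_iff.2 hz)]; ring_nf
  · simp

lemma integrable_norm_rpow_mul_wt (hN : 1 ≤ N) (ρ : ℝ) {s α : ℝ} (hs : s - α < N) :
    Integrable fun z : Eu N => ‖z‖ ^ α * wt ρ s z := by
  refine (integrable_wt hN ρ hs).congr ?_
  filter_upwards [ae_ne_zero hN] with z hz using (norm_rpow_mul_wt α ρ s hz).symm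

end Weights

section Kernels

variable {N : ℕ}

noncomputable instance : NormedAddCommGroup (Eu N →L[ℝ] ℝ) := inferInstance
noncomputable instance : NormedSpace ℝ (Eu N →L[ℝ] ℝ) := inferInstance
noncomputable instance : SeminormedAddCommGroup (Eu N →L[ℝ] ℝ) := inferInstance
noncomputable instance : NormedAddCommGroup (Eu N →L[ℝ] Eu N →L[ℝ] ℝ) := inferInstance
noncomputable instance : SeminormedAddCommGroup (Eu N →L[ℝ] Eu N →L[ℝ] ℝ) := inferInstance
noncomputable instance : SeminormedAddGroup (Eu N →L[ℝ] Eu N →L[ℝ] ℝ) := inferInstance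
noncomputable instance : NormedSpace ℝ (Eu N →L[ℝ] Eu N →L[ℝ] ℝ) := inferInstance

/-- The inner product as a continuous bilinear map. -/
noncomputable def bil : Eu N →L[ℝ] Eu N →L[ℝ] ℝ := innerSL ℝ

lemma bil_apply (z v : Eu N) : bil z v = inner ℝ z v := rfl

lemma norm_bil_apply (z : Eu N) : ‖bil z‖ = ‖z‖ := innerSL_apply_norm ℝ z

lemma norm_bil_le : ‖(bil : Eu N →L[ℝ] Eu N →L[ℝ] ℝ)‖ ≤ 1 := norm_innerSL_le ℝ

/-- The trace of a bilinear form. -/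
noncomputable def trBil (A : Eu N →L[ℝ] Eu N →L[ℝ] ℝ) : ℝ :=
  ∑ i, A (EuclideanSpace.single i 1) (EuclideanSpace.single i 1)

lemma trBil_bil : trBil (bil : Eu N →L[ℝ] Eu N →L[ℝ] ℝ) = N := by
  simp [trBil, bil_apply]

lemma trBil_smulRight (z : Eu N) : trBil ((bil z).smulRight (bil z)) = ‖z‖ ^ 2 := by
  rw [EuclideanSpace.real_norm_sq_eq]
  refine Finset.sum_congr rfl fun i _ => ?_
  simp [bil_apply, EuclideanSpace.inner_single_right, sq]

lemma trBil_add (A B : Eu N →L[ℝ] Eu N →L[ℝ] ℝ) : trBil (A + B) = trBil A + trBil B := by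
  simp [trBil, Finset.sum_add_distrib]

lemma trBil_smul (c : ℝ) (A : Eu N →L[ℝ] Eu N →L[ℝ] ℝ) : trBil (c • A) = c * trBil A := by
  simp [trBil, Finset.mul_sum]

lemma trBil_integral {f : Eu N → Eu N →L[ℝ] Eu N →L[ℝ] ℝ} (hf : Integrable f) :
    trBil (∫ z, f z) = ∫ z, trBil (f z) := by
  have h1 : ∀ v : Eu N, Integrable fun z => f z v := fun v =>
    (ContinuousLinearMap.apply ℝ _ v).integrable_comp hf
  have h2 : ∀ v : Eu N, Integrable fun z => f z v v := fun v =>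
    (ContinuousLinearMap.apply ℝ ℝ v).integrable_comp (h1 v)
  simp only [trBil]
  rw [integral_finsetSum _ fun i _ => h2 _]
  refine Finset.sum_congr rfl fun i _ => ?_
  rw [ContinuousLinearMap.integral_apply hf, ContinuousLinearMap.integral_apply (h1 _)]

/-- The exponent of the fundamental solution as a power of `|z|^2`. -/
noncomputable def nexp (N : ℕ) : ℝ := (N : ℝ) / 2 - 1

/-- The regularised truncated fundamental solution. -/
noncomputable def ker0 (c R ε : ℝ) (z : Eu N) : ℝ := prof c (nexp N) (R ^ 2) (‖z‖ ^ 2 + ε)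

/-- The gradient of `ker0`. -/
noncomputable def ker1 (c R ε : ℝ) (z : Eu N) : Eu N →L[ℝ] ℝ :=
  (2 * prof1 c (nexp N) (R ^ 2) (‖z‖ ^ 2 + ε)) • bil z

/-- The Hessian of `ker0`. -/
noncomputable def ker2 (c R ε : ℝ) (z : Eu N) : Eu N →L[ℝ] Eu N →L[ℝ] ℝ :=
  (2 * prof1 c (nexp N) (R ^ 2) (‖z‖ ^ 2 + ε)) • bil +
    (4 * prof2 c (nexp N) (R ^ 2) (‖z‖ ^ 2 + ε)) • (bil z).smulRight (bil z)

/-- Minus the Laplacian of `ker0` away from the origin. -/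
noncomputable def kerLap (c R : ℝ) (z : Eu N) : ℝ := profLap c (nexp N) (R ^ 2) (‖z‖ ^ 2)

variable {c R ε : ℝ} {z : Eu N}

lemma hasFDerivAt_norm_sq_add (ε : ℝ) (z : Eu N) :
    HasFDerivAt (fun z : Eu N => ‖z‖ ^ 2 + ε) ((2 : ℝ) • bil z) z := by
  have := (hasStrictFDerivAt_norm_sq z).hasFDerivAt.add_const ε
  refine this.congr_fderiv ?_
  ext v
  simp [bil_apply]

lemma hasFDerivAt_ker0 (hz : 0 < ‖z‖ ^ 2 + ε) : HasFDerivAt (ker0 c R ε) (ker1 c R ε z) z := by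
  have := (hasDerivAt_prof (c := c) (m := nexp N) (T := R ^ 2) hz).comp_hasFDerivAt z
    (hasFDerivAt_norm_sq_add ε z)
  refine this.congr_fderiv ?_
  rw [ker1, smul_smul, mul_comm]

lemma hasFDerivAt_ker1 (hz : 0 < ‖z‖ ^ 2 + ε) : HasFDerivAt (ker1 c R ε) (ker2 c R ε z) z := by
  have h1 := ((hasDerivAt_prof1 (c := c) (m := nexp N) (T := R ^ 2) hz).comp_hasFDerivAt z
    (hasFDerivAt_norm_sq_add ε z)).const_mul 2
  have h2 := h1.smul (bil (N := N)).hasFDerivAt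
  refine h2.congr_fderiv ?_
  rw [ker2]
  congr 1
  ext v w
  simp [bil_apply]
  ring

lemma norm_sq_add_pos (hε : 0 < ε) (z : Eu N) : 0 < ‖z‖ ^ 2 + ε := by positivity

lemma fderiv_ker0 (hε : 0 < ε) : fderiv ℝ (ker0 c R ε : Eu N → ℝ) = ker1 c R ε := by
  ext1 z
  exact (hasFDerivAt_ker0 (norm_sq_add_pos hε z)).fderiv

lemma fderiv_ker1 (hε : 0 < ε) : fderiv ℝ (ker1 c R ε : Eu N → _) = ker2 c R ε := by
  ext1 z
  exact (hasFDerivAt_ker1 (norm_sq_add_pos hε z)).fderiv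

lemma contDiff_ker0 (hε : 0 < ε) {n : ℕ∞} : ContDiff ℝ n (ker0 c R ε : Eu N → ℝ) := by
  rw [contDiff_iff_contDiffAt]
  intro z
  exact (contDiffAt_prof (norm_sq_add_pos hε z)).comp z
    ((contDiff_norm_sq ℝ).add contDiff_const).contDiffAt

lemma contDiff_ker1 (hε : 0 < ε) : ContDiff ℝ 1 (ker1 c R ε : Eu N → _) := by
  rw [← fderiv_ker0 hε]
  exact (contDiff_ker0 hε (n := 2)).fderiv_right (by norm_num)

lemma trBil_ker2_zero (hz : z ≠ 0) : trBil (ker2 c R 0 z) = -kerLap c R z := by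
  have : 0 < ‖z‖ ^ 2 := by have := norm_pos_iff.2 hz; positivity
  rw [ker2, trBil_add, trBil_smul, trBil_smul, trBil_bil, trBil_smulRight, kerLap, profLap_eq this,
    nexp, add_zero]
  ring

lemma two_mul_sq_lt (hR : 0 < R) (hε : 0 ≤ ε) (hz : 2 * R < ‖z‖) :
    2 * R ^ 2 < ‖z‖ ^ 2 + ε := by
  nlinarith

lemma ker0_eq_zero (hR : 0 < R) (hε : 0 ≤ ε) (hz : 2 * R < ‖z‖) : ker0 c R ε z = 0 :=
  prof_eq_zero (by positivity) (two_mul_sq_lt hR hε hz)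

lemma ker1_eq_zero (hR : 0 < R) (hε : 0 ≤ ε) (hz : 2 * R < ‖z‖) : ker1 c R ε z = 0 := by
  simp [ker1, prof1_eq_zero (show 0 < R ^ 2 by positivity) (two_mul_sq_lt hR hε hz)]

lemma ker2_eq_zero (hR : 0 < R) (hε : 0 ≤ ε) (hz : 2 * R < ‖z‖) : ker2 c R ε z = 0 := by
  simp [ker2, prof1_eq_zero (show 0 < R ^ 2 by positivity) (two_mul_sq_lt hR hε hz),
    prof2_eq_zero (show 0 < R ^ 2 by positivity) (two_mul_sq_lt hR hε hz)]

lemma kerLap_eq_zero (hR : 0 < R) (hz : 2 * R < ‖z‖) : kerLap c R z = 0 := by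
  have := two_mul_sq_lt hR le_rfl hz
  rw [add_zero] at this
  exact profLap_eq_zero_of_gt (by positivity) this

lemma kerLap_eq_zero_of_lt (hR : 0 < R) (hz : ‖z‖ < R) : kerLap c R z = 0 :=
  profLap_eq_zero_of_lt (by positivity) (by have := norm_nonneg z; nlinarith)

lemma contDiff_kerLap (hR : 0 < R) {n : ℕ∞} : ContDiff ℝ n (kerLap c R : Eu N → ℝ) :=
  (contDiff_profLap (by positivity)).comp (contDiff_norm_sq ℝ)

lemma sq_rpow_eq (z : Eu N) (t : ℝ) : (‖z‖ ^ 2) ^ t = ‖z‖ ^ (2 * t) := by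
  rw [← Real.rpow_natCast, ← Real.rpow_mul (norm_nonneg z)]; norm_num

/-- Bounds for the kernels, uniform in the regularisation parameter. -/
lemma exists_bound_ker (hN : 3 ≤ N) (hR : 0 < R) (c : ℝ) : ∃ C, 0 ≤ C ∧
    ∀ ε, 0 ≤ ε → ∀ z : Eu N, z ≠ 0 →
      ‖ker0 c R ε z‖ ≤ C * wt (2 * R) (N - 2) z ∧ ‖ker1 c R ε z‖ ≤ C * wt (2 * R) (N - 1) z ∧
      ‖ker2 c R ε z‖ ≤ C * wt (2 * R) N z := by
  obtain ⟨C, hC0, hC⟩ := exists_bound_prof (T := R ^ 2) (by positivity) c (nexp N)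
  have hN' : (3:ℝ) ≤ N := by exact_mod_cast hN
  have hm : 0 < nexp N := by rw [nexp]; linarith
  refine ⟨6 * C, by positivity, fun ε hε z hz => ?_⟩
  have hz0 : 0 < ‖z‖ := norm_pos_iff.2 hz
  rcases le_or_gt ‖z‖ (2 * R) with hzR | hzR
  swap
  · rw [ker0_eq_zero hR hε hzR, ker1_eq_zero hR hε hzR, ker2_eq_zero hR hε hzR]
    have h6 : 0 ≤ 6 * C := by positivity
    simp only [norm_zero]
    exact ⟨mul_nonneg h6 (wt_nonneg _ _ _), mul_nonneg h6 (wt_nonneg _ _ _),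
      mul_nonneg h6 (wt_nonneg _ _ _)⟩
  simp only [wt, if_pos hzR]
  set s := ‖z‖ ^ 2 + ε with hs
  have hs2 : ‖z‖ ^ 2 ≤ s := by linarith
  have hspos : 0 < s := by positivity
  obtain ⟨b0, b1, b2⟩ := hC s hspos
  have mono : ∀ t : ℝ, t ≤ 0 → s ^ t ≤ ‖z‖ ^ (2 * t) := fun t ht => by
    rw [← sq_rpow_eq]
    exact Real.rpow_le_rpow_of_nonpos (by positivity) hs2 ht
  have e1 : ‖z‖ ^ (2 * (-nexp N - 1)) * ‖z‖ = ‖z‖ ^ (-((N:ℝ) - 1)) := by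
    rw [← Real.rpow_add_one hz0.ne', nexp]; ring_nf
  have e2 : ‖z‖ ^ (2 * (-nexp N - 2)) * ‖z‖ * ‖z‖ = ‖z‖ ^ (-(N:ℝ)) := by
    rw [← Real.rpow_add_one hz0.ne', ← Real.rpow_add_one hz0.ne', nexp]; ring_nf
  have e3 : ‖z‖ ^ (2 * (-nexp N - 1)) = ‖z‖ ^ (-(N:ℝ)) := by
    rw [nexp]; ring_nf
  have m1 := mono (-nexp N - 1) (by linarith)
  have m2 := mono (-nexp N - 2) (by linarith)
  have n1 : |prof1 c (nexp N) (R ^ 2) s| ≤ C * ‖z‖ ^ (2 * (-nexp N - 1)) := b1.trans (by gcongr)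
  have n2 : |prof2 c (nexp N) (R ^ 2) s| ≤ C * ‖z‖ ^ (2 * (-nexp N - 2)) := b2.trans (by gcongr)
  refine ⟨?_, ?_, ?_⟩
  · have m0 := mono (-nexp N) (by linarith)
    rw [show 2 * -nexp N = -((N:ℝ) - 2) by rw [nexp]; ring] at m0
    have : C * s ^ (-nexp N) ≤ C * ‖z‖ ^ (-((N:ℝ) - 2)) := by gcongr
    have h0 : 0 ≤ C * ‖z‖ ^ (-((N:ℝ) - 2)) := by positivity
    rw [ker0, Real.norm_eq_abs, ← hs]
    linarith
  · rw [ker1, norm_smul, norm_bil_apply, Real.norm_eq_abs, abs_mul, ← hs, ← e1, abs_two]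
    have := mul_le_mul_of_nonneg_right n1 hz0.le
    have h0 : 0 ≤ C * ‖z‖ ^ (2 * (-nexp N - 1)) * ‖z‖ := by positivity
    nlinarith
  · rw [ker2, ← hs]
    refine (norm_add_le _ _).trans ?_
    rw [norm_smul, norm_smul, ContinuousLinearMap.norm_smulRight_apply, norm_bil_apply,
      Real.norm_eq_abs, Real.norm_eq_abs, abs_mul, abs_mul, abs_two,
      abs_of_pos (show (0:ℝ) < 4 by norm_num)]
    have t1 : 2 * |prof1 c (nexp N) (R ^ 2) s| * ‖(bil : Eu N →L[ℝ] Eu N →L[ℝ] ℝ)‖ ≤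
        2 * (C * ‖z‖ ^ (-(N:ℝ))) * 1 := by
      rw [← e3]
      gcongr
      exact norm_bil_le
    have t2 : 4 * |prof2 c (nexp N) (R ^ 2) s| * (‖z‖ * ‖z‖) ≤ 4 * (C * ‖z‖ ^ (-(N:ℝ))) := by
      rw [← e2]
      have := mul_le_mul_of_nonneg_right n2 (show 0 ≤ ‖z‖ * ‖z‖ by positivity)
      linarith
    linarith

lemma tendsto_ker (c R : ℝ) (hz : z ≠ 0) {e : ℕ → ℝ} (he : Tendsto e atTop (nhds 0)) :
    Tendsto (fun j => ker0 c R (e j) z) atTop (nhds (ker0 c R 0 z)) ∧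
    Tendsto (fun j => ker1 c R (e j) z) atTop (nhds (ker1 c R 0 z)) ∧
    Tendsto (fun j => ker2 c R (e j) z) atTop (nhds (ker2 c R 0 z)) := by
  have hpos : 0 < ‖z‖ ^ 2 + 0 := by have := norm_pos_iff.2 hz; positivity
  have hs : Tendsto (fun j => ‖z‖ ^ 2 + e j) atTop (nhds (‖z‖ ^ 2 + 0)) :=
    tendsto_const_nhds.add he
  have c0 := (hasDerivAt_prof (c := c) (m := nexp N) (T := R ^ 2) hpos).continuousAt.tendsto.comp hs
  have c1 :=
    (hasDerivAt_prof1 (c := c) (m := nexp N) (T := R ^ 2) hpos).continuousAt.tendsto.comp hs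
  have hc2 : ContinuousAt (prof2 c (nexp N) (R ^ 2)) (‖z‖ ^ 2 + 0) := by
    have hr : ∀ t : ℝ, ContinuousAt (fun s : ℝ => s ^ t) (‖z‖ ^ 2 + 0) := fun t =>
      Real.continuousAt_rpow_const _ _ (Or.inl hpos.ne')
    have k0 := (contDiff_cutoff (T := R ^ 2) (n := 0)).continuous.continuousAt (x := ‖z‖ ^ 2 + 0)
    have k1 :=
      (contDiff_deriv_cutoff (T := R ^ 2) (n := 0)).continuous.continuousAt (x := ‖z‖ ^ 2 + 0)
    have k2 :=
      (contDiff_deriv_deriv_cutoff (T := R ^ 2) (n := 0)).continuous.continuousAt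
        (x := ‖z‖ ^ 2 + 0)
    exact continuousAt_const.mul ((((continuousAt_const.mul (hr _)).mul k0).sub
      ((continuousAt_const.mul (hr _)).mul k1)).add ((hr _).mul k2))
  have c2 := hc2.tendsto.comp hs
  exact ⟨c0, (c1.const_mul 2).smul_const _, ((c1.const_mul 2).smul_const _).add
    ((c2.const_mul 4).smul_const _)⟩

/-- A sequence of regularisation parameters. -/
noncomputable def regSeq (j : ℕ) : ℝ := 1 / ((j : ℝ) + 1)

lemma regSeq_pos (j : ℕ) : 0 < regSeq j := by rw [regSeq]; positivity

lemma tendsto_regSeq : Tendsto regSeq atTop (nhds 0) := tendsto_one_div_add_atTop_nhds_zero_nat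

lemma exists_kernelApprox (hN : 3 ≤ N) (hR : 0 < R) (c : ℝ) : ∃ C, 0 ≤ C ∧
    KernelApprox (fun j => (ker0 c R (regSeq j) : Eu N → ℝ)) (ker0 c R 0)
      (fun z => C * wt (2 * R) (N - 2) z) (2 * R) ∧
    KernelApprox (fun j => (ker1 c R (regSeq j) : Eu N → _)) (ker1 c R 0)
      (fun z => C * wt (2 * R) (N - 1) z) (2 * R) ∧
    KernelApprox (fun j => (ker2 c R (regSeq j) : Eu N → _)) (ker2 c R 0)
      (fun z => C * wt (2 * R) N z) (2 * R) := by
  obtain ⟨C, hC0, hC⟩ := exists_bound_ker hN hR c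
  have hN1 : 1 ≤ N := by omega
  refine ⟨C, hC0, ⟨fun j => ?_, fun j z hz => ker0_eq_zero hR (regSeq_pos j).le hz, fun j => ?_, ?_,
    fun z hz => ker0_eq_zero hR le_rfl hz⟩, ⟨fun j => ?_,
    fun j z hz => ker1_eq_zero hR (regSeq_pos j).le hz, fun j => ?_, ?_,
    fun z hz => ker1_eq_zero hR le_rfl hz⟩, ⟨fun j => ?_,
    fun j z hz => ker2_eq_zero hR (regSeq_pos j).le hz, fun j => ?_, ?_,
    fun z hz => ker2_eq_zero hR le_rfl hz⟩⟩
  · exact (contDiff_ker0 (regSeq_pos j) (n := 0)).continuous.aestronglyMeasurable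
  · filter_upwards [ae_ne_zero hN1] with z hz using (hC _ (regSeq_pos j).le z hz).1
  · filter_upwards [ae_ne_zero hN1] with z hz using (tendsto_ker c R hz tendsto_regSeq).1
  · exact (contDiff_ker1 (regSeq_pos j)).continuous.aestronglyMeasurable
  · filter_upwards [ae_ne_zero hN1] with z hz using (hC _ (regSeq_pos j).le z hz).2.1
  · filter_upwards [ae_ne_zero hN1] with z hz using (tendsto_ker c R hz tendsto_regSeq).2.1
  · have := (contDiff_ker1 (N := N) (c := c) (R := R) (regSeq_pos j)).continuous_fderiv one_ne_zero
    rw [fderiv_ker1 (regSeq_pos j)] at this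
    exact this.aestronglyMeasurable
  · filter_upwards [ae_ne_zero hN1] with z hz using (hC _ (regSeq_pos j).le z hz).2.2
  · filter_upwards [ae_ne_zero hN1] with z hz using (tendsto_ker c R hz tendsto_regSeq).2.2

/-- The normalising constant of the fundamental solution. -/
noncomputable def fundConst (N : ℕ) : ℝ :=
  (N * volume.real (Metric.ball (0 : Eu N) 1) * (2 * nexp N))⁻¹

lemma fundConst_pos (hN : 3 ≤ N) : 0 < fundConst N := by
  have hN' : (3:ℝ) ≤ N := by exact_mod_cast hN
  have hm : 0 < nexp N := by rw [nexp]; linarith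
  have hv : 0 < volume.real (Metric.ball (0 : Eu N) 1) := by
    rw [Measure.real, ENNReal.toReal_pos_iff]
    exact ⟨Metric.measure_ball_pos _ _ one_pos, measure_ball_lt_top⟩
  rw [fundConst]
  positivity

lemma integral_kerLap (hN : 3 ≤ N) (hR : 0 < R) :
    ∫ z : Eu N, kerLap (fundConst N) R z = -1 := by
  have hN' : (3:ℝ) ≤ N := by exact_mod_cast hN
  have := nontrivial_eu (show 1 ≤ N by omega)
  set c := fundConst N with hc
  set m := nexp N with hm
  have hm0 : 0 < m := by rw [hm, nexp]; linarith
  have h1 := integral_fun_norm_addHaar (volume : Measure (Eu N))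
    (fun r => profLap c m (R ^ 2) (r ^ 2))
  have h1' : ∫ z : Eu N, kerLap c R z = ∫ z : Eu N, profLap c m (R ^ 2) (‖z‖ ^ 2) := rfl
  rw [h1', h1]
  simp only [finrank_euclideanSpace, Fintype.card_fin, smul_eq_mul, nsmul_eq_mul]
  -- the primitive, continuously extended to the origin
  set P : ℝ → ℝ := fun r => if r < R then 2 * (m * c) else -(2 * r ^ N * prof1 c m (R ^ 2) (r ^ 2))
    with hP
  have hPform : ∀ r, 0 < r → P r = -(2 * r ^ N * prof1 c m (R ^ 2) (r ^ 2)) := by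
    intro r hr
    simp only [hP]
    split_ifs with h
    · have hlt : r ^ 2 < R ^ 2 := by nlinarith
      have e : r ^ N * (r ^ 2) ^ (-m - 1) = 1 := by
        rw [← Real.rpow_natCast r N, ← Real.rpow_natCast r 2, ← Real.rpow_mul hr.le,
          ← Real.rpow_add hr]
        have : (N : ℝ) + ((2 : ℕ) : ℝ) * (-m - 1) = 0 := by rw [hm, nexp]; push_cast; ring
        rw [this, Real.rpow_zero]
      rw [prof1, cutoff_eq_one (by positivity) hlt.le, deriv_cutoff_of_lt (by positivity) hlt]
      linear_combination (-2 * m * c) * e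
    · rfl
  have hderiv : ∀ r ∈ Ioi (0:ℝ), HasDerivAt P (r ^ (N - 1) * profLap c m (R ^ 2) (r ^ 2)) r := by
    intro r hr
    have hr0 : (0:ℝ) < r := hr
    have h2 : 0 < r ^ 2 := by positivity
    have hsq : HasDerivAt (fun r : ℝ => r ^ 2) (2 * r) r := by simpa using hasDerivAt_pow 2 r
    have d1 : HasDerivAt (fun r : ℝ => prof1 c m (R ^ 2) (r ^ 2))
        (prof2 c m (R ^ 2) (r ^ 2) * (2 * r)) r :=
      HasDerivAt.comp (h₂ := prof1 c m (R ^ 2)) r (hasDerivAt_prof1 h2) hsq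
    have d2 := (((hasDerivAt_pow N r).const_mul 2).mul d1).neg
    have d3 : HasDerivAt P _ r := d2.congr_of_eventuallyEq (by
      filter_upwards [Ioi_mem_nhds hr0] with y hy using hPform y hy)
    refine d3.congr_deriv ?_
    rw [profLap_eq h2]
    have : r ^ N = r ^ (N - 1) * r := by rw [← pow_succ, Nat.sub_add_cancel (by omega)]
    rw [this, hm, nexp]
    push_cast
    ring
  have hcont : ContinuousWithinAt P (Ici 0) 0 := by
    have : P =ᶠ[nhds 0] fun _ => 2 * (m * c) := by
      filter_upwards [Iio_mem_nhds hR] with r hr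
      simp only [hP]; rw [if_pos (mem_Iio.1 hr)]
    exact (continuousAt_const.congr this.symm).continuousWithinAt
  have hlim : Tendsto P atTop (nhds 0) := by
    refine tendsto_const_nhds.congr' ?_
    filter_upwards [eventually_gt_atTop (2 * R)] with r hr
    rw [hPform r (by linarith), prof1_eq_zero (by positivity) (by nlinarith)]
    simp
  have hint : IntegrableOn (fun r : ℝ => r ^ (N - 1) * profLap c m (R ^ 2) (r ^ 2)) (Ioi 0) := by
    have hcl : Continuous fun r : ℝ => r ^ (N - 1) * profLap c m (R ^ 2) (r ^ 2) :=
      (continuous_pow _).mul ((contDiff_profLap (n := 0) (by positivity)).continuous.comp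
        (continuous_pow 2))
    refine (hcl.integrable_of_hasCompactSupport ?_).integrableOn
    refine HasCompactSupport.intro (isCompact_Icc (a := -(2 * R)) (b := 2 * R)) fun r hr => ?_
    rw [profLap_eq_zero_of_gt (by positivity), mul_zero]
    rw [mem_Icc, ← abs_le, not_le] at hr
    have := sq_abs r
    have := abs_nonneg r
    nlinarith
  have hval := integral_Ioi_of_hasDerivAt_of_tendsto hcont hderiv hint hlim
  rw [hval]
  have hP0 : P 0 = 2 * (m * c) := by simp only [hP]; rw [if_pos hR]
  have hcpos := (fundConst_pos hN).ne'
  have hci : c⁻¹ = N * volume.real (Metric.ball (0 : Eu N) 1) * (2 * m) := by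
    rw [hc, fundConst, inv_inv]
  have : c⁻¹ * c = 1 := inv_mul_cancel₀ hcpos
  rw [hci] at this
  rw [hP0]
  linear_combination (-1) * this

end Kernels

section Potential

variable {N : ℕ}

/-- The Laplacian as the trace of the second derivative. -/
noncomputable def lap (u : Eu N → ℝ) (x : Eu N) : ℝ := trBil (fderiv ℝ (fderiv ℝ u) x)

/-- Convolution with the truncated fundamental solution. -/
noncomputable def pot (R : ℝ) (h : Eu N → ℝ) : Eu N → ℝ := cv (ker0 (fundConst N) R 0) h

/-- Convolution with the gradient of the truncated fundamental solution. -/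
noncomputable def dpot (R : ℝ) (h : Eu N → ℝ) : Eu N → Eu N →L[ℝ] ℝ :=
  cv (ker1 (fundConst N) R 0) h

/-- Convolution with the smooth remainder of the Laplacian of the truncated fundamental
solution. -/
noncomputable def smo (R : ℝ) (h : Eu N → ℝ) : Eu N → ℝ := cv (kerLap (fundConst N) R) h

lemma integrable_const_mul_wt (hN : 1 ≤ N) (C ρ : ℝ) {s : ℝ} (hs : s < N) :
    Integrable fun z : Eu N => C * wt ρ s z := (integrable_wt hN ρ hs).const_mul C

lemma integrable_rpow_mul_const_mul_wt (hN : 1 ≤ N) (C ρ : ℝ) {s α : ℝ} (hs : s - α < N) :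
    Integrable fun z : Eu N => ‖z‖ ^ α * (C * wt ρ s z) := by
  refine ((integrable_norm_rpow_mul_wt hN ρ hs).const_mul C).congr ?_
  filter_upwards with z
  ring

lemma integrable_ker0 (hN : 3 ≤ N) {R : ℝ} (hR : 0 < R) (c : ℝ) :
    Integrable (ker0 c R 0 : Eu N → ℝ) := by
  obtain ⟨C, hC, H0, H1, H2⟩ := exists_kernelApprox hN hR c
  exact H0.integrable_lim (integrable_const_mul_wt (by omega) _ _ (by linarith))

lemma integrable_ker1 (hN : 3 ≤ N) {R : ℝ} (hR : 0 < R) (c : ℝ) :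
    Integrable (ker1 c R 0 : Eu N → _) := by
  obtain ⟨C, hC, H0, H1, H2⟩ := exists_kernelApprox hN hR c
  exact H1.integrable_lim (integrable_const_mul_wt (by omega) _ _ (by linarith))

variable {R : ℝ} {h : Eu N → ℝ}

lemma continuous_pot (hN : 3 ≤ N) (hR : 0 < R) (hh : Continuous h) : Continuous (pot R h) :=
  continuous_cv (integrable_ker0 hN hR _) (fun _ hz => ker0_eq_zero hR le_rfl hz) hh

lemma continuous_dpot (hN : 3 ≤ N) (hR : 0 < R) (hh : Continuous h) : Continuous (dpot R h) :=
  continuous_cv (integrable_ker1 hN hR _) (fun _ hz => ker1_eq_zero hR le_rfl hz) hh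

lemma hasFDerivAt_pot (hN : 3 ≤ N) (hR : 0 < R) (hh : Continuous h) (x : Eu N) :
    HasFDerivAt (pot R h) (dpot R h x) x := by
  obtain ⟨C, hC, H0, H1, H2⟩ := exists_kernelApprox hN hR (fundConst N)
  refine H0.hasFDerivAt (W' := fun z => C * wt (2 * R) (N - 1) z) ?_
    (integrable_const_mul_wt (by omega) _ _ (by linarith))
    (integrable_const_mul_wt (by omega) _ _ (by linarith))
    (fun j => contDiff_ker0 (regSeq_pos j)) hh x
  simpa only [fderiv_ker0 (regSeq_pos _)] using H1

lemma LocHolder.exists_norm_sub_le {α : ℝ} (hh : LocHolder α h) (x : Eu N) (ρ : ℝ) :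
    ∃ C, 0 ≤ C ∧ ∀ z : Eu N, ‖z‖ ≤ ρ → ‖h (x - z) - h x‖ ≤ C * ‖z‖ ^ α := by
  obtain ⟨C, hC0, hC⟩ := hh (‖x‖ + ρ)
  refine ⟨C, hC0, fun z hz => ?_⟩
  have := hC (x - z) x ((norm_sub_le _ _).trans (by linarith))
    (by linarith [norm_nonneg z])
  simpa using this

lemma integrable_sub_smul_ker2 (hN : 3 ≤ N) (hR : 0 < R) {α : ℝ} (hα : 0 < α)
    (hh : LocHolder α h) (x : Eu N) :
    Integrable fun z => (h (x - z) - h x) • ker2 (fundConst N) R 0 z := by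
  obtain ⟨C, hC, H0, H1, H2⟩ := exists_kernelApprox hN hR (fundConst N)
  obtain ⟨B, hB0, hB⟩ := hh.exists_norm_sub_le x (2 * R)
  have hc := hh.continuous hα
  refine ((integrable_rpow_mul_const_mul_wt (by omega) (B * C) (2 * R)
    (show (N : ℝ) - α < N by linarith))).mono' ?_ ?_
  · have hc' : Continuous fun z => h (x - z) - h x := by fun_prop
    exact hc'.aestronglyMeasurable.smul H2.meas_lim
  · filter_upwards [H2.bound_lim] with z hz
    rcases le_or_gt ‖z‖ (2 * R) with hzR | hzR
    · rw [norm_smul]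
      calc _ ≤ (B * ‖z‖ ^ α) * (C * wt (2 * R) N z) := by
            gcongr
            · exact hB z hzR
        _ = _ := by ring
    · rw [H2.supp_lim z hzR, smul_zero, norm_zero]
      have := wt_nonneg (2 * R) N z
      positivity

lemma integrable_kerLap (hR : 0 < R) (c : ℝ) : Integrable (kerLap c R : Eu N → ℝ) :=
  (contDiff_kerLap hR (n := 0)).continuous.integrable_of_hasCompactSupport
    (hasCompactSupport_of_norm fun _ hz => kerLap_eq_zero hR hz)

lemma hasFDerivAt_dpot (hN : 3 ≤ N) (hR : 0 < R) {α : ℝ} (hα : 0 < α) (hh : LocHolder α h) :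
    (∀ x, HasFDerivAt (dpot R h) (∫ z, (h (x - z) - h x) • ker2 (fundConst N) R 0 z) x) ∧
      Continuous fun x => ∫ z, (h (x - z) - h x) • ker2 (fundConst N) R 0 z := by
  obtain ⟨C, hC, H0, H1, H2⟩ := exists_kernelApprox hN hR (fundConst N)
  refine H1.hasFDerivAt_of_locHolder (W' := fun z => C * wt (2 * R) N z) hα ?_
    (integrable_const_mul_wt (by omega) _ _ (by linarith))
    (integrable_rpow_mul_const_mul_wt (by omega) _ _ (by linarith))
    (fun j => contDiff_ker1 (regSeq_pos j)) hh
  simpa only [fderiv_ker1 (regSeq_pos _)] using H2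

lemma fderiv_pot (hN : 3 ≤ N) (hR : 0 < R) (hh : Continuous h) :
    fderiv ℝ (pot R h) = dpot R h := funext fun x => (hasFDerivAt_pot hN hR hh x).fderiv

lemma contDiff_two_of_hasFDerivAt {u : Eu N → ℝ} {v : Eu N → Eu N →L[ℝ] ℝ}
    {w : Eu N → Eu N →L[ℝ] Eu N →L[ℝ] ℝ} (hu : ∀ x, HasFDerivAt u (v x) x)
    (hv : ∀ x, HasFDerivAt v (w x) x) (hw : Continuous w) : ContDiff ℝ 2 u := by
  have hv1 : ContDiff ℝ 1 v := by
    rw [contDiff_one_iff_fderiv]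
    refine ⟨fun x => (hv x).differentiableAt, ?_⟩
    rwa [show fderiv ℝ v = w from funext fun x => (hv x).fderiv]
  have := contDiff_succ_iff_fderiv (𝕜 := ℝ) (n := 1) (f := u)
  rw [show (2 : WithTop ℕ∞) = 1 + 1 by norm_num, this]
  refine ⟨fun x => (hu x).differentiableAt, by simp, ?_⟩
  rwa [show fderiv ℝ u = v from funext fun x => (hu x).fderiv]

lemma contDiff_pot (hN : 3 ≤ N) (hR : 0 < R) {α : ℝ} (hα : 0 < α) (hh : LocHolder α h) :
    ContDiff ℝ 2 (pot R h) :=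
  contDiff_two_of_hasFDerivAt (hasFDerivAt_pot hN hR (hh.continuous hα))
    (hasFDerivAt_dpot hN hR hα hh).1 (hasFDerivAt_dpot hN hR hα hh).2

lemma lap_pot (hN : 3 ≤ N) (hR : 0 < R) {α : ℝ} (hα : 0 < α) (hh : LocHolder α h) (x : Eu N) :
    lap (pot R h) x = -(h x + smo R h x) := by
  have hc := hh.continuous hα
  rw [lap, fderiv_pot hN hR hc, ((hasFDerivAt_dpot hN hR hα hh).1 x).fderiv,
    trBil_integral (integrable_sub_smul_ker2 hN hR hα hh x)]
  have e : ∫ z, trBil ((h (x - z) - h x) • ker2 (fundConst N) R 0 z) =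
      ∫ z, (h x * kerLap (fundConst N) R z - h (x - z) * kerLap (fundConst N) R z) := by
    refine integral_congr_ae ?_
    filter_upwards [ae_ne_zero (show 1 ≤ N by omega)] with z hz
    rw [trBil_smul, trBil_ker2_zero hz]
    ring
  have i2 : Integrable fun z => h (x - z) * kerLap (fundConst N) R z :=
    integrable_cv (integrable_kerLap hR _) (fun _ hz => kerLap_eq_zero hR hz) hc x
  rw [e, integral_sub ((integrable_kerLap hR _).const_mul _) i2,
    integral_const_mul, integral_kerLap hN hR]
  simp only [smo, cv, smul_eq_mul]
  ring

/-- Differentiation of a convolution in the smooth factor. -/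
lemma hasFDerivAt_cv_of_contDiff {k : Eu N → ℝ} {ρ : ℝ} (hk : Integrable k)
    (hs : ∀ z, ρ < ‖z‖ → k z = 0) {u : Eu N → ℝ} (hu : ContDiff ℝ 1 u) (x v : Eu N) :
    DifferentiableAt ℝ (cv k u) x ∧
      fderiv ℝ (cv k u) x v = cv k (fun y => fderiv ℝ u y v) x := by
  have hDc : Continuous (fderiv ℝ u) := hu.continuous_fderiv one_ne_zero
  obtain ⟨H, hH0, hH⟩ := exists_bound_of_continuous hDc (‖x‖ + 1 + ρ)
  have hc := hu.continuous
  have main : HasFDerivAt (fun y => ∫ z, u (y - z) • k z) (∫ z, k z • fderiv ℝ u (x - z)) x := by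
    refine hasFDerivAt_integral_of_dominated_of_fderiv_le (𝕜 := ℝ)
      (s := Metric.ball x 1) (bound := fun z => |k z| * H)
      (F' := fun y z => k z • fderiv ℝ u (y - z)) (Metric.ball_mem_nhds x one_pos) ?_
      (integrable_cv hk hs hc x) ?_ ?_ (hk.abs.mul_const H) ?_
    · filter_upwards with y using (integrable_cv hk hs hc y).aestronglyMeasurable
    · exact hk.aestronglyMeasurable.smul (Continuous.aestronglyMeasurable (by fun_prop))
    · filter_upwards with z y hy
      rw [norm_smul, Real.norm_eq_abs]
      rcases le_or_gt ‖z‖ ρ with hz | hz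
      · gcongr
        apply hH
        have h1 : ‖y - x‖ < 1 := by rwa [mem_ball_iff_norm] at hy
        have h2 : ‖y‖ ≤ ‖x‖ + ‖y - x‖ := norm_le_norm_add_norm_sub' y x
        exact (norm_sub_le _ _).trans (by linarith)
      · simp [hs z hz]
    · filter_upwards with z y hy
      have h1 : HasFDerivAt (fun y => u (y - z)) (fderiv ℝ u (y - z)) y := by
        have := (hu.differentiable one_ne_zero (y - z)).hasFDerivAt
        exact (this.comp y ((hasFDerivAt_id y).sub_const z)).congr_fderiv (by simp)
      refine (h1.const_smul (k z)).congr_of_eventuallyEq (Eventually.of_forall fun y => ?_)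
      simp [mul_comm]
  refine ⟨main.differentiableAt, ?_⟩
  rw [show cv k u = fun y => ∫ z, u (y - z) • k z from rfl, main.fderiv,
    ContinuousLinearMap.integral_apply]
  · simp [cv, mul_comm]
  · obtain ⟨H, hH0, hH⟩ := exists_bound_of_continuous hDc (‖x‖ + ρ)
    refine (hk.abs.mul_const H).mono'
      (hk.aestronglyMeasurable.smul (Continuous.aestronglyMeasurable (by fun_prop))) ?_
    filter_upwards with z
    rw [norm_smul, Real.norm_eq_abs]
    rcases le_or_gt ‖z‖ ρ with hz | hz
    · gcongr
      exact hH _ ((norm_sub_le _ _).trans (by linarith))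
    · simp [hs z hz]

lemma locHolder_one_of_contDiff {F : Type*} [NormedAddCommGroup F] [NormedSpace ℝ F]
    {u : Eu N → F} (hu : ContDiff ℝ 1 u) : LocHolder 1 u := by
  intro R
  obtain ⟨H, hH0, hH⟩ := exists_bound_of_continuous (hu.continuous_fderiv one_ne_zero) R
  refine ⟨H, hH0, fun x y hx hy => ?_⟩
  rw [Real.rpow_one]
  exact Convex.norm_image_sub_le_of_norm_fderiv_le (𝕜 := ℝ) (s := Metric.closedBall 0 R)
    (fun z _ => hu.differentiable one_ne_zero z)
    (fun z hz => hH z (by simpa using hz)) (convex_closedBall 0 R) (by simpa using hy)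
    (by simpa using hx)

lemma contDiff_fderiv_apply {u : Eu N → ℝ} (hu : ContDiff ℝ 2 u) (v : Eu N) :
    ContDiff ℝ 1 fun y => fderiv ℝ u y v :=
  (hu.fderiv_right (m := 1) (by norm_num)).clm_apply contDiff_const

lemma fderiv_fderiv_apply {u : Eu N → ℝ} {x : Eu N} (hu : DifferentiableAt ℝ (fderiv ℝ u) x)
    (v w : Eu N) : fderiv ℝ (fun y => fderiv ℝ u y v) x w = fderiv ℝ (fderiv ℝ u) x w v := by
  rw [fderiv_clm_apply hu (differentiableAt_const v)]
  simp

lemma continuous_lap {u : Eu N → ℝ} (hu : ContDiff ℝ 2 u) : Continuous (lap u) := by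
  have h1 : Continuous (fderiv ℝ (fderiv ℝ u)) :=
    (hu.fderiv_right (m := 1) (by norm_num)).continuous_fderiv one_ne_zero
  unfold lap trBil
  fun_prop

/-- Representation of a `C²` function by its Laplacian and its values nearby. -/
lemma eq_pot_lap (hN : 3 ≤ N) (hR : 0 < R) {u : Eu N → ℝ} (hu : ContDiff ℝ 2 u) (x : Eu N) :
    u x = -pot R (lap u) x - smo R u x := by
  have hu1 : ContDiff ℝ 1 u := hu.of_le (by norm_num)
  have hH := locHolder_one_of_contDiff hu1
  have h1 := lap_pot hN hR one_pos hH x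
  have hk := integrable_ker0 hN hR (fundConst N)
  have hs : ∀ z : Eu N, 2 * R < ‖z‖ → ker0 (fundConst N) R 0 z = 0 :=
    fun _ hz => ker0_eq_zero hR le_rfl hz
  have hdd : DifferentiableAt ℝ (fderiv ℝ (pot R u)) x := by
    rw [fderiv_pot hN hR hu.continuous]
    exact ((hasFDerivAt_dpot hN hR one_pos hH).1 x).differentiableAt
  have hD : Differentiable ℝ (fderiv ℝ u) :=
    (hu.fderiv_right (m := 1) (by norm_num)).differentiable one_ne_zero
  have h2 : lap (pot R u) x = pot R (lap u) x := by
    have key : ∀ v : Eu N, fderiv ℝ (fderiv ℝ (pot R u)) x v v =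
        cv (ker0 (fundConst N) R 0) (fun y => fderiv ℝ (fderiv ℝ u) y v v) x := by
      intro v
      rw [← fderiv_fderiv_apply hdd v v]
      have e1 : (fun y => fderiv ℝ (pot R u) y v) =
          cv (ker0 (fundConst N) R 0) fun y => fderiv ℝ u y v :=
        funext fun y => (hasFDerivAt_cv_of_contDiff hk hs hu1 y v).2
      rw [e1, (hasFDerivAt_cv_of_contDiff hk hs (contDiff_fderiv_apply hu v) x v).2]
      congr 1
      ext y
      exact fderiv_fderiv_apply (hD y) v v
    have hcc : Continuous (fderiv ℝ (fderiv ℝ u)) :=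
      (hu.fderiv_right (m := 1) (by norm_num)).continuous_fderiv one_ne_zero
    rw [lap, trBil]
    simp only [key]
    simp only [pot, cv]
    rw [← integral_finsetSum]
    · simp only [lap, trBil, Finset.sum_smul]
    · intro i _
      exact integrable_cv hk hs (h := fun y => fderiv ℝ (fderiv ℝ u) y
        (EuclideanSpace.single i 1) (EuclideanSpace.single i 1)) (by fun_prop) x
  linarith

/-- Convolution with the gradient of the smooth remainder. -/
noncomputable def dsmo (R : ℝ) (h : Eu N → ℝ) : Eu N → Eu N →L[ℝ] ℝ :=
  cv (fderiv ℝ (kerLap (fundConst N) R)) h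

lemma hasFDerivAt_smo (hR : 0 < R) (hh : Continuous h) (x : Eu N) :
    HasFDerivAt (smo R h) (dsmo R h x) x :=
  hasFDerivAt_cv (contDiff_kerLap hR (n := 1))
    (hasCompactSupport_of_norm fun _ hz => kerLap_eq_zero hR hz) hh x

lemma fderiv_eq_dpot_lap (hN : 3 ≤ N) (hR : 0 < R) {u : Eu N → ℝ} (hu : ContDiff ℝ 2 u)
    (x : Eu N) : fderiv ℝ u x = -dpot R (lap u) x - dsmo R u x := by
  have e : u = fun x => -pot R (lap u) x - smo R u x := funext (eq_pot_lap hN hR hu)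
  conv_lhs => rw [e]
  exact ((hasFDerivAt_pot hN hR (continuous_lap hu) x).neg.sub
    (hasFDerivAt_smo hR hu.continuous x)).fderiv

lemma contDiff_smo (hR : 0 < R) (hh : Continuous h) : ContDiff ℝ 2 (smo R h) := by
  have h2 : ContDiff ℝ 2 (fderiv ℝ (kerLap (fundConst N) R : Eu N → ℝ)) :=
    (contDiff_kerLap hR (n := 3)).fderiv_right (by norm_num)
  have h3 : Continuous (fderiv ℝ (fderiv ℝ (kerLap (fundConst N) R : Eu N → ℝ))) :=
    h2.continuous_fderiv (by norm_num)
  have s1 := fderiv_eq_zero_of_norm (N := N) fun z (hz : 2 * R < ‖z‖) =>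
    kerLap_eq_zero (c := fundConst N) hR hz
  have s2 := fderiv_eq_zero_of_norm s1
  refine contDiff_two_of_hasFDerivAt (hasFDerivAt_smo hR hh)
    (fun x => hasFDerivAt_cv (h2.of_le (by norm_num)) (hasCompactSupport_of_norm s1) hh x) ?_
  exact continuous_cv (h3.integrable_of_hasCompactSupport (hasCompactSupport_of_norm s2)) s2 hh

end Potential

section Estimates

variable {N : ℕ} {F : Type*} [NormedAddCommGroup F] [NormedSpace ℝ F]

lemma exists_norm_cv_le {k : Eu N → F} {ρ : ℝ} (hk : Integrable k)
    (hs : ∀ z, ρ < ‖z‖ → k z = 0) : ∃ C, 0 ≤ C ∧ ∀ (h : Eu N → ℝ) (x : Eu N) (H : ℝ), 0 ≤ H →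
      (∀ y, ‖x - y‖ ≤ ρ → |h y| ≤ H) → ‖cv k h x‖ ≤ C * H := by
  refine ⟨∫ z, ‖k z‖, integral_nonneg fun _ => norm_nonneg _, fun h x H hH0 hH => ?_⟩
  rw [mul_comm]
  exact norm_integral_mul_kernel_le (b := fun z => h (x - z)) hs hH0
    (fun z hz => hH _ (by simpa using hz)) hk.norm (Eventually.of_forall fun _ => le_rfl)

lemma norm_cv_sub_le {k : Eu N → F} {W : Eu N → ℝ} {ρ C α : ℝ} (hN : 1 ≤ N) (hk : Integrable k)
    (hW : Integrable W) (hs : ∀ z, ρ < ‖z‖ → k z = 0) (hC : 0 ≤ C) (hW0 : ∀ z, 0 ≤ W z)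
    (hkW : ∀ a b, a ≠ 0 → b ≠ 0 → ‖k a - k b‖ ≤ C * ‖a - b‖ ^ α * (W a + W b))
    {h : Eu N → ℝ} (hh : Continuous h) {x x' : Eu N} {H : ℝ} (hH0 : 0 ≤ H)
    (hH : ∀ y, ‖x - y‖ ≤ ρ ∨ ‖x' - y‖ ≤ ρ → |h y| ≤ H) :
    ‖cv k h x - cv k h x'‖ ≤ 2 * C * (∫ z, W z) * H * ‖x - x'‖ ^ α := by
  have hi : ∀ x, Integrable fun y => h y • k (x - y) := fun x => by
    have := (integrable_cv hk hs hh x).comp_sub_left x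
    simpa using this
  have hWi : ∀ x, Integrable fun y => W (x - y) := fun x => hW.comp_sub_left x
  rw [cv_eq_integral_sub, cv_eq_integral_sub, ← integral_sub (hi x) (hi x')]
  have hb : ∀ᵐ y, ‖h y • k (x - y) - h y • k (x' - y)‖ ≤
      H * (C * ‖x - x'‖ ^ α * (W (x - y) + W (x' - y))) := by
    have := nontrivial_eu hN
    filter_upwards [Measure.ae_ne volume x, Measure.ae_ne volume x'] with y hy hy'
    rw [← smul_sub, norm_smul, Real.norm_eq_abs]
    have h1 := hkW (x - y) (x' - y) (sub_ne_zero.2 hy.symm) (sub_ne_zero.2 hy'.symm)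
    rw [sub_sub_sub_cancel_right] at h1
    by_cases hc : ‖x - y‖ ≤ ρ ∨ ‖x' - y‖ ≤ ρ
    · exact mul_le_mul (hH y hc) h1 (norm_nonneg _) hH0
    · push Not at hc
      rw [hs _ hc.1, hs _ hc.2, sub_zero, norm_zero, mul_zero]
      have := hW0 (x - y)
      have := hW0 (x' - y)
      positivity
  refine (norm_integral_le_of_norm_le ((((hWi x).add (hWi x')).const_mul _).const_mul _)
    hb).trans_eq ?_
  have e1 : ∫ y, H * (C * ‖x - x'‖ ^ α * (W (x - y) + W (x' - y))) =
      H * (C * ‖x - x'‖ ^ α * ((∫ y, W (x - y)) + ∫ y, W (x' - y))) := by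
    rw [integral_const_mul, integral_const_mul, integral_add (hWi x) (hWi x')]
  refine e1.trans ?_
  rw [integral_sub_left_eq_self, integral_sub_left_eq_self]
  ring

variable {c R : ℝ}

lemma norm_ker1_sub_le (hN : 3 ≤ N) (hR : 0 < R) (c : ℝ) : ∃ C, 0 ≤ C ∧ ∀ a b : Eu N, a ≠ 0 →
    b ≠ 0 → ‖ker1 c R 0 a - ker1 c R 0 b‖ ≤ C * ‖a - b‖ ^ (1 / 2 : ℝ) *
      (wt (4 * R) (N - 1 / 2) a + wt (4 * R) (N - 1 / 2) b) := by
  obtain ⟨C, hC0, hC⟩ := exists_bound_ker hN hR c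
  have hw : ∀ a : Eu N, 0 ≤ wt (4 * R) (N - 1 / 2) a := fun a => wt_nonneg _ _ _
  refine ⟨2 * C + C * 2 ^ (N : ℝ), by positivity, fun a b ha hb => ?_⟩
  have ha0 := norm_pos_iff.2 ha
  have hb0 := norm_pos_iff.2 hb
  have hsq : ∀ t : ℝ, 0 < t → t = t ^ (1 / 2 : ℝ) * t ^ (1 / 2 : ℝ) := fun t ht => by
    rw [← Real.rpow_add ht]; norm_num
  have hwt : ∀ a : Eu N, ‖a‖ ≤ 4 * R → wt (4 * R) (N - 1 / 2) a = ‖a‖ ^ (1 / 2 - (N : ℝ)) :=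
    fun a ha => by rw [wt, if_pos ha]; ring_nf
  rcases le_or_gt ‖a - b‖ (‖a‖ / 2) with hab | hab
  · have hb2 : ‖a‖ / 2 ≤ ‖b‖ := by
      have := norm_sub_norm_le a b
      linarith
    rcases le_or_gt ‖a‖ (4 * R) with haR | haR
    · have hseg : ∀ z ∈ Metric.closedBall a ‖a - b‖, ‖a‖ / 2 ≤ ‖z‖ := fun z hz => by
        rw [mem_closedBall_iff_norm'] at hz
        have := norm_sub_norm_le a z
        linarith
      have hne : ∀ z ∈ Metric.closedBall a ‖a - b‖, z ≠ 0 := fun z hz h0 => by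
        have := hseg z hz
        rw [h0, norm_zero] at this
        linarith
      have hpos : ∀ z ∈ Metric.closedBall a ‖a - b‖, 0 < ‖z‖ ^ 2 + (0 : ℝ) := fun z hz => by
        have := norm_pos_iff.2 (hne z hz)
        positivity
      have hm := Convex.norm_image_sub_le_of_norm_hasFDerivWithin_le (𝕜 := ℝ)
        (f := ker1 c R 0) (f' := ker2 c R 0) (C := C * (‖a‖ / 2) ^ (-(N : ℝ)))
        (fun z hz => (hasFDerivAt_ker1 (c := c) (R := R) (hpos z hz)).hasFDerivWithinAt)
        (fun z hz => ?_) (convex_closedBall a ‖a - b‖)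
        (x := b) (y := a) (mem_closedBall_iff_norm'.2 le_rfl) (by simp)
      · have e1 : (‖a‖ / 2) ^ (-(N : ℝ)) = 2 ^ (N : ℝ) * ‖a‖ ^ (-(N : ℝ)) := by
          rw [Real.div_rpow ha0.le (by norm_num), Real.rpow_neg (by norm_num : (0:ℝ) ≤ 2)]
          field_simp
        have e2 : ‖a‖ ^ (-(N : ℝ)) * ‖a‖ ^ (1 / 2 : ℝ) = ‖a‖ ^ (1 / 2 - (N : ℝ)) := by
          rw [← Real.rpow_add ha0]; ring_nf
        have e3 : ‖a - b‖ ≤ ‖a‖ ^ (1 / 2 : ℝ) * ‖a - b‖ ^ (1 / 2 : ℝ) := by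
          rcases (norm_nonneg (a - b)).eq_or_lt with h0 | h0
          · rw [← h0]; positivity
          · conv_lhs => rw [hsq _ h0]
            gcongr
            linarith
        calc _ ≤ _ := hm
          _ ≤ C * (2 ^ (N : ℝ) * ‖a‖ ^ (-(N : ℝ))) *
              (‖a‖ ^ (1 / 2 : ℝ) * ‖a - b‖ ^ (1 / 2 : ℝ)) := by rw [e1]; gcongr
          _ = C * 2 ^ (N : ℝ) * ‖a - b‖ ^ (1 / 2 : ℝ) * ‖a‖ ^ (1 / 2 - (N : ℝ)) := by
            rw [← e2]; ring
          _ ≤ _ := by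
            rw [← hwt a haR]
            have := hw a
            gcongr
            · linarith
            · linarith [hw b]
      · refine ((hC 0 le_rfl z (hne z hz)).2.2).trans ?_
        gcongr
        rw [wt]
        split_ifs
        · exact Real.rpow_le_rpow_of_nonpos (by positivity) (hseg z hz) (by simp)
        · positivity
    · rw [ker1_eq_zero hR le_rfl (by linarith), ker1_eq_zero hR le_rfl (by linarith), sub_zero,
        norm_zero]
      have := hw a
      have := hw b
      positivity
  · have hb3 : ‖b‖ ≤ 4 * ‖a - b‖ := by
      have := norm_sub_norm_le b a
      rw [norm_sub_rev] at this
      linarith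
    have h4 : (4 : ℝ) ^ (1 / 2 : ℝ) = 2 := by
      rw [show (4 : ℝ) = 2 ^ (2 : ℝ) by norm_num, ← Real.rpow_mul (by norm_num)]; norm_num
    have key : ∀ z : Eu N, z ≠ 0 → ‖z‖ ≤ 4 * ‖a - b‖ →
        ‖ker1 c R 0 z‖ ≤ 2 * C * ‖a - b‖ ^ (1 / 2 : ℝ) * wt (4 * R) (N - 1 / 2) z := by
      intro z hz hzab
      have hz0 := norm_pos_iff.2 hz
      rcases le_or_gt ‖z‖ (2 * R) with hzR | hzR
      · refine (hC 0 le_rfl z hz).2.1.trans ?_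
        rw [hwt z (by linarith), wt, if_pos hzR]
        have e : ‖z‖ ^ (-((N : ℝ) - 1)) = ‖z‖ ^ (1 / 2 : ℝ) * ‖z‖ ^ (1 / 2 - (N : ℝ)) := by
          rw [← Real.rpow_add hz0]; ring_nf
        have e2 : ‖z‖ ^ (1 / 2 : ℝ) ≤ 2 * ‖a - b‖ ^ (1 / 2 : ℝ) := by
          refine (Real.rpow_le_rpow hz0.le hzab (by norm_num)).trans_eq ?_
          rw [Real.mul_rpow (by norm_num) (norm_nonneg _), h4]
        rw [e]
        calc _ ≤ C * ((2 * ‖a - b‖ ^ (1 / 2 : ℝ)) * ‖z‖ ^ (1 / 2 - (N : ℝ))) := by gcongr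
          _ = _ := by ring
      · rw [ker1_eq_zero hR le_rfl hzR, norm_zero]
        have := hw z
        positivity
    refine (norm_sub_le _ _).trans ((add_le_add (key a ha (by linarith)) (key b hb hb3)).trans ?_)
    rw [← mul_add]
    have := hw a
    have := hw b
    have h2 : 0 ≤ C * 2 ^ (N : ℝ) := by positivity
    gcongr
    linarith

lemma exists_dpot_holder (hN : 3 ≤ N) (hR : 0 < R) : ∃ C, 0 ≤ C ∧ ∀ h : Eu N → ℝ, Continuous h →
    ∀ (x x' : Eu N) (H : ℝ), 0 ≤ H → (∀ y, ‖x - y‖ ≤ 2 * R ∨ ‖x' - y‖ ≤ 2 * R → |h y| ≤ H) →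
      ‖dpot R h x - dpot R h x'‖ ≤ C * H * ‖x - x'‖ ^ (1 / 2 : ℝ) := by
  obtain ⟨C, hC0, hC⟩ := norm_ker1_sub_le hN hR (fundConst N)
  have hN1 : 1 ≤ N := by omega
  have hW := integrable_wt hN1 (4 * R) (show (N : ℝ) - 1 / 2 < N by linarith)
  have hW0 : 0 ≤ ∫ z : Eu N, wt (4 * R) (N - 1 / 2) z := integral_nonneg fun z => wt_nonneg _ _ _
  refine ⟨2 * C * ∫ z : Eu N, wt (4 * R) (N - 1 / 2) z, by positivity,
    fun h hh x x' H hH0 hH => ?_⟩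
  exact norm_cv_sub_le hN1 (integrable_ker1 hN hR _) hW
    (fun _ hz => ker1_eq_zero hR le_rfl hz) hC0 (fun z => wt_nonneg _ _ _) hC hh hH0 hH

lemma dkerLap_eq_zero (hR : 0 < R) (z : Eu N) (hz : 2 * R < ‖z‖) :
    fderiv ℝ (kerLap c R) z = 0 :=
  fderiv_eq_zero_of_norm (fun _ hz => kerLap_eq_zero hR hz) z hz

lemma continuous_dkerLap (hR : 0 < R) : Continuous (fderiv ℝ (kerLap c R : Eu N → ℝ)) :=
  (contDiff_kerLap hR (n := 1)).continuous_fderiv one_ne_zero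

lemma integrable_dkerLap (hR : 0 < R) : Integrable (fderiv ℝ (kerLap c R : Eu N → ℝ)) :=
  (continuous_dkerLap hR).integrable_of_hasCompactSupport
    (hasCompactSupport_of_norm (dkerLap_eq_zero hR))

lemma exists_dsmo_holder (hN : 3 ≤ N) (hR : 0 < R) : ∃ C, 0 ≤ C ∧ ∀ h : Eu N → ℝ, Continuous h →
    ∀ (x x' : Eu N) (H : ℝ), 0 ≤ H → (∀ y, ‖x - y‖ ≤ 2 * R ∨ ‖x' - y‖ ≤ 2 * R → |h y| ≤ H) →
      ‖dsmo R h x - dsmo R h x'‖ ≤ C * H * ‖x - x'‖ ^ (1 / 2 : ℝ) := by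
  have hN1 : 1 ≤ N := by omega
  have hc2 : ContDiff ℝ 1 (fderiv ℝ (kerLap (fundConst N) R : Eu N → ℝ)) :=
    (contDiff_kerLap hR (n := 2)).fderiv_right (by norm_num)
  obtain ⟨L, hL⟩ := hc2.lipschitzWith_of_hasCompactSupport
    (hasCompactSupport_of_norm (dkerLap_eq_zero hR)) one_ne_zero
  obtain ⟨M, hM0, hM⟩ := exists_bound_of_continuous
    (continuous_dkerLap (N := N) (c := fundConst N) hR) (2 * R)
  have hM' : ∀ z : Eu N, ‖fderiv ℝ (kerLap (fundConst N) R) z‖ ≤ M := fun z => by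
    rcases le_or_gt ‖z‖ (2 * R) with h | h
    · exact hM z h
    · rw [dkerLap_eq_zero hR z h, norm_zero]; exact hM0
  have hW := integrable_wt hN1 (2 * R) (s := 0) (show (0 : ℝ) < N by exact_mod_cast (by omega))
  have hW0 : 0 ≤ ∫ z : Eu N, wt (2 * R) 0 z := integral_nonneg fun z => wt_nonneg _ _ _
  refine ⟨2 * (L + 2 * M) * ∫ z : Eu N, wt (2 * R) 0 z, by positivity,
    fun h hh x x' H hH0 hH => ?_⟩
  refine norm_cv_sub_le hN1 (integrable_dkerLap hR) hW (dkerLap_eq_zero hR) (by positivity)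
    (fun z => wt_nonneg _ _ _) (fun a b _ _ => ?_) hh hH0 hH
  have hwt : ∀ z : Eu N, ‖z‖ ≤ 2 * R → wt (2 * R) 0 z = 1 := fun z hz => by
    rw [wt, if_pos hz]; simp
  have h1 : ‖fderiv ℝ (kerLap (fundConst N) R) a - fderiv ℝ (kerLap (fundConst N) R) b‖ ≤
      (L + 2 * M) * ‖a - b‖ ^ (1 / 2 : ℝ) := by
    rcases le_or_gt ‖a - b‖ 1 with h | h
    · have h2 : ‖a - b‖ ≤ ‖a - b‖ ^ (1 / 2 : ℝ) := by
        conv_lhs => rw [← Real.rpow_one ‖a - b‖]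
        exact Real.rpow_le_rpow_of_exponent_ge' (norm_nonneg _) h (by norm_num) (by norm_num)
      have h3 := hL.norm_sub_le a b
      have : 0 ≤ ‖a - b‖ ^ (1 / 2 : ℝ) := by positivity
      have h4 : (L : ℝ) * ‖a - b‖ ≤ L * ‖a - b‖ ^ (1 / 2 : ℝ) := by gcongr
      nlinarith
    · have h2 : 1 ≤ ‖a - b‖ ^ (1 / 2 : ℝ) := Real.one_le_rpow h.le (by norm_num)
      have h3 := norm_sub_le (fderiv ℝ (kerLap (fundConst N) R) a)
        (fderiv ℝ (kerLap (fundConst N) R) b)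
      have h4 := hM' a
      have h5 := hM' b
      have h6 : (L : ℝ) + 2 * M ≤ (L + 2 * M) * ‖a - b‖ ^ (1 / 2 : ℝ) :=
        le_mul_of_one_le_right (by positivity) h2
      have := L.2
      linarith [L.coe_nonneg]
  by_cases hc : ‖a‖ ≤ 2 * R ∨ ‖b‖ ≤ 2 * R
  · have : 1 ≤ wt (2 * R) 0 a + wt (2 * R) 0 b := by
      rcases hc with hc | hc
      · rw [hwt a hc]; linarith [wt_nonneg (2 * R) 0 b]
      · rw [hwt b hc]; linarith [wt_nonneg (2 * R) 0 a]
    exact h1.trans (le_mul_of_one_le_right (by positivity) this)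
  · push Not at hc
    rw [dkerLap_eq_zero hR a hc.1, dkerLap_eq_zero hR b hc.2, sub_zero, norm_zero]
    have := wt_nonneg (2 * R) 0 a
    have := wt_nonneg (2 * R) 0 b
    positivity

end Estimates

section GradientEstimates

variable {N : ℕ}

lemma fderiv_comp_affine {F : Type*} [NormedAddCommGroup F] [NormedSpace ℝ F] {u : Eu N → F}
    (hu : Differentiable ℝ u) (l : ℝ) (x : Eu N) :
    fderiv ℝ (fun y => u (l • y + x)) = fun y => l • fderiv ℝ u (l • y + x) := by
  ext1 y
  have h1 : HasFDerivAt (fun y : Eu N => l • y + x) (l • ContinuousLinearMap.id ℝ (Eu N)) y :=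
    ((hasFDerivAt_id y).const_smul l).add_const x
  have h2 : HasFDerivAt (fun y => u (l • y + x))
      ((fderiv ℝ u (l • y + x)).comp (l • ContinuousLinearMap.id ℝ (Eu N))) y :=
    (hu (l • y + x)).hasFDerivAt.comp y h1
  rw [h2.fderiv]
  ext v
  simp

lemma lap_comp_affine {u : Eu N → ℝ} (hu : ContDiff ℝ 2 u) (l : ℝ) (x y : Eu N) :
    lap (fun y => u (l • y + x)) y = l ^ 2 * lap u (l • y + x) := by
  have hD : Differentiable ℝ (fderiv ℝ u) :=
    (hu.fderiv_right (m := 1) (by norm_num)).differentiable one_ne_zero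
  rw [lap, fderiv_comp_affine (hu.differentiable (by norm_num))]
  have h1 : DifferentiableAt ℝ (fun y => fderiv ℝ u (l • y + x)) y :=
    DifferentiableAt.comp (g := fderiv ℝ u) y (hD _) (by fun_prop)
  have h2 : fderiv ℝ (fun y => l • fderiv ℝ u (l • y + x)) y =
      l • fderiv ℝ (fun y => fderiv ℝ u (l • y + x)) y := fderiv_const_smul h1 l
  rw [h2, fderiv_comp_affine hD, trBil_smul, trBil_smul, lap]
  ring

/-- Interior gradient estimate for the Laplacian. -/
lemma exists_norm_fderiv_le (hN : 3 ≤ N) : ∃ C, 0 ≤ C ∧ ∀ u : Eu N → ℝ, ContDiff ℝ 2 u →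
    ∀ (x : Eu N) (l H M : ℝ), 0 < l → 0 ≤ H → 0 ≤ M →
      (∀ y, ‖x - y‖ ≤ 2 * l → |lap u y| ≤ H ∧ |u y| ≤ M) →
        ‖fderiv ℝ u x‖ ≤ C * (l * H + M / l) := by
  obtain ⟨C1, hC1, h1⟩ := exists_norm_cv_le (integrable_ker1 hN one_pos (fundConst N))
    (ρ := 2 * 1) (fun _ hz => ker1_eq_zero one_pos le_rfl hz)
  obtain ⟨C2, hC2, h2⟩ := exists_norm_cv_le
    (integrable_dkerLap (N := N) (c := fundConst N) one_pos) (dkerLap_eq_zero one_pos)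
  refine ⟨C1 + C2, by positivity, fun u hu x l H M hl hH hM hb => ?_⟩
  set v : Eu N → ℝ := fun y => u (l • y + x) with hv
  have hvc : ContDiff ℝ 2 v := hu.comp (by fun_prop)
  have hd : fderiv ℝ v 0 = l • fderiv ℝ u x := by
    rw [hv, fderiv_comp_affine (hu.differentiable (by norm_num))]
    simp
  have hin : ∀ y : Eu N, ‖0 - y‖ ≤ 2 * 1 → ‖x - (l • y + x)‖ ≤ 2 * l := fun y hy => by
    rw [show x - (l • y + x) = -(l • y) by abel, norm_neg, norm_smul, Real.norm_eq_abs,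
      abs_of_pos hl]
    rw [zero_sub, norm_neg] at hy
    nlinarith
  have e1 : ‖dpot 1 (lap v) 0‖ ≤ C1 * (l ^ 2 * H) := h1 _ _ _ (by positivity) fun y hy => by
    rw [hv, lap_comp_affine hu, abs_mul, abs_of_nonneg (sq_nonneg l)]
    exact mul_le_mul_of_nonneg_left (hb _ (hin y hy)).1 (sq_nonneg l)
  have e2 : ‖dsmo 1 v 0‖ ≤ C2 * M := h2 _ _ _ hM fun y hy => (hb _ (hin y hy)).2
  have e3 : l * ‖fderiv ℝ u x‖ ≤ C1 * (l ^ 2 * H) + C2 * M := by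
    calc l * ‖fderiv ℝ u x‖ = ‖fderiv ℝ v 0‖ := by
          rw [hd, norm_smul, Real.norm_eq_abs, abs_of_pos hl]
      _ = ‖-dpot 1 (lap v) 0 - dsmo 1 v 0‖ := by rw [fderiv_eq_dpot_lap hN one_pos hvc]
      _ ≤ ‖dpot 1 (lap v) 0‖ + ‖dsmo 1 v 0‖ := by
          refine (norm_sub_le _ _).trans ?_
          rw [norm_neg]
      _ ≤ _ := add_le_add e1 e2
  have e4 : C1 * (l ^ 2 * H) + C2 * M ≤ l * ((C1 + C2) * (l * H + M / l)) := by
    have : l * ((C1 + C2) * (l * H + M / l)) = (C1 + C2) * (l ^ 2 * H + M) := by field_simp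
    rw [this]
    have := mul_nonneg hC1 hM
    have : 0 ≤ C2 * (l ^ 2 * H) := by positivity
    linarith
  exact le_of_mul_le_mul_left (e3.trans e4) hl

lemma rpow_le_add_mul {a s t : ℝ} (ha0 : 0 < a) (ha1 : a < 1) (hs : 0 < s) (ht : 0 ≤ t) :
    t ^ a ≤ s ^ a + s ^ (a - 1) * t := by
  rcases le_or_gt t s with h | h
  · have := Real.rpow_le_rpow ht h ha0.le
    have h2 : 0 ≤ s ^ (a - 1) * t := by positivity
    linarith
  · have ht0 : 0 < t := hs.trans h
    have h1 : t ^ (a - 1) ≤ s ^ (a - 1) := Real.rpow_le_rpow_of_nonpos hs h.le (by linarith)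
    have h2 : t ^ a = t ^ (a - 1) * t := by
      rw [← Real.rpow_add_one ht0.ne']; ring_nf
    rw [h2]
    have h3 : 0 ≤ s ^ a := by positivity
    have := mul_le_mul_of_nonneg_right h1 ht
    linarith

/-- Local gradient bound under sublinear growth in the gradient. -/
lemma exists_norm_fderiv_le_of_sublinear (hN : 3 ≤ N) {a : ℝ} (ha0 : 0 < a) (ha1 : a < 1)
    {R H P M : ℝ} (hR : 0 < R) (hH : 0 ≤ H) (hP : 0 ≤ P) (hM : 0 ≤ M) :
    ∃ B, 0 ≤ B ∧ ∀ u : Eu N → ℝ, ContDiff ℝ 2 u →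
      (∀ x, ‖x‖ ≤ R → |u x| ≤ M ∧ |lap u x| ≤ H + P * ‖fderiv ℝ u x‖ ^ a) →
        ∀ x, ‖x‖ ≤ R / 2 → ‖fderiv ℝ u x‖ ≤ B := by
  obtain ⟨C, hC0, hC⟩ := exists_norm_fderiv_le hN
  obtain ⟨s, hs0, hs⟩ : ∃ s : ℝ, 0 < s ∧ C * (R * P) * s ^ (a - 1) ≤ 1 := by
    have h1 : Tendsto (fun s : ℝ => C * (R * P) * s ^ (a - 1)) atTop (nhds (C * (R * P) * 0)) := by
      have := (tendsto_rpow_neg_atTop (show 0 < 1 - a by linarith)).const_mul (C * (R * P))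
      simpa using this
    rw [mul_zero] at h1
    obtain ⟨s, h2, h3⟩ := ((h1.eventually_lt_const one_pos).and (eventually_gt_atTop 0)).exists
    exact ⟨s, h3, h2.le⟩
  set K := C * (R ^ 2 / 8 * (H + P * s ^ a) + 8 * M) with hK
  have hK0 : 0 ≤ K := by positivity
  refine ⟨2 * (2 * K) / R, by positivity, fun u hu hb x hx => ?_⟩
  have hDc : Continuous (fderiv ℝ u) := hu.continuous_fderiv (by norm_num)
  obtain ⟨x0, hx0, hmax⟩ := (isCompact_closedBall (0 : Eu N) R).exists_isMaxOn
    ⟨0, by simpa using hR.le⟩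
    (f := fun x => (R - ‖x‖) * ‖fderiv ℝ u x‖) (by fun_prop)
  rw [mem_closedBall_zero_iff] at hx0
  set A := (R - ‖x0‖) * ‖fderiv ℝ u x0‖ with hA
  have hA' : ∀ y, ‖y‖ ≤ R → (R - ‖y‖) * ‖fderiv ℝ u y‖ ≤ A := fun y hy =>
    hmax (mem_closedBall_zero_iff.2 hy)
  have hAK : A ≤ 2 * K := by
    set d := R - ‖x0‖ with hd
    rcases (show 0 ≤ d by linarith).eq_or_lt with h0 | h0
    · rw [hA, ← h0, zero_mul]; positivity
    have hA0 : 0 ≤ A := by positivity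
    have hdR : d ≤ R := by linarith [norm_nonneg x0]
    have hy : ∀ y, ‖x0 - y‖ ≤ 2 * (d / 8) →
        |lap u y| ≤ H + P * (s ^ a + s ^ (a - 1) * (2 * A / d)) ∧ |u y| ≤ M := by
      intro y hy
      have hy1 : ‖y‖ ≤ ‖x0‖ + d / 4 := by
        have := norm_sub_norm_le y x0
        rw [norm_sub_rev] at this
        linarith
      have hyR : ‖y‖ ≤ R := by linarith
      refine ⟨(hb y hyR).2.trans ?_, (hb y hyR).1⟩
      have h1 : ‖fderiv ℝ u y‖ ≤ 2 * A / d := by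
        rw [le_div_iff₀ h0]
        have := hA' y hyR
        have h2 : d / 2 * ‖fderiv ℝ u y‖ ≤ (R - ‖y‖) * ‖fderiv ℝ u y‖ := by
          gcongr
          linarith
        linarith
      have h2 := (rpow_le_add_mul ha0 ha1 hs0 (norm_nonneg (fderiv ℝ u y)))
      gcongr
      exact h2.trans (by gcongr)
    have h1 := hC u hu x0 (d / 8) _ M (by positivity) (by positivity) hM hy
    have h2 : A ≤ d * (C * (d / 8 * (H + P * (s ^ a + s ^ (a - 1) * (2 * A / d))) + M / (d / 8))) :=
      mul_le_mul_of_nonneg_left h1 h0.le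
    have h3 : d * (C * (d / 8 * (H + P * (s ^ a + s ^ (a - 1) * (2 * A / d))) + M / (d / 8))) =
        C * (d ^ 2 / 8 * (H + P * s ^ a) + 8 * M) + (C * (d * P) * s ^ (a - 1)) * A / 4 := by
      field_simp
      ring
    have h4 : C * (d ^ 2 / 8 * (H + P * s ^ a) + 8 * M) ≤ K := by
      rw [hK]; gcongr
    have h5 : C * (d * P) * s ^ (a - 1) ≤ 1 := le_trans (by gcongr) hs
    nlinarith
  have h1 := hA' x (by linarith)
  rw [le_div_iff₀ hR]
  have h2 : R / 2 * ‖fderiv ℝ u x‖ ≤ (R - ‖x‖) * ‖fderiv ℝ u x‖ := by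
    gcongr
    linarith
  linarith

end GradientEstimates

section Profile

lemma exists_radial_profile {Φ : ℝ → ℝ} (hc : Continuous Φ) (h0 : ∀ t, 0 ≤ Φ t) {c : ℝ}
    (h1 : ∀ t ≤ 1, Φ t = c) (hint : IntegrableOn (fun t => t * Φ t) (Ioi 0)) :
    ∃ Q Q1 Q2 : ℝ → ℝ, (∀ s, HasDerivAt Q (Q1 s) s) ∧ (∀ s, HasDerivAt Q1 (Q2 s) s) ∧
      Continuous Q2 ∧ (∀ s, 0 ≤ s → Q1 s ≤ 0) ∧
      (∀ s, 0 ≤ s → 4 * s * Q2 s + 6 * Q1 s = -Φ (√s)) ∧ (∀ s, 0 ≤ s → 0 ≤ Q s) ∧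
      Tendsto Q atTop (nhds 0) ∧ ∃ L, 0 ≤ L ∧ ∀ s, 0 ≤ s → 2 * |Q1 s| * √s ≤ L := by
  have hc0 : 0 ≤ c := h1 1 le_rfl ▸ h0 1
  have hcm : Continuous fun t => t * Φ t := continuous_id.mul hc
  set T0 := ∫ t in Ioi 0, t * Φ t with hT0
  set tail : ℝ → ℝ := fun t => T0 - ∫ s in (0:ℝ)..t, s * Φ s with htail
  have dtail : ∀ t, HasDerivAt tail (-(t * Φ t)) t := fun t =>
    (hcm.integral_hasStrictDerivAt 0 t).hasDerivAt.const_sub T0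
  have ctail : Continuous tail := continuous_iff_continuousAt.2 fun t => (dtail t).continuousAt
  have tail0 : tail 0 = T0 := by simp [htail]
  have ltail : Tendsto tail atTop (nhds 0) := by
    have := (intervalIntegral_tendsto_integral_Ioi 0 hint tendsto_id).const_sub T0
    rwa [← hT0, sub_self] at this
  have mtail : AntitoneOn tail (Ici 0) := by
    refine antitoneOn_of_deriv_nonpos (convex_Ici 0) ctail.continuousOn
      (fun t _ => (dtail t).differentiableAt.differentiableWithinAt) fun t ht => ?_
    rw [interior_Ici] at ht
    rw [(dtail t).deriv]
    have := mul_nonneg (le_of_lt ht) (h0 t)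
    linarith
  have ptail : ∀ t, 0 ≤ t → 0 ≤ tail t := fun t ht => le_of_tendsto ltail (by
    filter_upwards [eventually_ge_atTop t] with r hr using mtail ht (ht.trans hr) hr)
  set y : ℝ → ℝ := fun r => ∫ t in (0:ℝ)..r, tail t with hy
  have dy : ∀ r, HasDerivAt y (tail r) r := fun r => (ctail.integral_hasStrictDerivAt 0 r).hasDerivAt
  have cy : Continuous y := continuous_iff_continuousAt.2 fun t => (dy t).continuousAt
  have y0 : y 0 = 0 := by simp [hy]
  have grow : ∀ b r, 0 ≤ b → b ≤ r → y r ≤ y b + tail b * (r - b) := by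
    intro b r hb hr
    have hd : ∀ t, HasDerivAt (fun t => tail b * t - y t) (tail b - tail t) t := fun t =>
      (((hasDerivAt_id t).const_mul (tail b)).sub (dy t)).congr_deriv (by simp)
    have hm : MonotoneOn (fun t => tail b * t - y t) (Ici b) := by
      refine monotoneOn_of_deriv_nonneg (convex_Ici b) (by fun_prop)
        (fun t _ => (hd t).differentiableAt.differentiableWithinAt) fun t ht => ?_
      rw [interior_Ici] at ht
      rw [(hd t).deriv]
      have := mtail hb (hb.trans (le_of_lt ht)) (le_of_lt ht)
      linarith
    have := hm self_mem_Ici hr hr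
    simp only at this
    linarith
  have low : ∀ r, 0 ≤ r → tail r * r ≤ y r := by
    intro r hr
    have hd : ∀ t, HasDerivAt (fun t => y t - tail t * t) (t * Φ t * t) t := fun t =>
      ((dy t).sub ((dtail t).mul (hasDerivAt_id t))).congr_deriv (by simp)
    have hm : MonotoneOn (fun t => y t - tail t * t) (Ici 0) := by
      refine monotoneOn_of_deriv_nonneg (convex_Ici 0) (by fun_prop)
        (fun t _ => (hd t).differentiableAt.differentiableWithinAt) fun t ht => ?_
      rw [interior_Ici] at ht
      rw [(hd t).deriv]
      have := h0 t
      have : (0:ℝ) < t := ht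
      positivity
    have := hm self_mem_Ici hr hr
    simp only [y0, mul_zero, sub_zero] at this
    linarith
  have ftail : ∀ r, r ≤ 1 → tail r = T0 - c * r ^ 2 / 2 := by
    intro r hr
    have : ∫ s in (0:ℝ)..r, s * Φ s = ∫ s in (0:ℝ)..r, s * c := by
      refine intervalIntegral.integral_congr fun s hs => ?_
      have : s ≤ 1 := hs.2.trans (max_le zero_le_one hr)
      simp only [h1 s this]
    simp only [htail, this]
    rw [intervalIntegral.integral_mul_const, integral_id]
    ring
  have fy : ∀ r, r ≤ 1 → y r = T0 * r - c * r ^ 3 / 6 := by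
    intro r hr
    have : ∫ s in (0:ℝ)..r, tail s = ∫ s in (0:ℝ)..r, (T0 - c / 2 * s ^ 2) := by
      refine intervalIntegral.integral_congr fun s hs => ?_
      have : s ≤ 1 := hs.2.trans (max_le zero_le_one hr)
      simp only [ftail s this]
      ring
    simp only [hy, this]
    rw [intervalIntegral.integral_sub (by simp) (Continuous.intervalIntegrable (by fun_prop) _ _),
      intervalIntegral.integral_const_mul, integral_pow]
    simp
    ring
  set Q : ℝ → ℝ := fun s => if s < 1 then T0 - c * s / 6 else y (√s) / √s with hQ
  have Q_lt : ∀ s, s < 1 → Q s = T0 - c * s / 6 := fun s hs => if_pos hs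
  have Q_pos : ∀ s, 0 < s → Q s = y (√s) / √s := fun s hs => by
    by_cases h : s < 1
    · have hs' : 0 < √s := Real.sqrt_pos.2 hs
      rw [Q_lt s h, fy _ (Real.sqrt_le_one.2 h.le), eq_div_iff hs'.ne']
      have := Real.sq_sqrt hs.le
      linear_combination (c * √s / 6) * this
    · exact if_neg h
  set Q1 : ℝ → ℝ := fun s => if s < 1 then -c / 6 else (tail (√s) - Q s) / (2 * s) with hQ1
  have Q1_lt : ∀ s, s < 1 → Q1 s = -c / 6 := fun s hs => if_pos hs
  have Q1_pos : ∀ s, 0 < s → Q1 s = (tail (√s) - Q s) / (2 * s) := fun s hs => by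
    by_cases h : s < 1
    · rw [Q1_lt s h, ftail _ (Real.sqrt_le_one.2 h.le), Q_lt s h, Real.sq_sqrt hs.le]
      field_simp
      ring
    · exact if_neg h
  set Q2 : ℝ → ℝ := fun s => if s < 1 then 0 else (-Φ (√s) - 6 * Q1 s) / (4 * s) with hQ2
  have Q2_lt : ∀ s, s < 1 → Q2 s = 0 := fun s hs => if_pos hs
  have Q2_pos : ∀ s, 0 < s → Q2 s = (-Φ (√s) - 6 * Q1 s) / (4 * s) := fun s hs => by
    by_cases h : s < 1
    · rw [Q2_lt s h, Q1_lt s h, h1 _ (Real.sqrt_le_one.2 h.le)]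
      ring
    · exact if_neg h
  have dQ : ∀ s, HasDerivAt Q (Q1 s) s := by
    intro s
    rcases lt_or_ge s 1 with h | h
    · rw [Q1_lt s h]
      have : HasDerivAt (fun s => T0 - c * s / 6) (-c / 6) s := by
        have := (((hasDerivAt_id s).const_mul c).div_const 6).const_sub T0
        simpa [neg_div] using this
      exact this.congr_of_eventuallyEq (by filter_upwards [Iio_mem_nhds h] with t ht using Q_lt t ht)
    · have hs : 0 < s := by linarith
      have hs' : 0 < √s := Real.sqrt_pos.2 hs
      have hsq := Real.hasDerivAt_sqrt hs.ne'
      have : HasDerivAt (fun s => y (√s) / √s) _ s :=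
        (HasDerivAt.comp (h₂ := y) s (dy _) hsq).div hsq hs'.ne'
      refine (this.congr_of_eventuallyEq (by
        filter_upwards [Ioi_mem_nhds hs] with t ht using Q_pos t ht)).congr_deriv ?_
      rw [Q1_pos s hs, Q_pos s hs]
      have := Real.sq_sqrt hs.le
      simp only [Function.comp]
      rw [this]
      field_simp
  have cQ : Continuous Q := continuous_iff_continuousAt.2 fun t => (dQ t).continuousAt
  have dQ1 : ∀ s, HasDerivAt Q1 (Q2 s) s := by
    intro s
    rcases lt_or_ge s 1 with h | h
    · rw [Q2_lt s h]
      exact (hasDerivAt_const s (-c / 6)).congr_of_eventuallyEq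
        (by filter_upwards [Iio_mem_nhds h] with t ht using Q1_lt t ht)
    · have hs : 0 < s := by linarith
      have hs' : 0 < √s := Real.sqrt_pos.2 hs
      have hsq := Real.hasDerivAt_sqrt hs.ne'
      have : HasDerivAt (fun s => (tail (√s) - Q s) / (2 * s)) _ s :=
        ((HasDerivAt.comp (h₂ := tail) s (dtail _) hsq).sub (dQ s)).div
          ((hasDerivAt_id s).const_mul 2) (by simpa using hs.ne')
      refine (this.congr_of_eventuallyEq (by
        filter_upwards [Ioi_mem_nhds hs] with t ht using Q1_pos t ht)).congr_deriv ?_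
      have e := Q1_pos s hs
      have e2 : tail (√s) - Q s = 2 * s * Q1 s := by rw [e]; field_simp
      rw [Q2_pos s hs]
      simp only [Function.comp, e2, Pi.sub_apply]
      field_simp
      ring
  have cQ1 : Continuous Q1 := continuous_iff_continuousAt.2 fun t => (dQ1 t).continuousAt
  have hQ1le : ∀ s, 0 ≤ s → Q1 s ≤ 0 := by
    intro s hs
    rcases lt_or_ge s 1 with h | h
    · rw [Q1_lt s h]; linarith
    · have hs0 : 0 < s := by linarith
      have hs' : 0 < √s := Real.sqrt_pos.2 hs0
      rw [Q1_pos s hs0, Q_pos s hs0]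
      refine div_nonpos_of_nonpos_of_nonneg ?_ (by linarith)
      rw [sub_nonpos, le_div_iff₀ hs']
      exact low _ hs'.le
  have hQ0 : ∀ s, 0 < s → 0 ≤ Q s := fun s hs => by
    have hs' : 0 < √s := Real.sqrt_pos.2 hs
    rw [Q_pos s hs]
    refine div_nonneg ((mul_nonneg (ptail _ hs'.le) hs'.le).trans (low _ hs'.le)) hs'.le
  have hQT : ∀ s, 0 < s → Q s ≤ T0 := fun s hs => by
    have hs' : 0 < √s := Real.sqrt_pos.2 hs
    rw [Q_pos s hs, div_le_iff₀ hs']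
    have := grow 0 (√s) le_rfl hs'.le
    rwa [y0, tail0, zero_add, sub_zero] at this
  have hT0' : 0 ≤ T0 := tail0 ▸ ptail 0 le_rfl
  refine ⟨Q, Q1, Q2, dQ, dQ1, ?_, hQ1le, ?_, ?_, ?_, T0 + c, by positivity, ?_⟩
  · refine continuous_iff_continuousAt.2 fun s => ?_
    rcases lt_or_ge s 1 with h | h
    · exact continuousAt_const.congr (f := fun _ => (0:ℝ))
        (by filter_upwards [Iio_mem_nhds h] with t ht using (Q2_lt t ht).symm)
    · have hs : 0 < s := by linarith
      have : ContinuousAt (fun s => (-Φ (√s) - 6 * Q1 s) / (4 * s)) s :=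
        ContinuousAt.div (Continuous.continuousAt (by fun_prop)) (by fun_prop) (by positivity)
      exact this.congr (by filter_upwards [Ioi_mem_nhds hs] with t ht using (Q2_pos t ht).symm)
  · intro s hs
    rcases hs.eq_or_lt with h | h
    · rw [← h, Q1_lt 0 one_pos, Real.sqrt_zero, h1 0 zero_le_one]; ring
    · rw [Q2_pos s h]; field_simp; ring
  · intro s hs
    rcases hs.eq_or_lt with h | h
    · rw [← h, Q_lt 0 one_pos]; simpa using hT0'
    · exact hQ0 s h
  · have hlim : Tendsto (fun r => y r / r) atTop (nhds 0) := by
      rw [Metric.tendsto_atTop]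
      intro ε hε
      obtain ⟨b, hb1, hb0⟩ :=
        ((ltail.eventually_lt_const (half_pos hε)).and (eventually_ge_atTop 0)).exists
      refine ⟨max (b + 1) (2 * y b / ε + 1), fun r hr => ?_⟩
      have hrb : b + 1 ≤ r := (le_max_left _ _).trans hr
      have hr2 : 2 * y b / ε + 1 ≤ r := (le_max_right _ _).trans hr
      have hr0 : 0 < r := by linarith
      have hy0 : 0 ≤ y r := (mul_nonneg (ptail r hr0.le) hr0.le).trans (low r hr0.le)
      rw [Real.dist_eq, sub_zero, abs_of_nonneg (div_nonneg hy0 hr0.le), div_lt_iff₀ hr0]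
      have h2 := grow b r hb0 (by linarith)
      have h3 : tail b * (r - b) ≤ ε / 2 * r := by
        have := ptail b hb0
        nlinarith
      have h4 : 2 * y b / ε < r := by linarith
      rw [div_lt_iff₀ hε] at h4
      linarith
    refine (hlim.comp Real.tendsto_sqrt_atTop).congr' ?_
    filter_upwards [eventually_gt_atTop 0] with s hs using (Q_pos s hs).symm
  · intro s hs
    rw [abs_of_nonpos (hQ1le s hs)]
    rcases lt_or_ge s 1 with h | h
    · rw [Q1_lt s h]
      have h1 : √s ≤ 1 := Real.sqrt_le_one.2 h.le
      have := Real.sqrt_nonneg s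
      nlinarith
    · have hs0 : 0 < s := by linarith
      have hs1 : 1 ≤ √s := Real.one_le_sqrt.2 h
      have e : 2 * -Q1 s * √s = (Q s - tail (√s)) / √s := by
        rw [Q1_pos s hs0, eq_div_iff (by linarith)]
        have := Real.mul_self_sqrt hs
        field_simp
        linear_combination (Q s - tail √s) * this
      rw [e, div_le_iff₀ (by linarith)]
      have h5 := ptail (√s) (by linarith)
      have h6 := hQT s hs0
      nlinarith

end Profile

section Supersolution

variable {N : ℕ}

lemma exists_supersolution (hN : 3 ≤ N) {Φ : ℝ → ℝ} (hc : Continuous Φ) (h0 : ∀ t, 0 ≤ Φ t) {c : ℝ}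
    (h1 : ∀ t ≤ 1, Φ t = c) (hint : IntegrableOn (fun t => t * Φ t) (Ioi 0)) :
    ∃ w : Eu N → ℝ, ContDiff ℝ 2 w ∧ (∀ x, 0 ≤ w x) ∧ Tendsto w (cocompact _) (nhds 0) ∧
      (∀ x, lap w x ≤ -Φ ‖x‖) ∧ ∃ L, 0 ≤ L ∧ ∀ x, ‖fderiv ℝ w x‖ ≤ L := by
  obtain ⟨Q, Q1, Q2, dQ, dQ1, cQ2, hQ1, hode, hQ0, hQlim, L, hL0, hL⟩ :=
    exists_radial_profile hc h0 h1 hint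
  have dsq : ∀ x : Eu N, HasFDerivAt (fun z : Eu N => ‖z‖ ^ 2) ((2 : ℝ) • bil x) x := fun x => by
    simpa using hasFDerivAt_norm_sq_add 0 x
  have dw : ∀ x : Eu N, HasFDerivAt (fun z : Eu N => Q (‖z‖ ^ 2)) ((2 * Q1 (‖x‖ ^ 2)) • bil x) x :=
    fun x => by
      have := (dQ (‖x‖ ^ 2)).comp_hasFDerivAt x (dsq x)
      refine this.congr_fderiv ?_
      rw [smul_smul, mul_comm]
  have dw2 : ∀ x : Eu N, HasFDerivAt (fun z : Eu N => (2 * Q1 (‖z‖ ^ 2)) • bil z)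
      ((2 * Q1 (‖x‖ ^ 2)) • bil + (4 * Q2 (‖x‖ ^ 2)) • (bil x).smulRight (bil x)) x := fun x => by
    have h1 := ((dQ1 (‖x‖ ^ 2)).comp_hasFDerivAt x (dsq x)).const_mul 2
    have h2 := h1.smul (bil (N := N)).hasFDerivAt
    refine h2.congr_fderiv ?_
    congr 1
    ext v w
    simp [bil_apply]
    ring
  have cQ1 : Continuous Q1 := continuous_iff_continuousAt.2 fun t => (dQ1 t).continuousAt
  have hfd : fderiv ℝ (fun z : Eu N => Q (‖z‖ ^ 2)) = fun x => (2 * Q1 (‖x‖ ^ 2)) • bil x :=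
    funext fun x => (dw x).fderiv
  refine ⟨fun z => Q (‖z‖ ^ 2), contDiff_two_of_hasFDerivAt dw dw2 ?_,
    fun x => hQ0 _ (by positivity), ?_, fun x => ?_, L, hL0, fun x => ?_⟩
  · have hsr : Continuous fun x : Eu N => (bil x).smulRight (bil x) := by
      have : (fun x : Eu N => (bil x).smulRight (bil x)) = fun x =>
        ContinuousLinearMap.smulRightL ℝ (Eu N) (Eu N →L[ℝ] ℝ) (bil x) (bil x) := rfl
      rw [this]
      fun_prop
    fun_prop
  · refine hQlim.comp ?_
    exact (tendsto_pow_atTop two_ne_zero).comp (tendsto_norm_cocompact_atTop (E := Eu N))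
  · rw [lap, hfd, (dw2 x).fderiv, trBil_add, trBil_smul, trBil_smul, trBil_bil, trBil_smulRight]
    have e1 := hode (‖x‖ ^ 2) (by positivity)
    have e2 := hQ1 (‖x‖ ^ 2) (by positivity)
    rw [Real.sqrt_sq (norm_nonneg x)] at e1
    have hN' : (3:ℝ) ≤ N := by exact_mod_cast hN
    nlinarith
  · rw [hfd]
    have := hL (‖x‖ ^ 2) (by positivity)
    rw [Real.sqrt_sq (norm_nonneg x)] at this
    rw [norm_smul, norm_bil_apply, Real.norm_eq_abs, abs_mul, abs_two]
    exact this

lemma exists_norm_eq_and_dist_eq {x : Eu N} (hx : x ≠ 0) {s : ℝ} (hs : 0 ≤ s) :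
    ∃ y : Eu N, ‖y‖ = s ∧ dist x y = |‖x‖ - s| := by
  have hx0 := norm_pos_iff.2 hx
  refine ⟨(s / ‖x‖) • x, ?_, ?_⟩
  · rw [norm_smul, Real.norm_eq_abs, abs_of_nonneg (by positivity)]
    field_simp
  · have : x - (s / ‖x‖) • x = (1 - s / ‖x‖) • x := by rw [sub_smul, one_smul]
    rw [dist_eq_norm, this, norm_smul, Real.norm_eq_abs]
    conv_lhs => rw [← abs_of_pos hx0, ← abs_mul]
    congr 1
    rw [abs_of_pos hx0]
    field_simp

lemma exists_majorant {γ : NNReal} (hγ : 0 < γ) {p : Eu N → ℝ} (hp0 : ∀ x, 0 < p x)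
    {C : NNReal} (hp : HolderWith C γ p) {φ : ℝ → ℝ}
    (hφ : ∀ r, 0 ≤ r → IsGreatest (p '' {x : Eu N | ‖x‖ = r}) (φ r))
    (hint : IntegrableOn (fun t => t * φ t) (Ioi 1)) :
    ∃ Φ : ℝ → ℝ, Continuous Φ ∧ (∀ t, 0 ≤ Φ t) ∧ (∃ c, ∀ t ≤ 1, Φ t = c) ∧
      IntegrableOn (fun t => t * Φ t) (Ioi 0) ∧ ∀ x : Eu N, p x ≤ Φ ‖x‖ := by
  have hcp : Continuous p := hp.continuous hγ
  have hφ0 : ∀ r, 0 ≤ r → 0 < φ r := fun r hr => by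
    obtain ⟨x, _, hx⟩ := (hφ r hr).1
    rw [← hx]
    exact hp0 x
  have hle : ∀ r s, 0 < r → 0 < s → φ r - φ s ≤ C * |r - s| ^ (γ : ℝ) := by
    intro r s hr hs
    obtain ⟨x, hxr, hx⟩ := (hφ r hr.le).1
    have hxr' : ‖x‖ = r := hxr
    have hx0 : x ≠ 0 := norm_pos_iff.1 (by rw [hxr']; exact hr)
    obtain ⟨y, hy, hd⟩ := exists_norm_eq_and_dist_eq hx0 hs.le
    have h1 : p y ≤ φ s := (hφ s hs.le).2 ⟨y, hy, rfl⟩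
    have h2 := hp.dist_le x y
    rw [hd, hxr', Real.dist_eq, hx] at h2
    have := le_abs_self (φ r - p y)
    linarith
  have hφc : Continuous fun r : ℝ => φ (max r 1) := by
    rw [continuous_iff_continuousAt]
    intro r
    have hpos : ∀ t : ℝ, 0 < max t 1 := fun t => by positivity
    rw [ContinuousAt, tendsto_iff_dist_tendsto_zero]
    have hlim : Tendsto (fun t : ℝ => C * |max t 1 - max r 1| ^ (γ : ℝ)) (nhds r) (nhds 0) := by
      have hγ' : (0:ℝ) < γ := by exact_mod_cast hγ
      have : ContinuousAt (fun t : ℝ => C * |max t 1 - max r 1| ^ (γ : ℝ)) r :=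
        continuousAt_const.mul (ContinuousAt.rpow_const (by fun_prop) (Or.inr hγ'.le))
      simpa [ContinuousAt, Real.zero_rpow hγ'.ne'] using this
    refine squeeze_zero (fun _ => dist_nonneg) (fun t => ?_) hlim
    rw [Real.dist_eq, abs_sub_le_iff]
    refine ⟨hle _ _ (hpos t) (hpos r), ?_⟩
    rw [abs_sub_comm]
    exact hle _ _ (hpos r) (hpos t)
  obtain ⟨P, hP0, hP⟩ := exists_bound_of_continuous hcp 1
  have hpos : ∀ t : ℝ, 0 ≤ φ (max t 1) := fun t => (hφ0 _ (by positivity)).le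
  have hcl : ∀ t : ℝ, 0 ≤ max (min (2 - t) 1) 0 := fun t => le_max_right _ _
  have hΦc : Continuous fun t : ℝ => φ (max t 1) + P * max (min (2 - t) 1) 0 :=
    hφc.add (continuous_const.mul (by fun_prop))
  refine ⟨fun t => φ (max t 1) + P * max (min (2 - t) 1) 0, hΦc, fun t => ?_,
    ⟨φ 1 + P, fun t ht => ?_⟩, ?_, fun x => ?_⟩
  · have := hpos t
    have := hcl t
    positivity
  · simp only
    rw [max_eq_right ht, min_eq_right (by linarith)]
    simp
  · rw [← Ioc_union_Ioi_eq_Ioi (show (0:ℝ) ≤ 2 by norm_num)]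
    refine IntegrableOn.union ?_ ?_
    · exact ((continuous_id.mul hΦc).continuousOn.integrableOn_compact isCompact_Icc).mono_set
        Ioc_subset_Icc_self
    · refine (hint.mono_set (Ioi_subset_Ioi one_le_two)).congr_fun (fun t ht => ?_)
        measurableSet_Ioi
      have ht' : (2:ℝ) < t := ht
      simp only
      rw [max_eq_left (by linarith : (1:ℝ) ≤ t), min_eq_left (by linarith), max_eq_right (by linarith)]
      ring
  · rcases le_or_gt ‖x‖ 1 with h | h
    · have h1 : p x ≤ P := (le_abs_self _).trans (hP x h)
      have h2 := hpos ‖x‖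
      simp only
      rw [min_eq_right (by linarith), max_eq_left zero_le_one]
      linarith
    · have h1 : p x ≤ φ ‖x‖ := (hφ _ (norm_nonneg x)).2 ⟨x, rfl, rfl⟩
      have := mul_nonneg hP0 (hcl ‖x‖)
      simp only
      rw [max_eq_left h.le]
      linarith

end Supersolution

section Comparison

variable {N : ℕ}

lemma deriv_deriv_nonpos_of_forall_le {q : ℝ → ℝ} (hq : Continuous q) (hmax : ∀ t, q t ≤ q 0) :
    deriv (deriv q) 0 ≤ 0 := by
  by_contra! h
  have h0 : deriv q 0 = 0 := IsLocalMax.deriv_eq_zero (Eventually.of_forall hmax)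
  have hmin := isLocalMin_of_deriv_deriv_pos h h0 hq.continuousAt
  have hconst : q =ᶠ[nhds 0] fun _ => q 0 := hmin.mono fun t ht => le_antisymm (hmax t) ht
  have h1 : deriv q =ᶠ[nhds 0] deriv fun _ => q 0 := hconst.deriv
  have h2 := h1.deriv_eq
  simp at h2
  linarith

lemma lap_eq_sum (u : Eu N → ℝ) (x : Eu N) : lap u x = ∑ i, fderiv ℝ (fderiv ℝ u) x
    (EuclideanSpace.single i 1) (EuclideanSpace.single i 1) := rfl

lemma lap_nonpos_of_forall_le {v : Eu N → ℝ} (hv : ContDiff ℝ 2 v) {x : Eu N}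
    (hmax : ∀ y, v y ≤ v x) : lap v x ≤ 0 := by
  rw [lap_eq_sum]
  refine Finset.sum_nonpos fun i _ => ?_
  set e : Eu N := EuclideanSpace.single i 1
  have hl : ∀ t : ℝ, HasDerivAt (fun t : ℝ => x + t • e) e t := fun t => by
    simpa using ((hasDerivAt_id t).smul_const e).const_add x
  have h1 : deriv (fun t : ℝ => v (x + t • e)) = fun t => fderiv ℝ v (x + t • e) e := by
    funext t
    exact ((hv.differentiable (by norm_num) _).hasFDerivAt.comp_hasDerivAt t (hl t)).deriv
  have hd : Differentiable ℝ (fderiv ℝ v) :=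
    (hv.fderiv_right (m := 1) (by norm_num)).differentiable (by norm_num)
  have h2 : deriv (fun t : ℝ => fderiv ℝ v (x + t • e) e) 0 = fderiv ℝ (fderiv ℝ v) x e e := by
    have := (hd (x + (0:ℝ) • e)).hasFDerivAt.comp_hasDerivAt 0 (hl 0)
    have h3 := this.clm_apply (hasDerivAt_const (0:ℝ) e)
    simpa using h3.deriv
  rw [← h2, ← h1]
  refine deriv_deriv_nonpos_of_forall_le ?_ fun t => ?_
  · exact hv.continuous.comp (by fun_prop)
  · simpa using hmax _

lemma lap_const_mul_sub {u w : Eu N → ℝ} (hu : ContDiff ℝ 2 u) (hw : ContDiff ℝ 2 w) (k C : ℝ)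
    (x : Eu N) :
    lap (fun y => k * u y - C * w y) x = k * lap u x - C * lap w x := by
  have du := hu.differentiable (by norm_num)
  have dw := hw.differentiable (by norm_num)
  have du2 : Differentiable ℝ (fderiv ℝ u) :=
    (hu.fderiv_right (m := 1) (by norm_num)).differentiable (by norm_num)
  have dw2 : Differentiable ℝ (fderiv ℝ w) :=
    (hw.fderiv_right (m := 1) (by norm_num)).differentiable (by norm_num)
  have h1 : fderiv ℝ (fun y => k * u y - C * w y) = fun y => k • fderiv ℝ u y - C • fderiv ℝ w y := by
    funext y
    exact (((du y).hasFDerivAt.const_mul k).sub ((dw y).hasFDerivAt.const_mul C)).fderiv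
  have h2 := (((du2 x).hasFDerivAt.const_smul k).sub ((dw2 x).hasFDerivAt.const_smul C)).fderiv
  simp only [lap_eq_sum]
  rw [h1]
  erw [h2]
  simp [Finset.sum_sub_distrib, Finset.mul_sum]

lemma exists_convex_transform {g : ℝ → ℝ} (hg_pos : ∀ t, 0 < t → 0 < g t)
    (hg_dec : StrictAntiOn g (Ioi 0)) :
    ∃ G : ℝ → ℝ, Continuous G ∧ (∀ t, 0 ≤ t → G t ≤ t) ∧ (∀ t, 0 < t → 0 < G t) ∧
      ∀ s t, 0 < s → (g s + 1)⁻¹ * (t - s) ≤ G t - G s := by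
  set k : ℝ → ℝ := fun t => if t ≤ 0 then 0 else (g t + 1)⁻¹ with hk
  have hkpos : ∀ t, 0 < t → k t = (g t + 1)⁻¹ := fun t ht => if_neg ht.not_ge
  have hmono : Monotone k := by
    intro s t hst
    rcases le_or_gt s 0 with hs | hs
    · have : k s = 0 := if_pos hs
      rw [this]
      rcases le_or_gt t 0 with ht | ht
      · exact (if_pos ht).ge
      · rw [hkpos t ht]
        have := hg_pos t ht
        positivity
    · have ht := hs.trans_le hst
      rw [hkpos s hs, hkpos t ht]
      have := hg_pos t ht
      have := hg_dec.antitoneOn hs ht hst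
      gcongr
  have hk1 : ∀ t, k t ≤ 1 := fun t => by
    rcases le_or_gt t 0 with ht | ht
    · exact (if_pos ht).le.trans zero_le_one
    · rw [hkpos t ht]
      exact inv_le_one_of_one_le₀ (by linarith [hg_pos t ht])
  have hint : ∀ s t, IntervalIntegrable k volume s t := fun s t => hmono.intervalIntegrable
  have hsub : ∀ s t, 0 < s →
      (g s + 1)⁻¹ * (t - s) ≤ (∫ r in (0:ℝ)..t, k r) - ∫ r in (0:ℝ)..s, k r := by
    intro s t hs
    rw [intervalIntegral.integral_interval_sub_left (hint _ _) (hint _ _), ← hkpos s hs]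
    rcases le_total s t with h | h
    · have := intervalIntegral.integral_mono_on h (intervalIntegrable_const (c := k s)) (hint s t)
        fun r hr => hmono hr.1
      rw [intervalIntegral.integral_const, smul_eq_mul] at this
      linarith
    · have := intervalIntegral.integral_mono_on h (hint t s) (intervalIntegrable_const (c := k s))
        fun r hr => hmono hr.2
      rw [intervalIntegral.integral_const, smul_eq_mul] at this
      rw [intervalIntegral.integral_symm]
      linarith
  have hnn : ∀ t, 0 ≤ t → 0 ≤ ∫ r in (0:ℝ)..t, k r := fun t ht =>
    intervalIntegral.integral_nonneg ht fun r hr => by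
      have := hmono hr.1
      rwa [show k 0 = 0 from if_pos le_rfl] at this
  refine ⟨fun t => ∫ r in (0:ℝ)..t, k r, intervalIntegral.continuous_primitive hint 0, fun t ht => ?_,
    fun t ht => ?_, hsub⟩
  · have := intervalIntegral.integral_mono_on ht (hint 0 t) (intervalIntegrable_const (c := (1:ℝ)))
      fun r _ => hk1 r
    simpa using this
  · have h1 := hsub (t / 2) t (half_pos ht)
    have h2 := hnn (t / 2) (half_pos ht).le
    have h3 := hg_pos (t / 2) (half_pos ht)
    have : 0 < (g (t / 2) + 1)⁻¹ * (t - t / 2) := mul_pos (by positivity) (by linarith)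
    simp only
    linarith

lemma transform_le_of_subsolution {a : ℝ} (ha0 : 0 < a) (ha1 : a < 1) {g f G : ℝ → ℝ}
    (hg_pos : ∀ t, 0 < t → 0 < g t) (hf0 : ∀ t, 0 ≤ t → 0 ≤ f t) (hf : MonotoneOn f (Ici 0))
    (hGc : Continuous G) (hG1 : ∀ t, 0 ≤ t → G t ≤ t)
    (hG : ∀ s t, 0 < s → (g s + 1)⁻¹ * (t - s) ≤ G t - G s)
    {w Φ : Eu N → ℝ} {L M C : ℝ} (hw : ContDiff ℝ 2 w) (hw0 : ∀ x, 0 ≤ w x) (hΦ : ∀ x, 0 < Φ x)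
    (hwΦ : ∀ x, lap w x ≤ -Φ x) (hL : ∀ x, ‖fderiv ℝ w x‖ ≤ L) (hC0 : 0 ≤ C)
    (hC : 1 + f M + (C * L) ^ a < C) {u : Eu N → ℝ} (hu : ContDiff ℝ 2 u) (hu0 : ∀ x, 0 < u x)
    (hul : Tendsto u (cocompact _) (nhds 0)) (huM : ∀ x, u x ≤ M)
    (hsub : ∀ x, -lap u x ≤ Φ x * (g (u x) + f (u x) + ‖fderiv ℝ u x‖ ^ a)) (x : Eu N) :
    G (u x) ≤ C * w x := by
  by_contra! hx
  obtain ⟨z, hz⟩ := Continuous.exists_forall_ge' (f := fun y => G (u y) - C * w y)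
    ((hGc.comp hu.continuous).sub (continuous_const.mul hw.continuous)) x (by
      filter_upwards [hul.eventually_lt_const (show (0:ℝ) < G (u x) - C * w x by linarith)] with y hy
      have := hG1 (u y) (hu0 y).le
      have := mul_nonneg hC0 (hw0 y)
      linarith)
  set k := (g (u z) + 1)⁻¹ with hk
  have hgz := hg_pos _ (hu0 z)
  have hk0 : 0 < k := by positivity
  have hk1 : k ≤ 1 := inv_le_one_of_one_le₀ (by linarith)
  have hmax : ∀ y, k * u y - C * w y ≤ k * u z - C * w z := fun y => by
    have h1 := hz y
    have h2 := hG (u z) (u y) (hu0 z)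
    rw [mul_sub] at h2
    linarith
  have hv : ContDiff ℝ 2 fun y => k * u y - C * w y :=
    (contDiff_const.mul hu).sub (contDiff_const.mul hw)
  have h1 := lap_nonpos_of_forall_le hv hmax
  rw [lap_const_mul_sub hu hw] at h1
  have h2 : fderiv ℝ (fun y => k * u y - C * w y) z = 0 :=
    IsLocalMax.fderiv_eq_zero (Eventually.of_forall hmax)
  have h3 := (((hu.differentiable (by norm_num) z).hasFDerivAt.const_mul k).sub
    ((hw.differentiable (by norm_num) z).hasFDerivAt.const_mul C)).fderiv
  have h4 : k • fderiv ℝ u z = C • fderiv ℝ w z := sub_eq_zero.1 (h3.symm.trans h2)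
  have h5 : k * ‖fderiv ℝ u z‖ ≤ C * L := by
    have := congrArg norm h4
    rw [norm_smul, norm_smul, Real.norm_of_nonneg hk0.le, Real.norm_of_nonneg hC0] at this
    rw [this]
    exact mul_le_mul_of_nonneg_left (hL z) hC0
  have h6 : k * ‖fderiv ℝ u z‖ ^ a ≤ (C * L) ^ a := by
    calc k * ‖fderiv ℝ u z‖ ^ a ≤ k ^ a * ‖fderiv ℝ u z‖ ^ a := by
          gcongr
          exact Real.self_le_rpow_of_le_one hk0.le hk1 ha1.le
      _ = (k * ‖fderiv ℝ u z‖) ^ a := (Real.mul_rpow hk0.le (norm_nonneg _)).symm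
      _ ≤ _ := Real.rpow_le_rpow (by positivity) h5 ha0.le
  have h7 : k * f (u z) ≤ f M := by
    have h := hf (hu0 z).le ((hu0 z).le.trans (huM z)) (huM z)
    have h' := hf0 _ (hu0 z).le
    nlinarith
  have h8 : k * g (u z) ≤ 1 := by
    rw [hk, inv_mul_le_one₀ (by linarith)]
    linarith
  have h9 := mul_le_mul_of_nonneg_left (hsub z) hk0.le
  have h10 : k * (g (u z) + f (u z) + ‖fderiv ℝ u z‖ ^ a) < C := by
    simp only [mul_add]
    linarith
  have h11 := mul_lt_mul_of_pos_left h10 (hΦ z)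
  have h12 := mul_le_mul_of_nonneg_left (hwΦ z) hC0
  nlinarith

lemma eventually_add_rpow_lt {a : ℝ} (ha1 : a < 1) {f : ℝ → ℝ}
    (hf : Tendsto (fun t => f t / t) atTop (nhds 0)) (A B : ℝ) {δ : ℝ} (hδ : 0 < δ) :
    ∀ᶠ t in atTop, A + f t + B * t ^ a < δ * t := by
  have h1 : Tendsto (fun t : ℝ => A * t⁻¹ + f t / t + B * t ^ (-(1 - a))) atTop (nhds 0) := by
    simpa using ((tendsto_inv_atTop_zero.const_mul A).add hf).add
      ((tendsto_rpow_neg_atTop (show 0 < 1 - a by linarith)).const_mul B)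
  filter_upwards [h1.eventually_lt_const hδ, eventually_gt_atTop 0] with t ht ht0
  have h2 := mul_lt_mul_of_pos_right ht ht0
  have h3 : t ^ (-(1 - a)) * t = t ^ a := by
    rw [← Real.rpow_add_one ht0.ne']
    congr 1
    ring
  have h4 : (A * t⁻¹ + f t / t + B * t ^ (-(1 - a))) * t = A + f t + B * t ^ a := by
    rw [add_mul, add_mul, mul_assoc B, h3]
    field_simp
  linarith

/-- Uniform a priori bounds for positive subsolutions vanishing at infinity. -/
lemma exists_apriori_bound {a : ℝ} (ha0 : 0 < a) (ha1 : a < 1) {g f G : ℝ → ℝ}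
    (hg_pos : ∀ t, 0 < t → 0 < g t) (hf0 : ∀ t, 0 ≤ t → 0 ≤ f t) (hf : MonotoneOn f (Ici 0))
    (hf' : Tendsto (fun t => f t / t) atTop (nhds 0))
    (hGc : Continuous G) (hG1 : ∀ t, 0 ≤ t → G t ≤ t) (hGp : ∀ t, 0 < t → 0 < G t)
    (hG : ∀ s t, 0 < s → (g s + 1)⁻¹ * (t - s) ≤ G t - G s)
    {w Φ : Eu N → ℝ} {L : ℝ} (hw : ContDiff ℝ 2 w) (hw0 : ∀ x, 0 ≤ w x)
    (hwl : Tendsto w (cocompact _) (nhds 0)) (hΦ : ∀ x, 0 < Φ x)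
    (hwΦ : ∀ x, lap w x ≤ -Φ x) (hL0 : 0 ≤ L) (hL : ∀ x, ‖fderiv ℝ w x‖ ≤ L) :
    ∃ M C, 0 ≤ M ∧ 0 ≤ C ∧ ∀ u : Eu N → ℝ, ContDiff ℝ 2 u → (∀ x, 0 < u x) →
      Tendsto u (cocompact _) (nhds 0) →
      (∀ x, -lap u x ≤ Φ x * (g (u x) + f (u x) + ‖fderiv ℝ u x‖ ^ a)) →
      ∀ x, u x ≤ M ∧ G (u x) ≤ C * w x := by
  have hpk : ∀ v : Eu N → ℝ, Continuous v → Tendsto v (cocompact _) (nhds 0) → (∀ x, 0 ≤ v x) →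
      ∃ z, ∀ y, v y ≤ v z := fun v hv hl h0 => by
    by_cases h : ∃ x, 0 < v x
    · obtain ⟨x, hx⟩ := h
      exact hv.exists_forall_ge' x ((hl.eventually_lt_const hx).mono fun y hy => hy.le)
    · push Not at h
      exact ⟨0, fun y => (h y).trans (h0 0)⟩
  obtain ⟨z0, hz0⟩ := hpk w hw.continuous hwl hw0
  set W := w z0 + 1 with hW
  have hWp : 0 < W := by linarith [hw0 z0]
  set q := g 1 + 1 with hq
  have hqp : 0 < q := by linarith [hg_pos 1 one_pos]
  set δ := 1 / (2 * W * q) with hδ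
  have hδp : 0 < δ := by positivity
  obtain ⟨M0, hM0⟩ := eventually_atTop.1 (eventually_add_rpow_lt ha1 hf' 1 ((δ * L) ^ a) hδp)
  set M := max M0 2 with hM
  have hM2 : 2 ≤ M := le_max_right _ _
  obtain ⟨C0, hC0⟩ := eventually_atTop.1 (eventually_add_rpow_lt (f := fun _ => 0) ha1
    (by simp) (1 + f M) (L ^ a) one_pos)
  set C := max C0 0 with hC
  have hC1 : 0 ≤ C := le_max_right _ _
  refine ⟨M, C, by linarith, hC1, fun u hu hu0 hul hsub => ?_⟩
  have huM : ∀ x, u x ≤ M := by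
    obtain ⟨z, hz⟩ := hpk u hu.continuous hul fun x => (hu0 x).le
    refine fun x => (hz x).trans ?_
    by_contra! hlt
    have h1 := hM0 (u z) ((le_max_left _ _).trans hlt.le)
    rw [← Real.mul_rpow (by positivity) (hu0 z).le] at h1
    have h2 := transform_le_of_subsolution (C := δ * u z) (M := u z) ha0 ha1 hg_pos hf0 hf hGc hG1 hG
      hw hw0 hΦ hwΦ hL (mul_pos hδp (hu0 z)).le
      (by rwa [show δ * u z * L = δ * L * u z by ring]) hu hu0 hul hz hsub z
    have h3 := hG 1 (u z) one_pos
    have h4 := hGp 1 one_pos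
    have h5 : δ * u z * w z ≤ δ * u z * W :=
      mul_le_mul_of_nonneg_left (by linarith [hz0 z]) (mul_pos hδp (hu0 z)).le
    have h6 : δ * u z * W = q⁻¹ * (u z / 2) := by
      rw [hδ]
      field_simp
    have h7 : q⁻¹ * (u z / 2) ≤ q⁻¹ * (u z - 1) :=
      mul_le_mul_of_nonneg_left (by linarith) (by positivity)
    linarith
  refine fun x => ⟨huM x, ?_⟩
  refine transform_le_of_subsolution (M := M) ha0 ha1 hg_pos hf0 hf hGc hG1 hG hw hw0 hΦ hwΦ hL hC1 ?_
    hu hu0 hul huM hsub x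
  have h := hC0 C (le_max_left _ _)
  rw [Real.mul_rpow hC1 hL0]
  linarith

end Comparison

section Ascoli

/-- The Arzelà–Ascoli theorem for the compact-open topology. -/
lemma isCompact_closure_of_equicontinuous {X Y : Type*} [TopologicalSpace X]
    [WeaklyLocallyCompactSpace X] [UniformSpace Y] [T2Space Y] {A : Set C(X, Y)}
    (hA : Equicontinuous fun f : A => ((f : C(X, Y)) : X → Y))
    (hQ : ∀ x, ∃ Q : Set Y, IsCompact Q ∧ ∀ f ∈ A, f x ∈ Q) : IsCompact (closure A) := by
  refine ArzelaAscoli.isCompact_closure_of_isClosedEmbedding (𝔖 := {K | IsCompact K})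
    (F := fun (f : C(X, Y)) x => f x) (fun K hK => hK) ?_ (fun K _ => hA.equicontinuousOn K)
    fun K _ x _ => hQ x
  refine ⟨ContinuousMap.isUniformEmbedding_toUniformOnFunIsCompact.isEmbedding, ?_⟩
  have : IsClosed (range (ContinuousMap.toUniformOnFunIsCompact (α := X) (β := Y))) := by
    rw [ContinuousMap.range_toUniformOnFunIsCompact]
    exact UniformOnFun.isClosed_setOfPred_continuous CompactlyCoherentSpace.isCoherentWith
  exact this

lemma isCompact_closure_of_locHolder {N : ℕ} {X F : Type*} [PseudoMetricSpace X]
    [WeaklyLocallyCompactSpace X] [NormedAddCommGroup F] [ProperSpace F] {ι : X → Eu N}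
    (hι : Isometry ι) {A : Set C(X, F)}
    (hb : ∀ R, ∃ B, ∀ f ∈ A, ∀ x, ‖ι x‖ ≤ R → ‖f x‖ ≤ B)
    (hh : ∀ R, ∃ C, ∀ f ∈ A, ∀ x y, ‖ι x‖ ≤ R → ‖ι y‖ ≤ R →
      ‖f x - f y‖ ≤ C * ‖ι x - ι y‖ ^ (1 / 2 : ℝ)) : IsCompact (closure A) := by
  refine isCompact_closure_of_equicontinuous (fun x => ?_) fun x => ?_
  · obtain ⟨C, hC⟩ := hh (‖ι x‖ + 1)
    rw [Metric.equicontinuousAt_iff]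
    intro ε hε
    have hlim : Tendsto (fun y => C * ‖ι y - ι x‖ ^ (1 / 2 : ℝ)) (nhds x) (nhds 0) := by
      have : ContinuousAt (fun y => C * ‖ι y - ι x‖ ^ (1 / 2 : ℝ)) x :=
        continuousAt_const.mul (ContinuousAt.rpow_const
          (hι.continuous.continuousAt.sub continuousAt_const).norm (Or.inr (by norm_num)))
      simpa [ContinuousAt] using this
    obtain ⟨δ, hδ, hδ'⟩ := Metric.eventually_nhds_iff.1 (hlim.eventually_lt_const hε)
    refine ⟨min δ 1, lt_min hδ one_pos, fun y hy f => ?_⟩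
    have h1 := hδ' (hy.trans_le (min_le_left _ _))
    have h2 : ‖ι y - ι x‖ < 1 := by
      rw [← dist_eq_norm, hι.dist_eq]
      exact hy.trans_le (min_le_right _ _)
    have h3 := norm_le_norm_add_norm_sub' (ι y) (ι x)
    rw [dist_comm, dist_eq_norm]
    exact (hC f f.2 y x (by linarith) (by linarith)).trans_lt h1
  · obtain ⟨B, hB⟩ := hb ‖ι x‖
    exact ⟨Metric.closedBall 0 B, isCompact_closedBall 0 B, fun f hf => by
      simpa using hB f hf x le_rfl⟩

end Ascoli

section Newton

variable {N : ℕ} {h : Eu N → ℝ} {n : ℝ}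

/-- The Newtonian potential. -/
noncomputable def newt (h : Eu N → ℝ) (x : Eu N) : ℝ :=
  ∫ z, h (x - z) * (fundConst N * (‖z‖ ^ 2) ^ (-nexp N))

lemma newt_integrand_eq {R : ℝ} (hR : 0 < R) (hs : ∀ y, n < ‖y‖ → h y = 0) {x : Eu N}
    (hx : ‖x‖ + n ≤ R) (z : Eu N) :
    h (x - z) * (fundConst N * (‖z‖ ^ 2) ^ (-nexp N)) = h (x - z) • ker0 (fundConst N) R 0 z := by
  rw [smul_eq_mul, ker0, prof, add_zero]
  rcases le_or_gt ‖z‖ R with hz | hz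
  · rw [cutoff_eq_one (by positivity) (by gcongr), mul_one]
  · rw [hs (x - z), zero_mul, zero_mul]
    have := norm_sub_norm_le z x
    rw [norm_sub_rev] at this
    linarith

lemma newt_eq_pot {R : ℝ} (hR : 0 < R) (hs : ∀ y, n < ‖y‖ → h y = 0) {x : Eu N}
    (hx : ‖x‖ + n ≤ R) : newt h x = pot R h x :=
  integral_congr_ae (Eventually.of_forall fun z => newt_integrand_eq hR hs hx z)

lemma integrable_newt (hN : 3 ≤ N) (hh : Continuous h) (hs : ∀ y, n < ‖y‖ → h y = 0) (x : Eu N) :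
    Integrable fun z => h (x - z) * (fundConst N * (‖z‖ ^ 2) ^ (-nexp N)) := by
  have hR : 0 < ‖x‖ + |n| + 1 := by positivity
  have h1 := integrable_cv (integrable_ker0 hN hR (fundConst N))
    (fun z hz => ker0_eq_zero hR le_rfl hz) hh x
  refine h1.congr (Eventually.of_forall fun z => ?_)
  exact (newt_integrand_eq hR hs (by linarith [le_abs_self n]) z).symm

lemma newt_eventuallyEq {R : ℝ} (hR : 0 < R) (hs : ∀ y, n < ‖y‖ → h y = 0) {x : Eu N}
    (hx : ‖x‖ + n < R) : newt h =ᶠ[nhds x] pot R h := by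
  have : Continuous fun y : Eu N => ‖y‖ + n := by fun_prop
  filter_upwards [this.continuousAt.eventually_lt_const hx] with y hy
  exact newt_eq_pot hR hs hy.le

lemma hasFDerivAt_newt (hN : 3 ≤ N) {R : ℝ} (hR : 0 < R) (hh : Continuous h)
    (hs : ∀ y, n < ‖y‖ → h y = 0) {x : Eu N} (hx : ‖x‖ + n < R) :
    HasFDerivAt (newt h) (dpot R h x) x :=
  (hasFDerivAt_pot hN hR hh x).congr_of_eventuallyEq (newt_eventuallyEq hR hs hx)

lemma contDiff_newt (hN : 3 ≤ N) {α : ℝ} (hα : 0 < α) (hh : LocHolder α h)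
    (hs : ∀ y, n < ‖y‖ → h y = 0) : ContDiff ℝ 2 (newt h) := by
  rw [contDiff_iff_contDiffAt]
  intro x
  have hR : 0 < ‖x‖ + |n| + 1 := by positivity
  exact (contDiff_pot hN hR hα hh).contDiffAt.congr_of_eventuallyEq
    (newt_eventuallyEq hR hs (by linarith [le_abs_self n]))

lemma lap_congr {u v : Eu N → ℝ} {x : Eu N} (huv : u =ᶠ[nhds x] v) : lap u x = lap v x := by
  rw [lap, lap, huv.fderiv.fderiv_eq]

lemma lap_newt (hN : 3 ≤ N) {α : ℝ} (hα : 0 < α) (hh : LocHolder α h)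
    (hs : ∀ y, n < ‖y‖ → h y = 0) (x : Eu N) : lap (newt h) x = -h x := by
  have hR : 0 < ‖x‖ + |n| + 1 := by positivity
  rw [lap_congr (newt_eventuallyEq hR hs (by linarith [le_abs_self n])), lap_pot hN hR hα hh]
  suffices smo (‖x‖ + |n| + 1) h x = 0 by rw [this, add_zero]
  refine integral_eq_zero_of_ae (Eventually.of_forall fun z => ?_)
  rcases lt_or_ge ‖z‖ (‖x‖ + |n| + 1) with hz | hz
  · simp [kerLap_eq_zero_of_lt hR hz]
  · have := norm_sub_norm_le z x
    rw [norm_sub_rev] at this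
    simp [hs (x - z) (by linarith [le_abs_self n])]

lemma newt_kernel_nonneg (hN : 3 ≤ N) (z : Eu N) : 0 ≤ fundConst N * (‖z‖ ^ 2) ^ (-nexp N) :=
  mul_nonneg (fundConst_pos hN).le (by positivity)

lemma newt_mono (hN : 3 ≤ N) {h' : Eu N → ℝ} (hh : Continuous h) (hh' : Continuous h')
    (hs : ∀ y, n < ‖y‖ → h y = 0) {n' : ℝ} (hs' : ∀ y, n' < ‖y‖ → h' y = 0) (hle : ∀ y, h y ≤ h' y)
    (x : Eu N) : newt h x ≤ newt h' x :=
  integral_mono (integrable_newt hN hh hs x) (integrable_newt hN hh' hs' x)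
    fun z => mul_le_mul_of_nonneg_right (hle _) (newt_kernel_nonneg hN z)

lemma newt_nonneg (hN : 3 ≤ N) (h0 : ∀ y, 0 ≤ h y) (x : Eu N) : 0 ≤ newt h x :=
  integral_nonneg fun z => mul_nonneg (h0 _) (newt_kernel_nonneg hN z)

lemma newt_const_mul (c : ℝ) (h : Eu N → ℝ) (x : Eu N) :
    newt (fun y => c * h y) x = c * newt h x := by
  rw [newt, newt, ← integral_const_mul]
  simp only [mul_assoc]

lemma newt_pos (hN : 3 ≤ N) (hh : Continuous h) (hs : ∀ y, n < ‖y‖ → h y = 0)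
    (h0 : ∀ y, 0 ≤ h y) {y : Eu N} (hy : 0 < h y) (x : Eu N) : 0 < newt h x := by
  rw [newt, integral_pos_iff_support_of_nonneg
    (fun z => mul_nonneg (h0 _) (newt_kernel_nonneg hN z)) (integrable_newt hN hh hs x)]
  have := nontrivial_eu (show 1 ≤ N by omega)
  have hopen : IsOpen ({z : Eu N | 0 < h (x - z)} : Set (Eu N)) :=
    isOpen_lt continuous_const (hh.comp (continuous_const.sub continuous_id))
  have hpos : 0 < volume {z : Eu N | 0 < h (x - z)} :=
    hopen.measure_pos _ ⟨x - y, by simpa using hy⟩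
  refine hpos.trans_le (measure_mono_ae ?_)
  filter_upwards [ae_ne_zero (show 1 ≤ N by omega)] with z hz hmem
  have h1 : 0 < h (x - z) := hmem
  have h2 : 0 < ‖z‖ := norm_pos_iff.2 hz
  have := fundConst_pos hN
  exact (mul_pos h1 (by positivity)).ne'

lemma tendsto_newt (hN : 3 ≤ N) (hh : Continuous h) (hs : ∀ y, n < ‖y‖ → h y = 0)
    (h0 : ∀ y, 0 ≤ h y) : Tendsto (newt h) (cocompact _) (nhds 0) := by
  have hnexp : 0 < nexp N := by
    have : (3:ℝ) ≤ N := by exact_mod_cast hN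
    rw [nexp]
    linarith
  have hI : Integrable h := hh.integrable_of_hasCompactSupport (hasCompactSupport_of_norm hs)
  have hlim : Tendsto (fun x : Eu N => fundConst N * ((‖x‖ / 2) ^ 2) ^ (-nexp N) * ∫ y, h y)
      (cocompact _) (nhds 0) := by
    have h1 : Tendsto (fun x : Eu N => (‖x‖ / 2) ^ 2) (cocompact _) atTop :=
      (tendsto_pow_atTop two_ne_zero).comp
        (tendsto_norm_cocompact_atTop.atTop_div_const two_pos)
    have h2 := ((tendsto_rpow_neg_atTop hnexp).comp h1).const_mul (fundConst N)
    simpa using h2.mul_const (∫ y, h y)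
  refine squeeze_zero' (Eventually.of_forall fun x => newt_nonneg hN h0 x) ?_ hlim
  filter_upwards [(tendsto_norm_cocompact_atTop (E := Eu N)).eventually_ge_atTop (2 * |n| + 1)]
    with x hx
  have h1 : ∫ z, h (x - z) = ∫ y, h y := integral_sub_left_eq_self _ _ _
  rw [← h1, ← integral_const_mul]
  refine integral_mono (integrable_newt hN hh hs x) ((hI.comp_sub_left x).const_mul _) fun z => ?_
  simp only
  rcases lt_or_ge ‖z‖ (‖x‖ / 2) with hz | hz
  · have := norm_sub_norm_le x z
    rw [hs (x - z) (by linarith [le_abs_self n])]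
    simp
  · rw [mul_comm]
    refine mul_le_mul_of_nonneg_right (mul_le_mul_of_nonneg_left ?_ (fundConst_pos hN).le) (h0 _)
    refine Real.rpow_le_rpow_of_nonpos ?_ (by gcongr) (by linarith)
    have : 0 < ‖x‖ := by linarith [abs_nonneg n]
    positivity

end Newton

section LocHolder

variable {N : ℕ} {F : Type*} [NormedAddCommGroup F]

lemma rpow_norm_sub_le {α β R : ℝ} (hβ : 0 ≤ β) (hβα : β ≤ α) {x y : F} (hx : ‖x‖ ≤ R)
    (hy : ‖y‖ ≤ R) : ‖x - y‖ ^ α ≤ (2 * R) ^ (α - β) * ‖x - y‖ ^ β := by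
  have h : ‖x - y‖ ≤ 2 * R := (norm_sub_le _ _).trans (by linarith)
  calc ‖x - y‖ ^ α = ‖x - y‖ ^ (α - β) * ‖x - y‖ ^ β := by
        rw [← Real.rpow_add_of_nonneg (norm_nonneg _) (by linarith) hβ, sub_add_cancel]
    _ ≤ _ := by
        refine mul_le_mul_of_nonneg_right ?_ (by positivity)
        exact Real.rpow_le_rpow (norm_nonneg _) h (by linarith)

lemma LocHolder.mono {α β : ℝ} {h : Eu N → F} (hh : LocHolder α h) (hβ : 0 ≤ β) (hβα : β ≤ α) :
    LocHolder β h := by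
  intro R
  obtain ⟨C, hC0, hC⟩ := hh R
  rcases lt_or_ge R 0 with hR | hR
  · exact ⟨0, le_rfl, fun x y hx => absurd (hx.trans_lt hR) (norm_nonneg x).not_gt⟩
  · refine ⟨C * (2 * R) ^ (α - β), by positivity, fun x y hx hy => (hC x y hx hy).trans ?_⟩
    rw [mul_assoc]
    exact mul_le_mul_of_nonneg_left (rpow_norm_sub_le hβ hβα hx hy) hC0

lemma LocHolder.add {α : ℝ} {h k : Eu N → F} (hh : LocHolder α h) (hk : LocHolder α k) :
    LocHolder α fun x => h x + k x := by
  intro R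
  obtain ⟨C, hC0, hC⟩ := hh R
  obtain ⟨D, hD0, hD⟩ := hk R
  refine ⟨C + D, by positivity, fun x y hx hy => ?_⟩
  rw [add_sub_add_comm, add_mul]
  exact (norm_add_le _ _).trans (add_le_add (hC x y hx hy) (hD x y hx hy))

lemma LocHolder.mul {α : ℝ} (hα : 0 < α) {h k : Eu N → ℝ} (hh : LocHolder α h)
    (hk : LocHolder α k) : LocHolder α fun x => h x * k x := by
  intro R
  obtain ⟨C, hC0, hC⟩ := hh R
  obtain ⟨D, hD0, hD⟩ := hk R
  obtain ⟨B, hB0, hB⟩ := exists_bound_of_continuous (hh.continuous hα) R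
  obtain ⟨A, hA0, hA⟩ := exists_bound_of_continuous (hk.continuous hα) R
  refine ⟨B * D + A * C, by positivity, fun x y hx hy => ?_⟩
  have h1 : h x * k x - h y * k y = h x * (k x - k y) + k y * (h x - h y) := by ring
  rw [h1, add_mul, mul_assoc, mul_assoc]
  refine (norm_add_le _ _).trans (add_le_add ?_ ?_)
  · rw [norm_mul]
    exact mul_le_mul (hB x hx) (hD x y hx hy) (norm_nonneg _) hB0
  · rw [norm_mul]
    exact mul_le_mul (hA y hy) (hC x y hx hy) (norm_nonneg _) hA0

lemma LocHolder.comp {α β : ℝ} (hβ : 0 ≤ β) {h : Eu N → F} (hh : LocHolder α h) {q : F → ℝ}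
    {s : Set F} {D : ℝ} (hD0 : 0 ≤ D) (hq : ∀ a ∈ s, ∀ b ∈ s, |q a - q b| ≤ D * ‖a - b‖ ^ β)
    (hs : ∀ x, h x ∈ s) : LocHolder (α * β) fun x => q (h x) := by
  intro R
  obtain ⟨C, hC0, hC⟩ := hh R
  refine ⟨D * C ^ β, by positivity, fun x y hx hy => (hq _ (hs x) _ (hs y)).trans ?_⟩
  rw [mul_assoc, Real.rpow_mul (norm_nonneg _), ← Real.mul_rpow hC0 (by positivity)]
  exact mul_le_mul_of_nonneg_left (Real.rpow_le_rpow (norm_nonneg _) (hC x y hx hy) hβ) hD0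

lemma abs_rpow_norm_sub_le {a : ℝ} (ha0 : 0 < a) (ha1 : a < 1) (x y : F) :
    |‖x‖ ^ a - ‖y‖ ^ a| ≤ 1 * ‖x - y‖ ^ a := by
  have key : ∀ x y : F, ‖x‖ ^ a - ‖y‖ ^ a ≤ ‖x - y‖ ^ a := fun x y => by
    have h1 : ‖x‖ ≤ ‖x - y‖ + ‖y‖ := by
      have := norm_add_le (x - y) y
      rwa [sub_add_cancel] at this
    have h2 := Real.rpow_le_rpow (norm_nonneg x) h1 ha0.le
    have h3 := Real.rpow_add_le_add_rpow (norm_nonneg (x - y)) (norm_nonneg y) ha0.le ha1.le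
    linarith
  rw [one_mul, abs_sub_le_iff]
  exact ⟨key x y, norm_sub_rev x y ▸ key y x⟩

lemma locHolder_density {a γ : ℝ} (ha0 : 0 < a) (ha1 : a < 1) (hγ0 : 0 < γ) (hγ1 : γ < 1)
    {q v u : Eu N → ℝ} {V : Eu N → Eu N →L[ℝ] ℝ} {f : ℝ → ℝ} {D : ℝ} (hD0 : 0 ≤ D)
    (hf : ∀ s ∈ Ici (0:ℝ), ∀ t ∈ Ici (0:ℝ), |f s - f t| ≤ D * ‖s - t‖ ^ γ)
    (hq : LocHolder γ q) (hv : ContDiff ℝ 1 v) (hu : ContDiff ℝ 1 u) (hu0 : ∀ x, 0 ≤ u x)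
    (hV : LocHolder (1 / 2) V) :
    LocHolder (min γ (a / 2)) fun x => q x * (v x + f (u x) + ‖V x‖ ^ a) := by
  have hm : 0 < min γ (a / 2) := lt_min hγ0 (by linarith)
  have h1 : min γ (a / 2) ≤ γ := min_le_left _ _
  have h2 : min γ (a / 2) ≤ 1 / 2 * a := (min_le_right _ _).trans (by linarith)
  refine LocHolder.mul hm (hq.mono hm.le h1) (LocHolder.add (LocHolder.add ?_ ?_) ?_)
  · exact (locHolder_one_of_contDiff hv).mono hm.le (by linarith)
  · exact ((locHolder_one_of_contDiff hu).comp hγ0.le hD0 hf hu0).mono hm.le (by linarith)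
  · exact (hV.comp (q := fun ξ => ‖ξ‖ ^ a) (s := univ) ha0.le zero_le_one
      (fun x _ y _ => abs_rpow_norm_sub_le ha0 ha1 x y) fun _ => mem_univ _).mono hm.le h2

lemma locHolder_dpot (hN : 3 ≤ N) {R : ℝ} (hR : 0 < R) {h : Eu N → ℝ} (hh : Continuous h) :
    LocHolder (1 / 2) (dpot R h) := by
  obtain ⟨C, hC0, hC⟩ := exists_dpot_holder hN hR
  intro ρ
  obtain ⟨H, hH0, hH⟩ := exists_bound_of_continuous hh (ρ + 2 * R)
  refine ⟨C * H, by positivity, fun x y hx hy => hC h hh x y H hH0 fun z hz => hH z ?_⟩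
  have key : ∀ x : Eu N, ‖x‖ ≤ ρ → ‖x - z‖ ≤ 2 * R → ‖z‖ ≤ ρ + 2 * R := fun x hx hxz => by
    have := norm_sub_norm_le z x
    rw [norm_sub_rev] at this
    linarith
  exact hz.elim (key x hx) (key y hy)

end LocHolder

section FixedPoint

variable {N : ℕ}

lemma cv_sub {F : Type*} [NormedAddCommGroup F] [NormedSpace ℝ F] {K : Eu N → F} {ρ : ℝ}
    (hK : Integrable K) (hs : ∀ z, ρ < ‖z‖ → K z = 0) {h k : Eu N → ℝ} (hh : Continuous h)
    (hk : Continuous k) (x : Eu N) : cv K h x - cv K k x = cv K (fun y => h y - k y) x := by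
  rw [cv, cv, cv, ← integral_sub (integrable_cv hK hs hh x) (integrable_cv hK hs hk x)]
  simp only [sub_smul]

lemma exists_ball_projection {n : ℝ} (hn : 0 < n) :
    ∃ π : C(Eu N, Metric.closedBall (0 : Eu N) n), ∀ x : Eu N, ‖x‖ ≤ n → (π x : Eu N) = x := by
  have hpos : ∀ x : Eu N, 0 < max n ‖x‖ := fun x => hn.trans_le (le_max_left _ _)
  refine ⟨⟨fun x => ⟨(n / max n ‖x‖) • x, ?_⟩, ?_⟩, fun x hx => ?_⟩
  · rw [mem_closedBall_zero_iff, norm_smul, Real.norm_of_nonneg (by have := hpos x; positivity),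
      div_mul_eq_mul_div, div_le_iff₀ (hpos x)]
    exact mul_le_mul_of_nonneg_left (le_max_right _ _) hn.le
  · refine Continuous.subtype_mk ?_ _
    exact (continuous_const.div (by fun_prop) fun x => (hpos x).ne').smul continuous_id
  · simp [max_eq_left hx, hn.ne']

/-- Existence of a density reproducing itself through its Newtonian potential. -/
lemma exists_fixed_density (hN : 3 ≤ N) {a : ℝ} (ha0 : 0 < a) (ha1 : a < 1) {n : ℝ} (hn : 0 < n)
    {q : Eu N → ℝ} (hq : Continuous q) (hq0 : ∀ x, 0 ≤ q x) (hqs : ∀ x, n < ‖x‖ → q x = 0)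
    {F f : ℝ → ℝ} {A : ℝ} (hF : Continuous F) (hF0 : ∀ t, 0 ≤ F t)
    (hFf : ∀ s t, |s| ≤ t → F s ≤ A + f t) (hf' : Tendsto (fun t => f t / t) atTop (nhds 0)) :
    ∃ h : Eu N → ℝ, Continuous h ∧ (∀ x, 0 ≤ h x) ∧ (∀ x, n < ‖x‖ → h x = 0) ∧
      ∀ x, h x = q x * (F (newt h x) + ‖fderiv ℝ (newt h) x‖ ^ a) := by
  set R := 2 * n + 1 with hRdef
  have hR : 0 < R := by positivity
  obtain ⟨π, hπ⟩ := exists_ball_projection (N := N) hn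
  have : CompactSpace (Metric.closedBall (0 : Eu N) n) :=
    isCompact_iff_compactSpace.1 (isCompact_closedBall 0 n)
  have : ProperSpace (Eu N →L[ℝ] ℝ) := FiniteDimensional.proper ℝ _
  obtain ⟨Q, hQ0, hQ⟩ : ∃ Q, 0 ≤ Q ∧ ∀ x, q x ≤ Q := by
    obtain ⟨Q, hQ0, hQ⟩ := exists_bound_of_continuous hq n
    refine ⟨Q, hQ0, fun x => ?_⟩
    rcases le_or_gt ‖x‖ n with hx | hx
    · exact (le_abs_self _).trans (hQ x hx)
    · rw [hqs x hx]
      exact hQ0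
  have hk0s : ∀ z : Eu N, 2 * R < ‖z‖ → ker0 (fundConst N) R 0 z = 0 :=
    fun z hz => ker0_eq_zero hR le_rfl hz
  have hk1s : ∀ z : Eu N, 2 * R < ‖z‖ → ker1 (fundConst N) R 0 z = 0 :=
    fun z hz => ker1_eq_zero hR le_rfl hz
  have hk0 := integrable_ker0 hN hR (fundConst N)
  have hk1 := integrable_ker1 hN hR (fundConst N)
  obtain ⟨C1, hC10, hC1⟩ := exists_norm_cv_le hk0 hk0s
  obtain ⟨C2, hC20, hC2⟩ := exists_norm_cv_le hk1 hk1s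
  obtain ⟨C3, hC30, hC3⟩ := exists_dpot_holder hN hR
  let X := C(Metric.closedBall (0 : Eu N) n, ℝ)
  let e : X → Eu N → ℝ := fun η x => q x * η (π x)
  have hec : ∀ η, Continuous (e η) := fun η => hq.mul (η.continuous.comp π.continuous)
  have heb : ∀ (η : X) (H : ℝ), (∀ z, |η z| ≤ H) → ∀ y, |e η y| ≤ Q * H := fun η H hH y => by
    rw [abs_mul, abs_of_nonneg (hq0 y)]
    exact mul_le_mul (hQ y) (hH _) (abs_nonneg _) hQ0
  have hpotb : ∀ (η : X) (H : ℝ), 0 ≤ H → (∀ z, |η z| ≤ H) → ∀ x,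
      |pot R (e η) x| ≤ C1 * (Q * H) := fun η H hH0 hH x =>
    hC1 (e η) x (Q * H) (by positivity) fun y _ => heb η H hH y
  have hdpotb : ∀ (η : X) (H : ℝ), 0 ≤ H → (∀ z, |η z| ≤ H) → ∀ x,
      ‖dpot R (e η) x‖ ≤ C2 * (Q * H) := fun η H hH0 hH x =>
    hC2 (e η) x (Q * H) (by positivity) fun y _ => heb η H hH y
  let P : X → C(Metric.closedBall (0 : Eu N) n, ℝ × (Eu N →L[ℝ] ℝ)) := fun η =>
    ⟨fun x => (pot R (e η) x, dpot R (e η) x),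
      ((continuous_pot hN hR (hec η)).prodMk (continuous_dpot hN hR (hec η))).comp
        continuous_subtype_val⟩
  have hPapp : ∀ η x, P η x = (pot R (e η) x, dpot R (e η) x) := fun _ _ => rfl
  have hPc : Continuous P := by
    have hK : 0 ≤ max C1 C2 * Q := mul_nonneg (hC10.trans (le_max_left _ _)) hQ0
    refine (LipschitzWith.of_dist_le_mul (K := (max C1 C2 * Q).toNNReal) fun η η' => ?_).continuous
    rw [Real.coe_toNNReal _ hK, ContinuousMap.dist_le (mul_nonneg hK dist_nonneg)]
    intro x
    have hsub : (fun y => e η y - e η' y) = e (η - η') := by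
      funext y
      exact (mul_sub _ _ _).symm
    have hb : ∀ z, |(η - η') z| ≤ dist η η' := fun z => by
      rw [dist_eq_norm]
      exact (η - η').norm_coe_le_norm z
    have e1 : pot R (e η) x - pot R (e η') x = pot R (e (η - η')) x := by
      rw [← hsub]
      exact cv_sub hk0 hk0s (hec η) (hec η') x
    have e2 : dpot R (e η) x - dpot R (e η') x = dpot R (e (η - η')) x := by
      rw [← hsub]
      exact cv_sub hk1 hk1s (hec η) (hec η') x
    rw [hPapp, hPapp, dist_eq_norm, Prod.mk_sub_mk, e1, e2, Prod.norm_mk]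
    have hd : 0 ≤ Q * dist η η' := mul_nonneg hQ0 dist_nonneg
    refine max_le ((hpotb _ _ dist_nonneg hb x).trans ?_) ((hdpotb _ _ dist_nonneg hb x).trans ?_)
    · show C1 * (Q * dist η η') ≤ max C1 C2 * Q * dist η η'
      rw [mul_assoc]
      exact mul_le_mul_of_nonneg_right (le_max_left _ _) hd
    · show C2 * (Q * dist η η') ≤ max C1 C2 * Q * dist η η'
      rw [mul_assoc]
      exact mul_le_mul_of_nonneg_right (le_max_right _ _) hd
  let Ψ : C(ℝ × (Eu N →L[ℝ] ℝ), ℝ) := ⟨fun z => F z.1 + ‖z.2‖ ^ a,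
    (hF.comp continuous_fst).add
      ((continuous_snd.norm).rpow_const fun _ => Or.inr ha0.le)⟩
  have hΨ : ∀ z, Ψ z = F z.1 + ‖z.2‖ ^ a := fun _ => rfl
  set K0 := max C1 C2 * Q + 1 with hK0
  have hK0p : 0 < K0 := by
    have := mul_nonneg (hC10.trans (le_max_left C1 C2)) hQ0
    linarith
  obtain ⟨s, hs, hs0⟩ := ((eventually_add_rpow_lt ha1 hf' A 1 (inv_pos.2 hK0p)).and
    (eventually_gt_atTop 0)).exists
  set M := K0⁻¹ * s with hM
  have hM0 : 0 < M := by positivity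
  have hKM : K0 * M = s := by rw [hM, mul_inv_cancel_left₀ hK0p.ne']
  have hle1 : C1 * (Q * M) ≤ s := by
    rw [← hKM, hK0, add_mul, ← mul_assoc]
    have := mul_le_mul_of_nonneg_right (mul_le_mul_of_nonneg_right (le_max_left C1 C2) hQ0) hM0.le
    linarith
  have hle2 : C2 * (Q * M) ≤ s := by
    rw [← hKM, hK0, add_mul, ← mul_assoc]
    have := mul_le_mul_of_nonneg_right (mul_le_mul_of_nonneg_right (le_max_right C1 C2) hQ0) hM0.le
    linarith
  let S : X → X := fun η => Ψ.comp (P η)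
  let Cs : Set X := {η | ∀ x, 0 ≤ η x ∧ η x ≤ M}
  have habs : ∀ η ∈ Cs, ∀ z, |η z| ≤ M := fun η hη z => by
    rw [abs_of_nonneg (hη z).1]
    exact (hη z).2
  have hconv : Convex ℝ Cs := by
    intro η hη ζ hζ b c hb hc hbc x
    have h1 := hη x
    have h2 := hζ x
    show 0 ≤ b * η x + c * ζ x ∧ b * η x + c * ζ x ≤ M
    constructor
    · nlinarith [mul_nonneg hb h1.1, mul_nonneg hc h2.1]
    · calc b * η x + c * ζ x ≤ b * M + c * M := by gcongr; exacts [h1.2, h2.2]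
        _ = M := by rw [← add_mul, hbc, one_mul]
  have hclosed : IsClosed Cs := by
    have : Cs = ⋂ x, {η : X | η x ∈ Icc 0 M} := by
      ext η
      simp [Cs]
    rw [this]
    exact isClosed_iInter fun x => isClosed_Icc.preimage (continuous_eval_const x)
  have hmaps : MapsTo S Cs Cs := by
    intro η hη x
    have h1 := hpotb η M hM0.le (habs η hη) x
    have h2 := hdpotb η M hM0.le (habs η hη) x
    have h3 : S η x = F (pot R (e η) x) + ‖dpot R (e η) x‖ ^ a := rfl
    rw [h3]
    refine ⟨add_nonneg (hF0 _) (by positivity), ?_⟩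
    have h4 := hFf _ s (h1.trans hle1)
    have h5 := Real.rpow_le_rpow (norm_nonneg _) (h2.trans hle2) ha0.le
    rw [hM]
    linarith
  have hcomp : IsCompact (closure (P '' Cs)) := by
    refine isCompact_closure_of_locHolder (ι := Subtype.val) isometry_subtype_coe
      (fun _ => ⟨s, ?_⟩) (fun _ => ⟨max (s * (2 * n) ^ (1 - 1 / 2 : ℝ)) (C3 * (Q * M)), ?_⟩)
    · rintro _ ⟨η, hη, rfl⟩ x -
      rw [hPapp, Prod.norm_mk]
      exact max_le ((hpotb η M hM0.le (habs η hη) x).trans hle1)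
        ((hdpotb η M hM0.le (habs η hη) x).trans hle2)
    · rintro _ ⟨η, hη, rfl⟩ x y - -
      rw [hPapp, hPapp, Prod.mk_sub_mk, Prod.norm_mk]
      refine max_le ?_ ?_
      · have h1 : ‖pot R (e η) x - pot R (e η) y‖ ≤ s * ‖(x : Eu N) - y‖ :=
          Convex.norm_image_sub_le_of_norm_hasFDerivWithin_le (𝕜 := ℝ) (s := univ)
            (fun z _ => (hasFDerivAt_pot hN hR (hec η) z).hasFDerivWithinAt)
            (fun z _ => (hdpotb η M hM0.le (habs η hη) z).trans hle2) convex_univ (mem_univ _)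
            (mem_univ _)
        have h2 := rpow_norm_sub_le (α := 1) (β := 1 / 2) (by norm_num) (by norm_num)
          (mem_closedBall_zero_iff.1 x.2) (mem_closedBall_zero_iff.1 y.2)
        rw [Real.rpow_one] at h2
        refine h1.trans ((mul_le_mul_of_nonneg_left h2 hs0.le).trans ?_)
        rw [← mul_assoc]
        exact mul_le_mul_of_nonneg_right (le_max_left _ _) (by positivity)
      · exact (hC3 (e η) (hec η) x y (Q * M) (by positivity)
          fun z _ => heb η M (habs η hη) z).trans
          (mul_le_mul_of_nonneg_right (le_max_right _ _) (by positivity))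
  have hpost : Continuous fun v : C(Metric.closedBall (0 : Eu N) n, ℝ × (Eu N →L[ℝ] ℝ)) =>
    Ψ.comp v := ContinuousMap.continuous_postcomp Ψ
  obtain ⟨η, hη, hfix⟩ := exists_fixedPoint_of_compact hconv hclosed
    ⟨0, fun x => ⟨le_rfl, hM0.le⟩⟩ (hpost.comp hPc).continuousOn hmaps (hcomp.image hpost)
    fun η hη => ⟨P η, subset_closure ⟨η, hη, rfl⟩, rfl⟩
  have hes : ∀ x, n < ‖x‖ → e η x = 0 := fun x hx => by simp only [e, hqs x hx, zero_mul]
  refine ⟨e η, hec η, fun x => mul_nonneg (hq0 x) (hη _).1, hes, fun x => ?_⟩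
  rcases le_or_gt ‖x‖ n with hx | hx
  · have hlt : ‖x‖ + n < R := by rw [hRdef]; linarith
    rw [newt_eq_pot hR hes hlt.le, (hasFDerivAt_newt hN hR (hec η) hes hlt).fderiv]
    have h1 : η (π x) = S η (π x) := congrArg (fun v : X => v (π x)) hfix.symm
    have h2 : S η (π x) = F (pot R (e η) (π x)) + ‖dpot R (e η) (π x)‖ ^ a := rfl
    rw [hπ x hx] at h2
    rw [← h2, ← h1]
  · rw [hes x hx, hqs x hx, zero_mul]

end FixedPoint

section Approximation

variable {N : ℕ} {a γ : ℝ} {g f : ℝ → ℝ} {D : ℝ}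

lemma continuousOn_of_holder (hγ0 : 0 < γ)
    (hf : ∀ s ∈ Ici (0:ℝ), ∀ t ∈ Ici (0:ℝ), |f s - f t| ≤ D * ‖s - t‖ ^ γ) :
    Continuous fun t => f (max t 0) := by
  rw [continuous_iff_continuousAt]
  intro t
  rw [ContinuousAt, tendsto_iff_dist_tendsto_zero]
  have hlim : Tendsto (fun s : ℝ => D * ‖max s 0 - max t 0‖ ^ γ) (nhds t) (nhds 0) := by
    have : ContinuousAt (fun s : ℝ => D * ‖max s 0 - max t 0‖ ^ γ) t :=
      continuousAt_const.mul (ContinuousAt.rpow_const (by fun_prop) (Or.inr hγ0.le))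
    simpa [ContinuousAt, Real.zero_rpow hγ0.ne'] using this
  exact squeeze_zero (fun _ => dist_nonneg)
    (fun s => hf _ (mem_Ici.2 (le_max_right _ _)) _ (mem_Ici.2 (le_max_right _ _))) hlim

lemma min_le_add (hg_pos : ∀ t, 0 < t → 0 < g t) (hg_dec : StrictAntiOn g (Ioi 0))
    (hf0 : ∀ t, 0 ≤ t → 0 ≤ f t) (hfm : MonotoneOn f (Ici 0)) {t δ : ℝ} (ht : 0 ≤ t) (hδ0 : 0 < δ)
    (hδ1 : δ ≤ 1) : min (g 2) (f 1) ≤ g (t + δ) + f t := by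
  rcases le_total t 1 with h | h
  · have h1 := hg_dec.antitoneOn (show t + δ ∈ Ioi 0 from add_pos_of_nonneg_of_pos ht hδ0)
      (mem_Ioi.2 (two_pos : (0:ℝ) < 2)) (by linarith)
    have := hf0 t ht
    linarith [min_le_left (g 2) (f 1)]
  · have h1 := hfm (mem_Ici.2 (zero_le_one : (0:ℝ) ≤ 1)) (mem_Ici.2 ht) h
    have := hg_pos (t + δ) (by linarith)
    linarith [min_le_right (g 2) (f 1)]

/-- Solutions of the regularised problem with a compactly supported weight. -/
lemma exists_approx_solution (hN : 3 ≤ N) (ha0 : 0 < a) (ha1 : a < 1) (hγ0 : 0 < γ) (hγ1 : γ < 1)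
    (hg : ContDiffOn ℝ 1 g (Ioi 0)) (hg_pos : ∀ t, 0 < t → 0 < g t)
    (hg_dec : StrictAntiOn g (Ioi 0)) (hf0 : ∀ t, 0 ≤ t → 0 ≤ f t) (hD0 : 0 ≤ D)
    (hf : ∀ s ∈ Ici (0:ℝ), ∀ t ∈ Ici (0:ℝ), |f s - f t| ≤ D * ‖s - t‖ ^ γ)
    (hfm : MonotoneOn f (Ici 0)) (hf' : Tendsto (fun t => f t / t) atTop (nhds 0))
    {n δ : ℝ} (hn : 0 < n) (hδ0 : 0 < δ) (hδ1 : δ ≤ 1) {q q0 : Eu N → ℝ} (hq : LocHolder γ q)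
    (hq0 : ∀ x, 0 ≤ q x) (hqs : ∀ x, n < ‖x‖ → q x = 0) {y : Eu N} (hy : 0 < q y)
    (hc0 : Continuous q0) (hs0 : ∀ x, n < ‖x‖ → q0 x = 0) (hle : ∀ x, q0 x ≤ q x)
    (hm : 0 ≤ min (g 2) (f 1)) :
    ∃ u : Eu N → ℝ, ContDiff ℝ 2 u ∧ (∀ x, 0 < u x) ∧ Tendsto u (cocompact _) (nhds 0) ∧
      (∀ x, lap u x = -(q x * (g (u x + δ) + f (u x) + ‖fderiv ℝ u x‖ ^ a))) ∧
      ∀ x, min (g 2) (f 1) * newt q0 x ≤ u x := by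
  have hqc := hq.continuous hγ0
  have hpos : ∀ t : ℝ, 0 < max t 0 + δ := fun t => by positivity
  have hgc : Continuous fun t => g (max t 0 + δ) :=
    hg.continuousOn.comp_continuous (by fun_prop) hpos
  have hfc := continuousOn_of_holder hγ0 hf
  obtain ⟨h, hhc, hh0, hhs, hheq⟩ := exists_fixed_density hN ha0 ha1 hn hqc hq0 hqs
    (F := fun t => g (max t 0 + δ) + f (max t 0)) (f := f) (A := g δ) (hgc.add hfc)
    (fun t => add_nonneg (hg_pos _ (hpos t)).le (hf0 _ (le_max_right _ _)))
    (fun s t hst => by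
      have ht : 0 ≤ t := (abs_nonneg s).trans hst
      have h1 := hg_dec.antitoneOn hδ0 (hpos s) (by linarith [le_max_right s 0])
      have h2 := hfm (le_max_right s 0) ht (max_le ((le_abs_self s).trans hst) ht)
      exact add_le_add h1 h2) hf'
  have hu0 : ∀ x, 0 ≤ newt h x := newt_nonneg hN hh0
  have heq : ∀ x, h x = q x * (g (newt h x + δ) + f (newt h x) + ‖fderiv ℝ (newt h) x‖ ^ a) :=
    fun x => by
      have := hheq x
      simp only [max_eq_left (hu0 x)] at this
      exact this
  have hlow : ∀ x, min (g 2) (f 1) * q x ≤ h x := fun x => by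
    rw [heq x, mul_comm]
    refine mul_le_mul_of_nonneg_left ?_ (hq0 x)
    have := min_le_add hg_pos hg_dec hf0 hfm (hu0 x) hδ0 hδ1
    have h2 : 0 ≤ ‖fderiv ℝ (newt h) x‖ ^ a := by positivity
    linarith
  have hu1 : ContDiff ℝ 1 (newt h) := by
    refine contDiff_one_iff_fderiv.2 ⟨fun x => ?_, ?_⟩
    · have hR : 0 < ‖x‖ + |n| + 1 := by positivity
      exact (hasFDerivAt_newt hN hR hhc hhs
        (by linarith [le_abs_self n])).differentiableAt
    · refine continuous_iff_continuousAt.2 fun x => ?_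
      have hR : 0 < ‖x‖ + |n| + 1 := by positivity
      refine (continuous_dpot hN hR hhc).continuousAt.congr ?_
      have := newt_eventuallyEq hR hhs (x := x) (by linarith [le_abs_self n])
      filter_upwards [this.fderiv (𝕜 := ℝ)] with z hz
      rw [hz, fderiv_pot hN hR hhc]
  have hDu : LocHolder (1 / 2) (fderiv ℝ (newt h)) := by
    intro R
    have hR : 0 < |R| + |n| + 1 := by positivity
    obtain ⟨C, hC0, hC⟩ := locHolder_dpot hN hR hhc R
    refine ⟨C, hC0, fun x z hx hz => ?_⟩
    rw [(hasFDerivAt_newt hN hR hhc hhs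
      (by linarith [le_abs_self n, le_abs_self R])).fderiv,
      (hasFDerivAt_newt hN hR hhc hhs (by linarith [le_abs_self n, le_abs_self R])).fderiv]
    exact hC x z hx hz
  have hv : ContDiff ℝ 1 fun x => g (newt h x + δ) :=
    contDiff_iff_contDiffAt.2 fun x => ((hg.contDiffAt (Ioi_mem_nhds
      (show 0 < newt h x + δ from add_pos_of_nonneg_of_pos (hu0 x) hδ0))).comp x
        (hu1.add contDiff_const).contDiffAt)
  have hm' : 0 < min γ (a / 2) := lt_min hγ0 (by linarith)
  have hhH : LocHolder (min γ (a / 2)) h := by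
    have := locHolder_density ha0 ha1 hγ0 hγ1 hD0 hf hq hv hu1 hu0 hDu
    rwa [show (fun x => q x * (g (newt h x + δ) + f (newt h x) + ‖fderiv ℝ (newt h) x‖ ^ a)) = h from
      (funext heq).symm] at this
  refine ⟨newt h, contDiff_newt hN hm' hhH hhs, newt_pos hN hhc hhs hh0 (y := y) ?_,
    tendsto_newt hN hhc hhs hh0, fun x => ?_, fun x => ?_⟩
  · rw [heq y]
    have h1 := hg_pos (newt h y + δ) (add_pos_of_nonneg_of_pos (hu0 y) hδ0)
    have h2 := hf0 _ (hu0 y)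
    positivity
  · rw [lap_newt hN hm' hhH hhs, ← heq x]
  · rw [← newt_const_mul]
    refine newt_mono hN (h := fun y => min (g 2) (f 1) * q0 y) (continuous_const.mul hc0) hhc (n := n)
      (fun z hz => by rw [hs0 z hz, mul_zero]) hhs (fun z => ?_) x
    exact (mul_le_mul_of_nonneg_left (hle z) hm).trans (hlow z)

end Approximation

section Compactness

variable {N : ℕ}

lemma norm_fderiv_sub_le_of_bounds (hN : 3 ≤ N) : ∃ C, 0 ≤ C ∧ ∀ (u : Eu N → ℝ) (B R : ℝ),
    ContDiff ℝ 2 u → 0 ≤ B → (∀ x, ‖x‖ ≤ R + 2 → |u x| ≤ B ∧ |lap u x| ≤ B) →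
    ∀ x y, ‖x‖ ≤ R → ‖y‖ ≤ R →
      ‖fderiv ℝ u x - fderiv ℝ u y‖ ≤ C * B * ‖x - y‖ ^ (1 / 2 : ℝ) := by
  obtain ⟨C1, hC10, hC1⟩ := exists_dpot_holder hN one_pos
  obtain ⟨C2, hC20, hC2⟩ := exists_dsmo_holder hN one_pos
  refine ⟨C1 + C2, by positivity, fun u B R hu hB0 hB x y hx hy => ?_⟩
  have hR : ∀ z, ‖x - z‖ ≤ 2 * 1 ∨ ‖y - z‖ ≤ 2 * 1 → ‖z‖ ≤ R + 2 := by
    rintro z (hz | hz)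
    · linarith [norm_le_norm_add_norm_sub x z]
    · linarith [norm_le_norm_add_norm_sub y z]
  have h1 := hC1 (lap u) (continuous_lap hu) x y B hB0 fun z hz => (hB z (hR z hz)).2
  have h2 := hC2 u hu.continuous x y B hB0 fun z hz => (hB z (hR z hz)).1
  rw [fderiv_eq_dpot_lap hN one_pos hu, fderiv_eq_dpot_lap hN one_pos hu,
    show -dpot 1 (lap u) x - dsmo 1 u x - (-dpot 1 (lap u) y - dsmo 1 u y) =
      -((dpot 1 (lap u) x - dpot 1 (lap u) y) + (dsmo 1 u x - dsmo 1 u y)) by abel, norm_neg]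
  calc _ ≤ _ := norm_add_le _ _
    _ ≤ _ := add_le_add h1 h2
    _ = _ := by ring

lemma norm_sub_le_of_fderiv {u : Eu N → ℝ} {B R : ℝ} (hu : Differentiable ℝ u)
    (hB : ∀ x, ‖x‖ ≤ R → ‖fderiv ℝ u x‖ ≤ B) {x y : Eu N} (hx : ‖x‖ ≤ R) (hy : ‖y‖ ≤ R) :
    ‖u x - u y‖ ≤ B * (2 * R) ^ (1 / 2 : ℝ) * ‖x - y‖ ^ (1 / 2 : ℝ) := by
  have h := (convex_closedBall (0 : Eu N) R).norm_image_sub_le_of_norm_fderiv_le (𝕜 := ℝ) (f := u)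
    (fun z _ => hu z) (fun z hz => hB z (mem_closedBall_zero_iff.1 hz))
    (mem_closedBall_zero_iff.2 hy) (mem_closedBall_zero_iff.2 hx)
  have h2 := rpow_norm_sub_le (α := 1) (β := 1 / 2) (by norm_num) (by norm_num) hx hy
  rw [Real.rpow_one, show (1 - 1 / 2 : ℝ) = 1 / 2 by norm_num] at h2
  have hB0 : 0 ≤ B := (norm_nonneg _).trans (hB x hx)
  rw [mul_assoc]
  exact h.trans (mul_le_mul_of_nonneg_left h2 hB0)

/-- Local bounds on functions, gradients and Laplacians give a subsequence converging
together with its gradients. -/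
lemma exists_convergent_subsequence (hN : 3 ≤ N) {u : ℕ → Eu N → ℝ}
    (hu : ∀ n, ContDiff ℝ 2 (u n))
    (hb : ∀ R, ∃ B, 0 ≤ B ∧ ∀ n x, ‖x‖ ≤ R →
      |u n x| ≤ B ∧ |lap (u n) x| ≤ B ∧ ‖fderiv ℝ (u n) x‖ ≤ B) :
    ∃ (U : Eu N → ℝ) (V : Eu N → Eu N →L[ℝ] ℝ) (s : ℕ → ℕ), StrictMono s ∧
      (∀ x, Tendsto (fun n => u (s n) x) atTop (nhds (U x))) ∧
      (∀ x, Tendsto (fun n => fderiv ℝ (u (s n)) x) atTop (nhds (V x))) ∧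
      (∀ x, HasFDerivAt U (V x) x) ∧ LocHolder (1 / 2) V := by
  have : ProperSpace (Eu N →L[ℝ] ℝ) := FiniteDimensional.proper ℝ _
  obtain ⟨C, hC0, hC⟩ := norm_fderiv_sub_le_of_bounds hN
  have hd : ∀ n, Differentiable ℝ (u n) := fun n => (hu n).differentiable (by norm_num)
  let e : ℕ → C(Eu N, ℝ × (Eu N →L[ℝ] ℝ)) := fun n =>
    ⟨fun x => (u n x, fderiv ℝ (u n) x),
      (hu n).continuous.prodMk ((hu n).continuous_fderiv (by norm_num))⟩
  have hcomp : IsCompact (closure (range e)) := by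
    refine isCompact_closure_of_locHolder (ι := id) isometry_id (fun R => ?_) fun R => ?_
    · obtain ⟨B, hB0, hB⟩ := hb R
      refine ⟨B, ?_⟩
      rintro _ ⟨n, rfl⟩ x hx
      exact max_le (hB n x hx).1 (hB n x hx).2.2
    · obtain ⟨B, hB0, hB⟩ := hb (R + 2)
      refine ⟨max (B * (2 * R) ^ (1 / 2 : ℝ)) (C * B), ?_⟩
      rintro _ ⟨n, rfl⟩ x y hx hy
      simp only [id] at hx hy ⊢
      refine max_le ((norm_sub_le_of_fderiv (hd n) (fun z hz => (hB n z (by linarith)).2.2)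
        hx hy).trans ?_) ((hC (u n) B R (hu n) hB0
          (fun z hz => ⟨(hB n z hz).1, (hB n z hz).2.1⟩) x y hx hy).trans ?_)
      · gcongr
        exact le_max_left _ _
      · gcongr
        exact le_max_right _ _
  obtain ⟨E, -, s, hs, hlim⟩ := hcomp.tendsto_subseq fun n => subset_closure (mem_range_self n)
  have hunif := ContinuousMap.tendsto_iff_tendstoLocallyUniformly.1 hlim
  have hpt : ∀ x, Tendsto (fun n => (u (s n) x, fderiv ℝ (u (s n)) x)) atTop (nhds (E x)) :=
    fun x => ((continuous_eval_const x).tendsto E).comp hlim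
  have hU : ∀ x, Tendsto (fun n => u (s n) x) atTop (nhds (E x).1) := fun x =>
    (continuous_fst.tendsto _).comp (hpt x)
  have hV : ∀ x, Tendsto (fun n => fderiv ℝ (u (s n)) x) atTop (nhds (E x).2) := fun x =>
    (continuous_snd.tendsto _).comp (hpt x)
  have hunif' : TendstoLocallyUniformly (fun n x => fderiv ℝ (u (s n)) x) (fun x => (E x).2)
      atTop := by
    rw [Metric.tendstoLocallyUniformly_iff] at hunif ⊢
    intro ε hε x
    obtain ⟨t, ht, h⟩ := hunif ε hε x
    refine ⟨t, ht, h.mono fun n hn y hy => lt_of_le_of_lt ?_ (hn y hy)⟩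
    exact le_max_right _ _
  refine ⟨fun x => (E x).1, fun x => (E x).2, s, hs, hU, hV, fun x => ?_, fun R => ?_⟩
  · exact hasFDerivAt_of_tendstoLocallyUniformlyOn isOpen_univ
      (tendstoLocallyUniformlyOn_univ.2 hunif')
      (fun n y _ => (hd (s n) y).hasFDerivAt) (fun y _ => hU y) (mem_univ x)
  · obtain ⟨B, hB0, hB⟩ := hb (R + 2)
    refine ⟨C * B, by positivity, fun x y hx hy => ?_⟩
    refine le_of_tendsto ((hV x).sub (hV y)).norm (Eventually.of_forall fun n => ?_)
    exact hC (u (s n)) B R (hu _) hB0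
      (fun z hz => ⟨(hB _ z hz).1, (hB _ z hz).2.1⟩) x y hx hy

end Compactness

section LimitEquation

variable {N : ℕ}

lemma tendsto_cv {F : Type*} [NormedAddCommGroup F] [NormedSpace ℝ F] {K : Eu N → F} {ρ : ℝ}
    (hK : Integrable K) (hs : ∀ z, ρ < ‖z‖ → K z = 0) {k : ℕ → Eu N → ℝ} {h : Eu N → ℝ}
    (hk : ∀ n, Continuous (k n)) (hb : ∀ R, ∃ B, ∀ n x, ‖x‖ ≤ R → |k n x| ≤ B)
    (hlim : ∀ x, Tendsto (fun n => k n x) atTop (nhds (h x))) (x : Eu N) :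
    Tendsto (fun n => cv K (k n) x) atTop (nhds (cv K h x)) := by
  obtain ⟨B, hB⟩ := hb (‖x‖ + ρ)
  refine tendsto_integral_of_dominated_convergence (fun z => B * ‖K z‖)
    (fun n => (integrable_cv hK hs (hk n) x).aestronglyMeasurable) (hK.norm.const_mul B)
    (fun n => Eventually.of_forall fun z => ?_)
    (Eventually.of_forall fun z => (hlim (x - z)).smul_const _)
  rcases le_or_gt ‖z‖ ρ with hz | hz
  · rw [norm_smul]
    exact mul_le_mul_of_nonneg_right (hB n _ ((norm_sub_le _ _).trans (by linarith)))
      (norm_nonneg _)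
  · simp [hs z hz]

lemma pot_pos (hN : 3 ≤ N) {R : ℝ} (hR : 0 < R) {k : Eu N → ℝ} (hk : Continuous k) {x : Eu N}
    (hpos : ∀ z, ‖z‖ ≤ 2 * R → 0 < k (x - z)) : 0 < pot R k x := by
  have hc := fundConst_pos hN
  have hK0 : ∀ z : Eu N, 0 ≤ ker0 (fundConst N) R 0 z := fun z =>
    mul_nonneg hc.le (mul_nonneg (by positivity) (cutoff_nonneg _))
  have hs : ∀ z : Eu N, 2 * R < ‖z‖ → ker0 (fundConst N) R 0 z = 0 :=
    fun z hz => ker0_eq_zero hR le_rfl hz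
  have hint := integrable_cv (integrable_ker0 hN hR (fundConst N)) hs hk x
  rw [pot, cv, integral_pos_iff_support_of_nonneg (fun z => ?_) hint]
  · have := nontrivial_eu (show 1 ≤ N by omega)
    refine (Metric.measure_ball_pos volume (0 : Eu N) hR).trans_le (measure_mono_ae ?_)
    filter_upwards [ae_ne_zero (show 1 ≤ N by omega)] with z hz hmem
    have h1 : ‖z‖ < R := by
      have : z ∈ Metric.ball (0 : Eu N) R := hmem
      simpa using this
    have h2 : 0 < ‖z‖ := norm_pos_iff.2 hz
    have h3 : 0 < ker0 (fundConst N) R 0 z := by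
      rw [ker0, prof, cutoff_eq_one (by positivity) (by nlinarith)]
      positivity
    exact (mul_pos (hpos z (by linarith)) h3).ne'
  · rcases le_or_gt ‖z‖ (2 * R) with hz | hz
    · exact mul_nonneg (hpos z hz).le (hK0 z)
    · simp [hs z hz]

lemma exists_pot_pos (hN : 3 ≤ N) {k : Eu N → ℝ} (hk : Continuous k) {x : Eu N} (hx : 0 < k x) :
    ∃ R, 0 < R ∧ 0 < pot R k x := by
  have h1 : Tendsto (fun z : Eu N => k (x - z)) (nhds 0) (nhds (k x)) := by
    have : Continuous fun z : Eu N => k (x - z) := by fun_prop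
    simpa using this.tendsto 0
  obtain ⟨ε, hε, h⟩ := Metric.eventually_nhds_iff.1 (h1.eventually_const_lt hx)
  refine ⟨ε / 4, by positivity, pot_pos hN (by positivity) hk fun z hz => h ?_⟩
  rw [dist_zero_right]
  linarith

lemma eq_zero_of_pot_eq_zero (hN : 3 ≤ N) {k : Eu N → ℝ} (hk : Continuous k) {x : Eu N}
    (h : ∀ R, 0 < R → pot R k x = 0) : k x = 0 := by
  rcases lt_trichotomy (k x) 0 with hx | hx | hx
  · obtain ⟨R, hR, h1⟩ := exists_pot_pos hN (k := fun y => -k y) hk.neg (x := x) (by linarith)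
    have h2 : pot R (fun y => -k y) x = -pot R k x := by
      simp only [pot, cv, neg_smul, integral_neg]
    rw [h2, h R hR] at h1
    simp at h1
  · exact hx
  · obtain ⟨R, hR, h1⟩ := exists_pot_pos hN hk hx
    exact absurd (h R hR) h1.ne'

/-- A locally Hölder solution of the integral equation is a classical solution. -/
lemma contDiff_of_eq_pot (hN : 3 ≤ N) {α : ℝ} (hα : 0 < α) {U h : Eu N → ℝ} (hU : Continuous U)
    (hh : LocHolder α h) (heq : ∀ R, 0 < R → ∀ x, U x = pot R h x - smo R U x) :
    ContDiff ℝ 2 U ∧ ∀ x, lap U x = -h x := by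
  have hU2 : ContDiff ℝ 2 U := by
    have := (contDiff_pot hN one_pos hα hh).sub (contDiff_smo one_pos hU)
    have h1 : U = fun x => pot 1 h x - smo 1 U x := funext (heq 1 one_pos)
    rwa [← h1] at this
  have hl := continuous_lap hU2
  have hhc := hh.continuous hα
  refine ⟨hU2, fun x => ?_⟩
  have : h x - -lap U x = 0 := by
    refine eq_zero_of_pot_eq_zero hN (k := fun y => h y - -lap U y) (hhc.sub hl.neg) fun R hR => ?_
    have h1 := heq R hR x
    have h2 := eq_pot_lap hN hR hU2 x
    have h3 := cv_sub (integrable_ker0 hN hR (fundConst N)) (ρ := 2 * R)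
      (fun z hz => ker0_eq_zero hR le_rfl hz) hhc hl.neg x
    have h4 : pot R (fun y => -lap U y) x = -pot R (lap U) x := by
      simp only [pot, cv, neg_smul, integral_neg]
    have h5 : pot R h x - pot R (fun y => -lap U y) x = pot R (fun y => h y - -lap U y) x := h3
    rw [← h5, h4]
    linarith
  linarith

/-- Passage to the limit in the equation, from pointwise convergence and local bounds. -/
lemma eq_pot_of_tendsto (hN : 3 ≤ N) {u : ℕ → Eu N → ℝ} (hu : ∀ n, ContDiff ℝ 2 (u n))
    (hb : ∀ R, ∃ B, 0 ≤ B ∧ ∀ n x, ‖x‖ ≤ R →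
      |u n x| ≤ B ∧ |lap (u n) x| ≤ B ∧ ‖fderiv ℝ (u n) x‖ ≤ B) {U h : Eu N → ℝ}
    (hU : ∀ x, Tendsto (fun n => u n x) atTop (nhds (U x)))
    (hh : ∀ x, Tendsto (fun n => -lap (u n) x) atTop (nhds (h x))) {R : ℝ} (hR : 0 < R)
    (x : Eu N) : U x = pot R h x - smo R U x := by
  have h1 := tendsto_cv (integrable_ker0 hN hR (fundConst N)) (ρ := 2 * R)
    (fun z hz => ker0_eq_zero hR le_rfl hz) (k := fun n y => -lap (u n) y)
    (fun n => (continuous_lap (hu n)).neg) (fun r => by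
      obtain ⟨B, -, hB⟩ := hb r
      exact ⟨B, fun n y hy => by simpa using (hB n y hy).2.1⟩) hh x
  have h2 := tendsto_cv (integrable_kerLap hR (fundConst N)) (ρ := 2 * R)
    (fun z hz => kerLap_eq_zero hR hz) (k := u) (fun n => (hu n).continuous) (fun r => by
      obtain ⟨B, -, hB⟩ := hb r
      exact ⟨B, fun n y hy => (hB n y hy).1⟩) hU x
  refine tendsto_nhds_unique (hU x) ((h1.sub h2).congr fun n => ?_)
  rw [eq_pot_lap hN hR (hu n) x]
  simp only [pot, smo, cv, neg_smul, integral_neg]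

end LimitEquation

section GroundState

variable {N : ℕ}

/-- A continuous cutoff equal to one on the ball of radius `c - 1`, vanishing off the ball of
radius `c`. -/
noncomputable def ramp (c : ℝ) (x : Eu N) : ℝ := max 0 (min 1 (c - ‖x‖))

lemma ramp_nonneg (c : ℝ) (x : Eu N) : 0 ≤ ramp c x := le_max_left _ _

lemma ramp_le_one (c : ℝ) (x : Eu N) : ramp c x ≤ 1 := max_le zero_le_one (min_le_left _ _)

lemma ramp_mono {c d : ℝ} (h : c ≤ d) (x : Eu N) : ramp c x ≤ ramp d x :=
  max_le_max le_rfl (min_le_min le_rfl (by linarith))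

lemma ramp_eq_zero {c : ℝ} {x : Eu N} (h : c < ‖x‖) : ramp c x = 0 :=
  max_eq_left ((min_le_right _ _).trans (by linarith))

lemma ramp_eq_one {c : ℝ} {x : Eu N} (h : ‖x‖ + 1 ≤ c) : ramp c x = 1 := by
  rw [ramp, min_eq_left (by linarith), max_eq_right zero_le_one]

lemma locHolder_ramp (c : ℝ) {α : ℝ} (hα0 : 0 < α) (hα1 : α ≤ 1) :
    LocHolder α (ramp c : Eu N → ℝ) := by
  refine LocHolder.mono (α := 1) (fun R => ⟨1, zero_le_one, fun x y _ _ => ?_⟩) hα0.le hα1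
  rw [Real.rpow_one, one_mul]
  have h1 := abs_norm_sub_norm_le x y
  have h2 : |ramp c x - ramp c y| ≤ |‖x‖ - ‖y‖| := by
    unfold ramp
    rcases max_cases 0 (min 1 (c - ‖x‖)) with h | h <;>
    rcases max_cases 0 (min 1 (c - ‖y‖)) with h' | h' <;>
    rcases min_cases 1 (c - ‖x‖) with k | k <;>
    rcases min_cases 1 (c - ‖y‖) with k' | k' <;>
    rw [h.1, h'.1] <;>
    rcases abs_cases (‖x‖ - ‖y‖) with l | l <;>
    rw [abs_le] <;> constructor <;> linarith
  exact h2.trans h1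

/-- A priori local bounds for solutions bounded from below by a fixed positive function. -/
lemma exists_local_bounds (hN : 3 ≤ N) {a : ℝ} (ha0 : 0 < a) (ha1 : a < 1) {g f : ℝ → ℝ}
    (hg_pos : ∀ t, 0 < t → 0 < g t) (hg_dec : StrictAntiOn g (Ioi 0))
    (hf0 : ∀ t, 0 ≤ t → 0 ≤ f t) (hfm : MonotoneOn f (Ici 0)) {p ψ : Eu N → ℝ}
    (hp : Continuous p) (hψ : Continuous ψ) (hψ0 : ∀ x, 0 < ψ x) {M : ℝ} (hM : 0 ≤ M)
    {ι : Type*} {u q : ι → Eu N → ℝ} {δ : ι → ℝ} (hu : ∀ n, ContDiff ℝ 2 (u n))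
    (hq0 : ∀ n x, 0 ≤ q n x) (hqp : ∀ n x, q n x ≤ p x) (hδ : ∀ n, 0 < δ n)
    (hψu : ∀ n x, ψ x ≤ u n x) (huM : ∀ n x, u n x ≤ M)
    (heq : ∀ n x,
      lap (u n) x = -(q n x * (g (u n x + δ n) + f (u n x) + ‖fderiv ℝ (u n) x‖ ^ a)))
    (R : ℝ) : ∃ B, 0 ≤ B ∧ ∀ n x, ‖x‖ ≤ R →
      |u n x| ≤ B ∧ |lap (u n) x| ≤ B ∧ ‖fderiv ℝ (u n) x‖ ≤ B := by
  set ρ : ℝ := 2 * (|R| + 1) with hρ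
  have hρ0 : 0 < ρ := by positivity
  obtain ⟨z, -, hz⟩ := (isCompact_closedBall (0 : Eu N) ρ).exists_isMinOn
    ⟨0, Metric.mem_closedBall_self hρ0.le⟩ hψ.continuousOn
  obtain ⟨P, hP0, hP⟩ := exists_bound_of_continuous hp ρ
  have hpos : ∀ n x, 0 < u n x := fun n x => (hψ0 x).trans_le (hψu n x)
  have hg0 := hg_pos _ (hψ0 z)
  have hfM := hf0 M hM
  have hlap : ∀ n x, ‖x‖ ≤ ρ →
      |lap (u n) x| ≤ P * (g (ψ z) + f M) + P * ‖fderiv ℝ (u n) x‖ ^ a := fun n x hx => by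
    have h1 : g (u n x + δ n) ≤ g (ψ z) := hg_dec.antitoneOn (mem_Ioi.2 (hψ0 z))
      (mem_Ioi.2 (add_pos (hpos n x) (hδ n)))
      (by linarith [isMinOn_iff.1 hz x (mem_closedBall_zero_iff.2 hx), hψu n x, hδ n])
    have h2 : f (u n x) ≤ f M := hfm (mem_Ici.2 (hpos n x).le) (mem_Ici.2 hM) (huM n x)
    have h3 : q n x ≤ P := (hqp n x).trans ((le_abs_self _).trans (hP x hx))
    have h4 := hg_pos _ (add_pos (hpos n x) (hδ n))
    have h5 := hf0 _ (hpos n x).le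
    have h6 := hq0 n x
    rw [heq, abs_neg, abs_of_nonneg (by positivity), ← mul_add]
    gcongr
  obtain ⟨B, hB0, hB⟩ := exists_norm_fderiv_le_of_sublinear hN ha0 ha1 hρ0
    (show 0 ≤ P * (g (ψ z) + f M) by positivity) hP0 hM
  have hD : ∀ n x, ‖x‖ ≤ R → ‖fderiv ℝ (u n) x‖ ≤ B := fun n x hx =>
    hB (u n) (hu n) (fun y hy => ⟨by
      rw [abs_of_pos (hpos n y)]
      exact huM n y, hlap n y hy⟩) x (by rw [hρ]; linarith [le_abs_self R])
  refine ⟨M + B + (P * (g (ψ z) + f M) + P * B ^ a), by positivity, fun n x hx => ⟨?_, ?_, ?_⟩⟩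
  · rw [abs_of_pos (hpos n x)]
    have : 0 ≤ B + (P * (g (ψ z) + f M) + P * B ^ a) := by positivity
    linarith [huM n x]
  · have h1 := hlap n x (by rw [hρ]; linarith [le_abs_self R, abs_nonneg R])
    have h2 : ‖fderiv ℝ (u n) x‖ ^ a ≤ B ^ a := Real.rpow_le_rpow (norm_nonneg _) (hD n x hx) ha0.le
    have h3 := mul_le_mul_of_nonneg_left h2 hP0
    linarith
  · have : 0 ≤ M + (P * (g (ψ z) + f M) + P * B ^ a) := by positivity
    linarith [hD n x hx]

lemma tendsto_zero_of_convex_transform {X : Type*} {l : Filter X} {g G : ℝ → ℝ}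
    (hg_pos : ∀ t, 0 < t → 0 < g t) (hGp : ∀ t, 0 < t → 0 < G t)
    (hG : ∀ s t, 0 < s → (g s + 1)⁻¹ * (t - s) ≤ G t - G s) {U w : X → ℝ} {C : ℝ}
    (hU0 : ∀ x, 0 < U x) (hw : Tendsto w l (nhds 0)) (hUw : ∀ x, G (U x) ≤ C * w x) :
    Tendsto U l (nhds 0) := by
  have hlim : Tendsto (fun x => C * w x) l (nhds 0) := by simpa using hw.const_mul C
  refine tendsto_order.2 ⟨fun b hb => Eventually.of_forall fun x => hb.trans (hU0 x),
    fun ε hε => ?_⟩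
  filter_upwards [hlim.eventually_lt_const (hGp ε hε)] with x hx
  by_contra! hlt
  have h1 := hG ε (U x) hε
  have h2 : 0 ≤ (g ε + 1)⁻¹ * (U x - ε) :=
    mul_nonneg (inv_nonneg.2 (by linarith [hg_pos ε hε])) (by linarith)
  linarith [hUw x]

/-- Existence of a positive decaying solution, given a positive decaying supersolution `w` of
the linear problem. -/
lemma exists_positive_decaying_solution (hN : 3 ≤ N) {a γ : ℝ} (ha0 : 0 < a) (ha1 : a < 1)
    (hγ0 : 0 < γ) (hγ1 : γ < 1) {g f : ℝ → ℝ} {D : ℝ} (hg : ContDiffOn ℝ 1 g (Ioi 0))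
    (hg_pos : ∀ t, 0 < t → 0 < g t) (hg_dec : StrictAntiOn g (Ioi 0))
    (hf_pos : ∀ t, 0 < t → 0 < f t) (hf0 : ∀ t, 0 ≤ t → 0 ≤ f t) (hD0 : 0 ≤ D)
    (hf : ∀ s ∈ Ici (0:ℝ), ∀ t ∈ Ici (0:ℝ), |f s - f t| ≤ D * ‖s - t‖ ^ γ)
    (hfm : MonotoneOn f (Ici 0)) (hf' : Tendsto (fun t => f t / t) atTop (nhds 0))
    {p w : Eu N → ℝ} (hp : LocHolder γ p) (hp0 : ∀ x, 0 < p x) {L : ℝ} (hw : ContDiff ℝ 2 w)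
    (hw0 : ∀ x, 0 ≤ w x) (hwl : Tendsto w (cocompact _) (nhds 0)) (hwp : ∀ x, lap w x ≤ -p x)
    (hL0 : 0 ≤ L) (hL : ∀ x, ‖fderiv ℝ w x‖ ≤ L) :
    ∃ U : Eu N → ℝ, ContDiff ℝ 2 U ∧ (∀ x, 0 < U x) ∧ Tendsto U (cocompact _) (nhds 0) ∧
      ∀ x, -lap U x = p x * (g (U x) + f (U x) + ‖fderiv ℝ U x‖ ^ a) := by
  obtain ⟨G, hGc, hG1, hGp, hG⟩ := exists_convex_transform hg_pos hg_dec
  obtain ⟨M, C, hM0, hC0, hMC⟩ := exists_apriori_bound ha0 ha1 hg_pos hf0 hfm hf' hGc hG1 hGp hG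
    hw hw0 hwl hp0 hwp hL0 hL
  have hpc := hp.continuous hγ0
  have hc0 : 0 < min (g 2) (f 1) := lt_min (hg_pos _ two_pos) (hf_pos _ one_pos)
  let q : ℕ → Eu N → ℝ := fun n x => p x * ramp ((n : ℝ) + 2) x
  have hqH : ∀ n, LocHolder γ (q n) := fun n => hp.mul hγ0 (locHolder_ramp _ hγ0 hγ1.le)
  have hq0 : ∀ n x, 0 ≤ q n x := fun n x => mul_nonneg (hp0 x).le (ramp_nonneg _ _)
  have hqp : ∀ n x, q n x ≤ p x := fun n x => mul_le_of_le_one_right (hp0 x).le (ramp_le_one _ _)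
  have hqs : ∀ (n : ℕ) x, (n : ℝ) + 2 < ‖x‖ → q n x = 0 := fun n x hx => by
    simp only [q, ramp_eq_zero hx, mul_zero]
  have hqm : ∀ n x, q 0 x ≤ q n x := fun n x =>
    mul_le_mul_of_nonneg_left (ramp_mono (by simp) x) (hp0 x).le
  have hqy : ∀ n, 0 < q n 0 := fun n => by
    have : ramp ((n : ℝ) + 2) (0 : Eu N) = 1 :=
      ramp_eq_one (by rw [norm_zero]; linarith [Nat.cast_nonneg (α := ℝ) n])
    simp only [q, this, mul_one, hp0]
  have hqc := (hqH 0).continuous hγ0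
  let δ : ℕ → ℝ := fun n => 1 / ((n : ℝ) + 1)
  have hδ0 : ∀ n, 0 < δ n := fun n => Nat.one_div_pos_of_nat
  have hδ1 : ∀ n, δ n ≤ 1 := fun n => by
    rw [div_le_one (by positivity)]
    linarith [Nat.cast_nonneg (α := ℝ) n]
  have hsol : ∀ n : ℕ, _ := fun n => exists_approx_solution hN ha0 ha1 hγ0 hγ1 hg hg_pos hg_dec hf0 hD0
    hf hfm hf' (n := (n : ℝ) + 2) (by positivity) (hδ0 n) (hδ1 n) (hqH n) (hq0 n) (hqs n) (hqy n)
    hqc (fun x hx => hqs 0 x (by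
      have := Nat.cast_nonneg (α := ℝ) n
      push_cast
      linarith)) (hqm n) hc0.le
  choose u hu hupos hul heq hlow using hsol
  have hap : ∀ n x, u n x ≤ M ∧ G (u n x) ≤ C * w x := fun n =>
    hMC (u n) (hu n) (hupos n) (hul n) fun x => by
      rw [heq, neg_neg]
      have h1 : g (u n x + δ n) ≤ g (u n x) := hg_dec.antitoneOn (mem_Ioi.2 (hupos n x))
        (mem_Ioi.2 (add_pos (hupos n x) (hδ0 n))) (by linarith [hδ0 n])
      have h2 := hg_pos _ (add_pos (hupos n x) (hδ0 n))
      have h3 := hf0 _ (hupos n x).le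
      have h4 := hqp n x
      have h5 := (hp0 x).le
      gcongr
  let ψ : Eu N → ℝ := fun x => min (g 2) (f 1) * newt (q 0) x
  have hψ0 : ∀ x, 0 < ψ x := fun x =>
    mul_pos hc0 (newt_pos hN hqc (hqs 0) (hq0 0) (hqy 0) x)
  have hψc : Continuous ψ :=
    continuous_const.mul (contDiff_newt hN hγ0 (hqH 0) (hqs 0)).continuous
  have hb := exists_local_bounds hN ha0 ha1 hg_pos hg_dec hf0 hfm hpc hψc hψ0 hM0 hu hq0 hqp hδ0
    hlow (fun n x => (hap n x).1) heq
  obtain ⟨U, V, s, hs, hU, hV, hUV, hVH⟩ := exists_convergent_subsequence hN hu hb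
  have hUψ : ∀ x, ψ x ≤ U x := fun x =>
    ge_of_tendsto (hU x) (Eventually.of_forall fun n => hlow (s n) x)
  have hU0 : ∀ x, 0 < U x := fun x => (hψ0 x).trans_le (hUψ x)
  have hUG : ∀ x, G (U x) ≤ C * w x := fun x =>
    le_of_tendsto ((hGc.tendsto _).comp (hU x)) (Eventually.of_forall fun n => (hap (s n) x).2)
  have hVf : fderiv ℝ U = V := funext fun x => (hUV x).fderiv
  have hVc : Continuous V := hVH.continuous (by norm_num)
  have hU1 : ContDiff ℝ 1 U := contDiff_one_iff_fderiv.2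
    ⟨fun x => (hUV x).differentiableAt, hVf ▸ hVc⟩
  have hgU : ContDiff ℝ 1 fun x => g (U x) := contDiff_iff_contDiffAt.2 fun x =>
    (hg.contDiffAt (Ioi_mem_nhds (hU0 x))).comp x hU1.contDiffAt
  have hm : 0 < min γ (a / 2) := lt_min hγ0 (by linarith)
  have hhH := locHolder_density ha0 ha1 hγ0 hγ1 hD0 hf hp hgU hU1 (fun x => (hU0 x).le) hVH
  have hlim : ∀ x, Tendsto (fun n => -lap (u (s n)) x) atTop
      (nhds (p x * (g (U x) + f (U x) + ‖V x‖ ^ a))) := fun x => by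
    have h1 : Tendsto (fun n => q (s n) x) atTop (nhds (p x)) := by
      refine tendsto_const_nhds.congr' ?_
      have h := (tendsto_natCast_atTop_atTop (R := ℝ)).comp hs.tendsto_atTop
      filter_upwards [h.eventually_ge_atTop ‖x‖] with n hn
      have hn' : ‖x‖ ≤ (s n : ℝ) := hn
      simp only [q]
      rw [ramp_eq_one (by linarith), mul_one]
    have h2 : Tendsto (fun n => δ (s n)) atTop (nhds 0) :=
      (tendsto_one_div_add_atTop_nhds_zero_nat (𝕜 := ℝ)).comp hs.tendsto_atTop
    have h3 : Tendsto (fun n => g (u (s n) x + δ (s n))) atTop (nhds (g (U x))) := by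
      have hc : ContinuousAt g (U x) := (hg.contDiffAt (Ioi_mem_nhds (hU0 x))).continuousAt
      have h := (hU x).add h2
      rw [add_zero] at h
      exact hc.tendsto.comp h
    have h4 : Tendsto (fun n => f (u (s n) x)) atTop (nhds (f (U x))) := by
      have h := ((continuousOn_of_holder hγ0 hf).tendsto (U x)).comp (hU x)
      simpa only [Function.comp_def, max_eq_left (hU0 x).le, max_eq_left (hupos _ x).le] using h
    have h5 : Tendsto (fun n => ‖fderiv ℝ (u (s n)) x‖ ^ a) atTop (nhds (‖V x‖ ^ a)) :=
      (hV x).norm.rpow_const (Or.inr ha0.le)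
    refine (h1.mul ((h3.add h4).add h5)).congr fun n => ?_
    rw [heq, neg_neg]
  obtain ⟨hU2, hUeq⟩ := contDiff_of_eq_pot hN hm hU1.continuous hhH fun R hR =>
    eq_pot_of_tendsto hN (fun n => hu (s n)) (fun r => by
      obtain ⟨B, hB0, hB⟩ := hb r
      exact ⟨B, hB0, fun n => hB (s n)⟩) hU hlim hR
  refine ⟨U, hU2, hU0, tendsto_zero_of_convex_transform hg_pos hGp hG hU0 hwl hUG, fun x => ?_⟩
  rw [hUeq, neg_neg, hVf]

end GroundState

lemma laplacianFn_eq_lap {N : ℕ} {u : Eu N → ℝ} (hu : ContDiff ℝ 2 u) (x : Eu N) :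
    laplacianFn u x = lap u x := by
  have hd : DifferentiableAt ℝ (fderiv ℝ u) x :=
    ((hu.fderiv_right (m := 1) (by norm_num)).differentiable one_ne_zero) x
  rw [lap_eq_sum]
  exact Finset.sum_congr rfl fun i _ => fderiv_fderiv_apply hd _ _

lemma norm_gradient {N : ℕ} (u : Eu N → ℝ) (x : Eu N) : ‖gradient u x‖ = ‖fderiv ℝ u x‖ :=
  LinearIsometryEquiv.norm_map _ _

lemma abs_sub_le_of_holderOnWith {E : Type*} [NormedAddCommGroup E] {h : E → ℝ} {C : NNReal}
    {γ : ℝ} (hγ : 0 ≤ γ) {s : Set E} (hh : HolderOnWith C (Real.toNNReal γ) h s) {x y : E}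
    (hx : x ∈ s) (hy : y ∈ s) : |h x - h y| ≤ C * ‖x - y‖ ^ γ := by
  have := hh.dist_le hx hy
  rwa [Real.coe_toNNReal γ hγ, dist_eq_norm, dist_eq_norm] at this

/-- existence of a ground state solution of
`-Δu = p(x)(g(u) + f(u) + |∇u|^a)` in `ℝ^N`, `u > 0`, `u(x) → 0` as `|x| → ∞`. -/
theorem ground_state_existence
    {N : ℕ} (hN : 3 ≤ N) (a γ : ℝ) (ha0 : 0 < a) (ha1 : a < 1)
    (hγ0 : 0 < γ) (hγ1 : γ < 1)
    (p : EuclideanSpace ℝ (Fin N) → ℝ)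
    (hp_pos : ∀ x, 0 < p x)
    (hp_holder : ∃ C : NNReal, HolderWith C (Real.toNNReal γ) p)
    (g : ℝ → ℝ)
    (hg_smooth : ContDiffOn ℝ 1 g (Ioi 0))
    (hg_pos : ∀ t > (0:ℝ), 0 < g t)
    (hg_dec : StrictAntiOn g (Ioi 0))
    (hg1 : Tendsto g (nhdsWithin 0 (Ioi 0)) atTop)
    (f : ℝ → ℝ)
    (hf_nonneg : ∀ t ≥ (0:ℝ), 0 ≤ f t)
    (hf_holder : ∃ C : NNReal, HolderOnWith C (Real.toNNReal γ) f (Ici 0))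
    (hf_mono : MonotoneOn f (Ici 0))
    (hf_pos : ∀ t > (0:ℝ), 0 < f t)
    (hf1 : AntitoneOn (fun t => f t / t) (Ioi 0))
    (hf2 : Tendsto (fun t => f t / t) (nhdsWithin 0 (Ioi 0)) atTop)
    (hf2' : Tendsto (fun t => f t / t) atTop (nhds 0))
    (φ : ℝ → ℝ)
    (hφ_max : ∀ r ≥ (0:ℝ), IsGreatest (p '' {x | ‖x‖ = r}) (φ r))
    (hφ_int : IntegrableOn (fun t => t * φ t) (Ioi 1)) :
    ∃ u : EuclideanSpace ℝ (Fin N) → ℝ,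
      ContDiff ℝ 2 u ∧
      (∀ x, 0 < u x) ∧
      Tendsto u (cocompact _) (nhds 0) ∧
      (∀ x, -laplacianFn u x = p x * (g (u x) + f (u x) + ‖gradient u x‖ ^ a)) := by
  obtain ⟨Cp, hCp⟩ := hp_holder
  obtain ⟨Cf, hCf⟩ := hf_holder
  obtain ⟨Φ, hΦc, hΦ0, ⟨c, hΦ1⟩, hΦi, hpΦ⟩ :=
    exists_majorant (Real.toNNReal_pos.2 hγ0) hp_pos hCp hφ_max hφ_int
  obtain ⟨w, hw, hw0, hwl, hwΦ, L, hL0, hL⟩ := exists_supersolution hN hΦc hΦ0 hΦ1 hΦi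
  have hpH : LocHolder γ p := fun _ => ⟨Cp, Cp.2, fun x y _ _ =>
    abs_sub_le_of_holderOnWith hγ0.le (hCp.holderOnWith univ) (mem_univ x) (mem_univ y)⟩
  obtain ⟨u, hu, hu0, hul, hueq⟩ := exists_positive_decaying_solution hN ha0 ha1 hγ0 hγ1 hg_smooth
    hg_pos hg_dec hf_pos hf_nonneg Cf.2
    (fun s hs t ht => abs_sub_le_of_holderOnWith hγ0.le hCf hs ht) hf_mono hf2' hpH hp_pos hw hw0
    hwl (fun x => (hwΦ x).trans (neg_le_neg (hpΦ x))) hL0 hL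
  refine ⟨u, hu, hu0, hul, fun x => ?_⟩
  rw [laplacianFn_eq_lap hu, norm_gradient]
  exact hueq x
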